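/- There exists a finite Galois extension L of ℚ, ramified only at 5, whose Galois group Gal(L/ℚ) is isomorphic to a semidirect product (PSL₂(F₅))⁵ ⋊ ℤ/10ℤ for some action of ℤ/10ℤ on the direct product of 5 copies of PSL₂(F₅); in particular Gal(L/ℚ) is not solvable. Moreover L can be taken with |disc(L)|^20 ≤ 5^(61·[L:ℚ]) (root discriminant at most 5^(61/20) < 135.48). -/

import Mathlib

instance : Fact (Nat.Prime 5) := ⟨by norm_num⟩

/-- `PSL₂(F)`: the quotient of `SL₂(F)` by its center. -/
abbrev PSL2 (F : Type) [Field F] : Type :=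
  (Matrix.SpecialLinearGroup (Fin 2) F) ⧸ Subgroup.center (Matrix.SpecialLinearGroup (Fin 2) F)

section LocalMonogenic
open NumberField
variable {L : Type} [Field L] [NumberField L]

theorem exists_generator_mod (P : Ideal (𝓞 L)) [P.IsPrime] (hP : P ≠ ⊥) :
    ∃ (q : ℕ) (x : 𝓞 L), 2 ≤ q ∧ (q : 𝓞 L) ∈ P ∧ x ∉ P ∧ x ^ q - x ∈ P ∧
      ∀ y, y ∈ P ∨ ∃ n : ℕ, y - x ^ n ∈ P := by
  have hM : P.IsMaximal := Ideal.IsPrime.isMaximal ‹_› hP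
  let : Field (𝓞 L ⧸ P) := Ideal.Quotient.field P
  have : Finite (𝓞 L ⧸ P) := Ideal.finiteQuotientOfFreeOfNeBot P hP
  let := Fintype.ofFinite (𝓞 L ⧸ P)
  obtain ⟨u, hu⟩ := IsCyclic.exists_generator (α := (𝓞 L ⧸ P)ˣ)
  obtain ⟨x, hx⟩ := Ideal.Quotient.mk_surjective (I := P) (u : 𝓞 L ⧸ P)
  refine ⟨Fintype.card (𝓞 L ⧸ P), x, Fintype.one_lt_card, ?_, ?_, ?_, ?_⟩
  · rw [← Ideal.Quotient.eq_zero_iff_mem, map_natCast]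
    exact FiniteField.cast_card_eq_zero _
  · rw [← Ideal.Quotient.eq_zero_iff_mem, hx]
    exact u.ne_zero
  · rw [← Ideal.Quotient.eq_zero_iff_mem, map_sub, map_pow, FiniteField.pow_card, sub_self]
  · intro y
    by_cases hy : y ∈ P
    · exact Or.inl hy
    · right
      rw [← Ideal.Quotient.eq_zero_iff_mem] at hy
      obtain ⟨n, hn⟩ := (mem_powers_iff_mem_zpowers (x := u)).2 (hu (Units.mk0 _ hy))
      refine ⟨n, ?_⟩
      rw [← Ideal.Quotient.eq_zero_iff_mem, map_sub, map_pow, hx]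
      have := congrArg Units.val hn
      simp only [Units.val_pow_eq_pow_val, Units.val_mk0] at this
      rw [this, sub_self]

theorem pow_sub_self_add_sub_mem {P : Ideal (𝓞 L)} {q : ℕ}
    (hq : (q : 𝓞 L) ∈ P) {x y : 𝓞 L} (hy : y ∈ P) :
    (x + y) ^ q - (x + y) - (x ^ q - x - y) ∈ P ^ 2 := by
  obtain ⟨k, hk⟩ := Polynomial.binomExpansion (Polynomial.X ^ q : Polynomial (𝓞 L)) x y
  simp only [Polynomial.eval_pow, Polynomial.eval_X, Polynomial.derivative_X_pow,
    Polynomial.eval_mul, Polynomial.eval_natCast, map_natCast] at hk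
  have : (x + y) ^ q - (x + y) - (x ^ q - x - y) = (q : 𝓞 L) * y * x ^ (q - 1) + k * y ^ 2 := by
    rw [hk]; ring
  rw [this, sq]
  exact add_mem (Ideal.mul_mem_right _ _ (Ideal.mul_mem_mul hq hy))
    (Ideal.mul_mem_left _ _ (by rw [sq]; exact Ideal.mul_mem_mul hy hy))


theorem exists_localUniformizer_generator (P : Ideal (𝓞 L)) [P.IsPrime] (hP : P ≠ ⊥) :
    ∃ (q : ℕ) (x : 𝓞 L), 2 ≤ q ∧ (q : 𝓞 L) ∈ P ∧ x ∉ P ∧ x ^ q - x ∈ P ∧ x ^ q - x ∉ P ^ 2 ∧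
      (∀ y, y ∈ P ∨ ∃ n : ℕ, y - x ^ n ∈ P) ∧
      ∀ Q : Ideal (𝓞 L), Q.IsPrime → (q : 𝓞 L) ∈ Q → Q ≠ P → x ∈ Q := by
  obtain ⟨q, x₀, h2, hq, hx₀, hxq, hgen⟩ := exists_generator_mod P hP
  have hPp : Prime P := Ideal.prime_of_isPrime hP ‹_›
  obtain ⟨x₁, hx₁, hx₁q⟩ : ∃ x₁, x₁ - x₀ ∈ P ∧ x₁ ^ q - x₁ ∉ P ^ 2 := by
    by_cases h : x₀ ^ q - x₀ ∈ P ^ 2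
    · have hlt : P ^ 2 < P := by
        simpa using Ideal.pow_right_strictAnti P hP (Ideal.IsPrime.ne_top ‹_›) one_lt_two
      obtain ⟨π, hπ, hπ2⟩ := SetLike.exists_of_lt hlt
      refine ⟨x₀ + π, by simpa using hπ, fun h' => hπ2 ?_⟩
      have := sub_mem (add_mem (pow_sub_self_add_sub_mem hq (x := x₀) hπ) h) h'
      convert this using 1
      ring
    · exact ⟨x₀, by simp, h⟩
  have hq0 : (Ideal.span {(q : 𝓞 L)}) ≠ ⊥ := by
    rw [Ne, Ideal.span_singleton_eq_bot]
    exact_mod_cast (by omega : q ≠ 0)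
  have hfin : {Q : Ideal (𝓞 L) | Q ∣ Ideal.span {(q : 𝓞 L)}}.Finite :=
    Set.finite_coe_iff.mp (UniqueFactorizationMonoid.fintypeSubtypeDvd _ hq0).finite
  classical
  let s : Finset (Ideal (𝓞 L)) := hfin.toFinset.filter Prime
  obtain ⟨x, hx⟩ := IsDedekindDomain.exists_forall_sub_mem_ideal (s := s) (fun Q => Q) (fun _ => 2)
    (fun i hi => (Finset.mem_filter.1 hi).2) (fun i _ j _ h => h)
    (fun Q => if (Q : Ideal (𝓞 L)) = P then x₁ else 0)
  have hxP : x - x₁ ∈ P ^ 2 := by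
    have := hx P (by simp [s, hPp, Ideal.dvd_span_singleton, hq])
    simpa using this
  have hxx₁ : x - x₁ ∈ P := Ideal.pow_le_self two_ne_zero hxP
  have hxx₀ : x - x₀ ∈ P := by simpa using add_mem hxx₁ hx₁
  have hpow : ∀ n : ℕ, x ^ n - x₀ ^ n ∈ P := fun n =>
    Ideal.mem_of_dvd P (sub_dvd_pow_sub_pow x x₀ n) hxx₀
  have hxq2 : x ^ q - x ^ 1 - (x₁ ^ q - x₁ ^ 1) ∈ P ^ 2 := by
    have h1 := Ideal.mem_of_dvd (P ^ 2) (sub_dvd_pow_sub_pow x x₁ q) hxP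
    convert sub_mem h1 hxP using 1
    ring
  refine ⟨q, x, h2, hq, fun h => hx₀ ?_, ?_, fun h => hx₁q ?_, fun y => ?_, fun Q hQ hqQ hQP => ?_⟩
  · simpa using sub_mem h hxx₀
  · have := add_mem (sub_mem (hpow q) hxx₀) hxq
    convert this using 1
    ring
  · have := sub_mem h hxq2
    convert this using 1
    ring
  · refine (hgen y).imp_right fun ⟨n, hn⟩ => ⟨n, ?_⟩
    convert sub_mem hn (hpow n) using 1
    ring
  · have hQ0 : Q ≠ ⊥ := by
      rintro rfl
      exact hq0 ((Ideal.span_singleton_eq_bot).2 (by simpa using hqQ))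
    have := hx Q (by simp [s, Ideal.prime_of_isPrime hQ0 hQ, Ideal.dvd_span_singleton, hqQ])
    simp only [hQP, if_false, sub_zero] at this
    exact Ideal.pow_le_self two_ne_zero this

open Pointwise in
theorem exists_not_conductor_le (P : Ideal (𝓞 L)) [P.IsPrime] (hP : P ≠ ⊥) :
    ∃ x : 𝓞 L, ¬ conductor ℤ x ≤ P := by
  obtain ⟨q, x, h2, hq, hxP, hxq, hxq2, hgen, hother⟩ := exists_localUniformizer_generator P hP
  refine ⟨x, fun hle => ?_⟩
  let A := Algebra.adjoin ℤ {x}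
  let xA : A := ⟨x, Algebra.self_mem_adjoin_singleton ℤ x⟩
  let 𝔭 : Ideal A := P.comap (algebraMap A (𝓞 L))
  have hPp : Prime P := Ideal.prime_of_isPrime hP ‹_›
  have hxq1 : x ^ (q - 1) - 1 ∈ P := by
    have : x * (x ^ (q - 1) - 1) ∈ P := by
      rw [mul_sub, ← pow_succ', Nat.sub_add_cancel (by omega), mul_one]
      exact hxq
    exact (Ideal.IsPrime.mem_or_mem ‹_› this).resolve_left hxP
  have hJP : 𝔭.map (algebraMap A (𝓞 L)) ≤ P := Ideal.map_comap_le
  have hmem : ∀ a : A, (a : 𝓞 L) ∈ P → (a : 𝓞 L) ∈ 𝔭.map (algebraMap A (𝓞 L)) := fun a ha =>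
    Ideal.mem_map_of_mem (algebraMap A (𝓞 L)) (show a ∈ 𝔭 from ha)
  have hJ : P = 𝔭.map (algebraMap A (𝓞 L)) := by
    obtain ⟨C, hC⟩ := Ideal.dvd_iff_le.2 hJP
    by_cases hCt : C = ⊤
    · rw [hC, hCt, Ideal.mul_top]
    exfalso
    obtain ⟨Q, hQ, hCQ⟩ := Ideal.exists_le_maximal C hCt
    have hJQ : 𝔭.map (algebraMap A (𝓞 L)) ≤ Q := by
      rw [hC]
      exact Ideal.mul_le_right.trans hCQ
    by_cases hQP : Q = P
    · subst hQP
      refine hxq2 ?_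
      have h1 := hmem (xA ^ q - xA) (by simpa [xA] using hxq)
      rw [hC] at h1
      rw [sq]
      exact Ideal.mul_mono_right hCQ (by simpa [xA] using h1)
    · have hqQ : (q : 𝓞 L) ∈ Q := hJQ (by simpa using hmem (q : A) (by simpa using hq))
      have hxQ := hother Q hQ.isPrime hqQ hQP
      have h1 : x ^ (q - 1) - 1 ∈ Q := by
        simpa [xA] using hJQ (hmem (xA ^ (q - 1) - 1) (by simpa [xA] using hxq1))
      have h2' : x ^ (q - 1) ∈ Q := Ideal.pow_mem_of_mem Q hxQ _ (by omega)
      exact hQ.ne_top ((Ideal.eq_top_iff_one Q).2 (by simpa using sub_mem h2' h1))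
  let N := (𝓞 L) ⧸ (LinearMap.range (Algebra.linearMap A (𝓞 L)))
  have : Module.Finite A (𝓞 L) := Module.Finite.of_restrictScalars_finite ℤ A (𝓞 L)
  have hN : (⊤ : Submodule A N) ≤ 𝔭 • (⊤ : Submodule A N) := by
    rintro n -
    obtain ⟨y, rfl⟩ := Submodule.mkQ_surjective _ n
    have hstep : ∀ z ∈ P, Submodule.mkQ (LinearMap.range (Algebra.linearMap A (𝓞 L))) z ∈
        𝔭 • (⊤ : Submodule A N) := by
      intro z hz
      rw [hJ, ← Submodule.restrictScalars_mem A, ← Ideal.smul_top_eq_map] at hz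
      have := Submodule.mem_map_of_mem
        (f := Submodule.mkQ (LinearMap.range (Algebra.linearMap A (𝓞 L)))) hz
      rw [Submodule.map_smul''] at this
      exact Submodule.smul_mono le_rfl le_top this
    rcases hgen y with hy | ⟨k, hk⟩
    · exact hstep y hy
    · have h0 : Submodule.mkQ (LinearMap.range (Algebra.linearMap A (𝓞 L))) (x ^ k) = 0 := by
        rw [Submodule.mkQ_apply, Submodule.Quotient.mk_eq_zero]
        exact ⟨xA ^ k, by simp [xA]⟩
      have := hstep _ hk
      rwa [map_sub, h0, sub_zero] at this
  obtain ⟨r, hr, hr0⟩ := Submodule.exists_sub_one_mem_and_smul_eq_zero_of_fg_of_le_smul 𝔭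
    (⊤ : Submodule A N) Module.Finite.fg_top hN
  have hrc : (r : 𝓞 L) ∈ conductor ℤ x := by
    rw [mem_conductor_iff]
    intro b
    have := hr0 (Submodule.mkQ _ b) trivial
    rw [← map_smul, Submodule.mkQ_apply, Submodule.Quotient.mk_eq_zero] at this
    obtain ⟨a, ha⟩ := this
    have h3 : (a : 𝓞 L) = r * b := by simpa [Algebra.smul_def] using ha
    rw [← h3]
    exact a.2
  have h4 : (r : 𝓞 L) - 1 ∈ P := by simpa [𝔭] using hr
  have h5 := sub_mem (hle hrc) h4
  exact Ideal.IsPrime.ne_top ‹P.IsPrime› ((Ideal.eq_top_iff_one P).2 (by simpa using h5))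

end LocalMonogenic

section IdealOrder
open NumberField
variable {R : Type} [CommRing R]

/-- The order of vanishing of `a` at the ideal `P`. -/
noncomputable def idealOrd (P : Ideal R) (a : R) : ℕ∞ := emultiplicity P (Ideal.span {a})

theorem idealOrd_neg {P : Ideal R} {a : R} : idealOrd P (-a) = idealOrd P a := by
  rw [idealOrd, Ideal.span_singleton_neg, idealOrd]

variable [IsDedekindDomain R]

theorem le_idealOrd {P : Ideal R} {a : R} {k : ℕ} : (k : ℕ∞) ≤ idealOrd P a ↔ a ∈ P ^ k := by
  rw [idealOrd, ← pow_dvd_iff_le_emultiplicity, Ideal.dvd_span_singleton]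

theorem le_idealOrd_of_forall {P : Ideal R} {a : R} {n : ℕ∞}
    (h : ∀ k : ℕ, (k : ℕ∞) ≤ n → a ∈ P ^ k) : n ≤ idealOrd P a := by
  refine ENat.forall_natCast_le_iff_le.mp fun k hk => le_idealOrd.mpr (h k hk)

theorem one_le_idealOrd {P : Ideal R} {a : R} : 1 ≤ idealOrd P a ↔ a ∈ P := by
  have := le_idealOrd (P := P) (a := a) (k := 1)
  simpa using this

theorem idealOrd_eq_zero {P : Ideal R} {a : R} : idealOrd P a = 0 ↔ a ∉ P := by
  rw [← one_le_idealOrd, Order.one_le_iff_ne_zero, not_not]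

theorem idealOrd_add {P : Ideal R} {a b : R} {n : ℕ∞} (ha : n ≤ idealOrd P a)
    (hb : n ≤ idealOrd P b) : n ≤ idealOrd P (a + b) :=
  le_idealOrd_of_forall fun _ hk =>
    add_mem (le_idealOrd.mp (hk.trans ha)) (le_idealOrd.mp (hk.trans hb))

theorem idealOrd_sub {P : Ideal R} {a b : R} {n : ℕ∞} (ha : n ≤ idealOrd P a)
    (hb : n ≤ idealOrd P b) : n ≤ idealOrd P (a - b) := by
  rw [sub_eq_add_neg]
  exact idealOrd_add ha (by rwa [idealOrd_neg])

@[simp] theorem idealOrd_zero {P : Ideal R} : idealOrd P 0 = ⊤ := by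
  refine top_le_iff.mp (le_idealOrd_of_forall fun _ _ => zero_mem _)

theorem idealOrd_le_of_dvd {P : Ideal R} {a b : R} (h : a ∣ b) : idealOrd P a ≤ idealOrd P b :=
  emultiplicity_le_emultiplicity_of_dvd_right (Ideal.dvd_iff_le.mpr
    (Ideal.span_singleton_le_span_singleton.mpr h))

variable {P : Ideal R} [hPp : P.IsPrime]

theorem idealOrd_mul (hP : P ≠ ⊥) (a b : R) : idealOrd P (a * b) = idealOrd P a + idealOrd P b := by
  rw [idealOrd, ← Ideal.span_singleton_mul_span_singleton,
    emultiplicity_mul (Ideal.prime_of_isPrime hP hPp)]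
  rfl

theorem idealOrd_prod (hP : P ≠ ⊥) {ι : Type*} (s : Finset ι) (f : ι → R) :
    idealOrd P (∏ i ∈ s, f i) = ∑ i ∈ s, idealOrd P (f i) := by
  classical
  induction s using Finset.induction_on with
  | empty =>
    simpa [idealOrd_eq_zero] using (Ideal.ne_top_iff_one P).mp hPp.ne_top
  | insert a s ha ih => rw [Finset.prod_insert ha, Finset.sum_insert ha, idealOrd_mul hP, ih]

theorem idealOrd_pow (hP : P ≠ ⊥) (a : R) (n : ℕ) : idealOrd P (a ^ n) = n * idealOrd P a := by
  simpa using idealOrd_prod hP (Finset.range n) fun _ => a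

theorem idealOrd_ne_top (hP : P ≠ ⊥) {a : R} (ha : a ≠ 0) : idealOrd P a ≠ ⊤ := by
  rw [idealOrd, ← finiteMultiplicity_iff_emultiplicity_ne_top]
  refine FiniteMultiplicity.of_prime_left (Ideal.prime_of_isPrime hP hPp) ?_
  simpa using ha

theorem exists_notMem_dvd_mul (hP : P ≠ ⊥) {a b : R} (h : idealOrd P a ≤ idealOrd P b) :
    ∃ s, s ∉ P ∧ a ∣ s * b := by
  by_cases ha : a = 0
  · subst ha
    have : b = 0 := by
      by_contra hb
      rw [idealOrd_zero, top_le_iff] at h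
      exact idealOrd_ne_top hP hb h
    exact ⟨1, (Ideal.ne_top_iff_one P).mp hPp.ne_top, by simp [this]⟩
  have hfin : FiniteMultiplicity P (Ideal.span {a}) := by
    rw [finiteMultiplicity_iff_emultiplicity_ne_top]
    exact idealOrd_ne_top hP ha
  obtain ⟨J, hJ, hJP⟩ := hfin.exists_eq_pow_mul_and_not_dvd
  have : ∃ s ∈ J, s ∉ P := by
    rw [Ideal.dvd_iff_le, SetLike.not_le_iff_exists] at hJP
    exact hJP
  obtain ⟨s, hsJ, hsP⟩ := this
  refine ⟨s, hsP, ?_⟩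
  rw [← Ideal.mem_span_singleton, hJ, mul_comm]
  refine Ideal.mul_mem_mul hsJ ?_
  rw [← le_idealOrd]
  refine le_trans ?_ h
  rw [idealOrd, hfin.emultiplicity_eq_multiplicity]

end IdealOrder

section Displacement
open NumberField Polynomial
variable {L : Type} [Field L] [NumberField L]

/-- `x` generates `𝓞 L` over `ℤ` locally at `P`, up to the denominator `r ∉ P`. -/
def IsLocalGenerator (P : Ideal (𝓞 L)) (x r : 𝓞 L) : Prop :=
  r ∉ P ∧ ∀ y, ∃ g : ℤ[X], aeval x g = r * y

theorem exists_isLocalGenerator (P : Ideal (𝓞 L)) [P.IsPrime] (hP : P ≠ ⊥) :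
    ∃ x r : 𝓞 L, IsLocalGenerator P x r := by
  obtain ⟨x, hx⟩ := exists_not_conductor_le P hP
  obtain ⟨r, hr, hrP⟩ := SetLike.not_le_iff_exists.mp hx
  refine ⟨x, r, hrP, fun y => ?_⟩
  have := hr y
  rw [Algebra.adjoin_singleton_eq_range_aeval] at this
  exact this

theorem smul_aeval (σ : L ≃ₐ[ℚ] L) (x : 𝓞 L) (g : ℤ[X]) :
    σ • aeval x g = aeval (σ • x) g := by
  simpa using (aeval_algHom_apply ((MulSemiringAction.toRingHom _ (𝓞 L) σ).toIntAlgHom) x g).symm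

theorem aeval_sub_dvd (x y : 𝓞 L) (g : ℤ[X]) : x - y ∣ aeval x g - aeval y g := by
  simpa [aeval_def, eval₂_eq_eval_map] using sub_dvd_eval_sub x y (g.map (algebraMap ℤ (𝓞 L)))

variable {P : Ideal (𝓞 L)} {x r : 𝓞 L}

theorem IsLocalGenerator.exists_aeval_eq (hx : IsLocalGenerator P x r) :
    ∃ g : ℤ[X], aeval x g = r := by
  simpa using hx.2 1

theorem IsLocalGenerator.ne_zero (hx : IsLocalGenerator P x r) : r ≠ 0 := by
  rintro rfl
  exact hx.1 (zero_mem _)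

theorem IsLocalGenerator.eq_one_of_smul_eq (hx : IsLocalGenerator P x r) {σ : L ≃ₐ[ℚ] L}
    (h : σ • x = x) : σ = 1 := by
  obtain ⟨g₀, hg₀⟩ := hx.exists_aeval_eq
  have hr : σ • r = r := by rw [← hg₀, smul_aeval, h]
  have hy (y : 𝓞 L) : σ • y = y := by
    obtain ⟨g, hg⟩ := hx.2 y
    have : σ • (r * y) = r * y := by rw [← hg, smul_aeval, h]
    rw [smul_mul', hr] at this
    exact mul_left_cancel₀ hx.ne_zero this
  ext z
  obtain ⟨a, b, hb, rfl⟩ := IsFractionRing.div_surjective (A := 𝓞 L) z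
  have h₁ (y : 𝓞 L) : σ (y : L) = y := congrArg (algebraMap (𝓞 L) L) (hy y)
  simp [h₁]

/-- The order at `P` of the displacement of `x` by `σ`. -/
noncomputable def displacement (P : Ideal (𝓞 L)) (x : 𝓞 L) (σ : L ≃ₐ[ℚ] L) : ℕ∞ :=
  idealOrd P (σ • x - x)

variable [P.IsPrime]

theorem displacement_le (hP : P ≠ ⊥) (hx : IsLocalGenerator P x r) (σ : L ≃ₐ[ℚ] L) (y : 𝓞 L) :
    displacement P x σ ≤ displacement P y σ := by
  obtain ⟨g₀, hg₀⟩ := hx.exists_aeval_eq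
  obtain ⟨g, hg⟩ := hx.2 y
  have h₁ : σ • x - x ∣ r * (σ • y - y) := by
    have : r * (σ • y - y) = (aeval (σ • x) g - aeval x g)
        - (aeval (σ • x) g₀ - aeval x g₀) * (σ • y) := by
      rw [← smul_aeval, ← smul_aeval, hg, hg₀, smul_mul']
      ring
    rw [this]
    exact dvd_sub (aeval_sub_dvd _ _ _) ((aeval_sub_dvd _ _ _).mul_right _)
  have := idealOrd_le_of_dvd (P := P) h₁
  rwa [idealOrd_mul hP, idealOrd_eq_zero.mpr hx.1, zero_add] at this

theorem displacement_mul (hP : P ≠ ⊥) (hx : IsLocalGenerator P x r) (σ τ : L ≃ₐ[ℚ] L) :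
    min (displacement P x σ) (displacement P x τ) ≤ displacement P x (σ * τ) := by
  have : (σ * τ) • x - x = (σ • τ • x - τ • x) + (τ • x - x) := by rw [mul_smul]; ring
  rw [displacement.eq_1 P x (σ * τ), this]
  exact idealOrd_add ((min_le_left _ _).trans (displacement_le hP hx σ (τ • x))) (min_le_right _ _)

theorem displacement_inv (hP : P ≠ ⊥) (hx : IsLocalGenerator P x r) (σ : L ≃ₐ[ℚ] L) :
    displacement P x σ⁻¹ = displacement P x σ := by
  have (σ : L ≃ₐ[ℚ] L) : displacement P x σ ≤ displacement P x σ⁻¹ := by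
    refine (displacement_le hP hx σ (σ⁻¹ • x)).trans_eq ?_
    rw [displacement, displacement, smul_inv_smul, ← idealOrd_neg, neg_sub]
  exact le_antisymm (by simpa using this σ⁻¹) (this σ)

theorem sum_displacement_le (hP : P ≠ ⊥) (hx : IsLocalGenerator P x r)
    (s : Finset (L ≃ₐ[ℚ] L)) {y : 𝓞 L} (hy : ∀ h ∈ s, h • y = y) (ρ : L ≃ₐ[ℚ] L) :
    ∑ h ∈ s, displacement P x (ρ * h) ≤ displacement P y ρ := by
  obtain ⟨g₀, hg₀⟩ := hx.exists_aeval_eq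
  obtain ⟨g, hg⟩ := hx.2 y
  let p : (𝓞 L)[X] := g.map (algebraMap ℤ (𝓞 L)) - C y * g₀.map (algebraMap ℤ (𝓞 L))
  have h₁ : ∏ h ∈ s, (X - C (h • x)) ∣ p := by
    by_cases hp : p = 0
    · rw [hp]; exact dvd_zero _
    have := (Multiset.prod_X_sub_C_dvd_iff_le_roots hp (s.val.map (· • x))).mpr (by
      rw [Multiset.le_iff_subset]
      · intro z hz
        obtain ⟨h, hh, rfl⟩ := Multiset.mem_map.mp hz
        rw [mem_roots hp, IsRoot.def]
        simp only [p, eval_sub, eval_mul, eval_C, eval_map_algebraMap]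
        rw [← smul_aeval, ← smul_aeval, hg, hg₀, smul_mul', hy h hh]
        ring
      · refine Multiset.Nodup.map_on (fun h _ h' _ hhh => ?_) s.nodup
        have := hx.eq_one_of_smul_eq (σ := h'⁻¹ * h) (by
          rw [mul_smul]; exact (congrArg (h'⁻¹ • ·) hhh).trans (inv_smul_smul _ _))
        rwa [inv_mul_eq_one, eq_comm] at this)
    rw [Multiset.map_map] at this
    exact this
  let f := MulSemiringAction.toRingHom (L ≃ₐ[ℚ] L) (𝓞 L) ρ
  have hfi : f.comp (algebraMap ℤ (𝓞 L)) = algebraMap ℤ (𝓞 L) := RingHom.ext_int _ _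
  have h₂ : eval x ((∏ h ∈ s, (X - C (h • x))).map f) ∣ eval x (p.map f) :=
    eval_dvd (Polynomial.map_dvd f h₁)
  simp only [Polynomial.map_prod, Polynomial.map_sub, Polynomial.map_mul, map_X, map_C, eval_prod,
    eval_sub, eval_mul, eval_X, eval_C, p, Polynomial.map_map, hfi, eval_map_algebraMap, hg,
    hg₀] at h₂
  have h₃ := idealOrd_le_of_dvd (P := P) h₂
  have h₄ : r * y - f y * r = -(r * (ρ • y - y)) := by
    change r * y - (ρ • y) * r = _
    ring
  rw [h₄, idealOrd_neg, idealOrd_mul hP, idealOrd_eq_zero.mpr hx.1, zero_add, idealOrd_prod hP]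
    at h₃
  refine le_trans (Finset.sum_le_sum fun h _ => ?_) h₃
  rw [displacement, ← idealOrd_neg, neg_sub, mul_smul]
  rfl

end Displacement

section Discriminant
open NumberField Polynomial
variable {L : Type} [Field L] [NumberField L] [IsGalois ℚ L]
variable {P : Ideal (𝓞 L)} {x r : 𝓞 L}

theorem IsLocalGenerator.injective_smul (hx : IsLocalGenerator P x r) :
    Function.Injective fun σ : L ≃ₐ[ℚ] L => σ • x := fun h h' hhh => by
  have := hx.eq_one_of_smul_eq (σ := h'⁻¹ * h) (by
    rw [mul_smul]; exact (congrArg (h'⁻¹ • ·) hhh).trans (inv_smul_smul _ _))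
  rwa [inv_mul_eq_one, eq_comm] at this

theorem IsLocalGenerator.adjoin_eq_top (hx : IsLocalGenerator P x r) :
    IntermediateField.adjoin ℚ {(x : L)} = ⊤ := by
  rw [← IsGalois.fixedField_fixingSubgroup (IntermediateField.adjoin ℚ {(x : L)})]
  have : (IntermediateField.adjoin ℚ {(x : L)}).fixingSubgroup = ⊥ := by
    rw [eq_bot_iff]
    intro σ hσ
    refine Subgroup.mem_bot.mpr (hx.eq_one_of_smul_eq (RingOfIntegers.ext ?_))
    rw [IntermediateField.mem_fixingSubgroup_iff] at hσ
    exact hσ _ (IntermediateField.mem_adjoin_simple_self ℚ _)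
  rw [this, IntermediateField.fixedField_bot]

theorem IsLocalGenerator.map_minpoly (hx : IsLocalGenerator P x r) :
    (minpoly ℤ x).map (algebraMap ℤ (𝓞 L)) = ∏ σ : L ≃ₐ[ℚ] L, (X - C (σ • x)) := by
  have hxi : IsIntegral ℤ x := RingOfIntegers.isIntegral x
  have hm : ((minpoly ℤ x).map (algebraMap ℤ (𝓞 L))).Monic := (minpoly.monic hxi).map _
  refine eq_of_monic_of_dvd_of_natDegree_le ?_ hm ?_ ?_
  · exact monic_prod_of_monic _ _ fun σ _ => monic_X_sub_C _
  · have := (Multiset.prod_X_sub_C_dvd_iff_le_roots hm.ne_zero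
      ((Finset.univ : Finset (L ≃ₐ[ℚ] L)).val.map (· • x))).mpr (by
      rw [Multiset.le_iff_subset]
      · intro z hz
        obtain ⟨h, hh, rfl⟩ := Multiset.mem_map.mp hz
        rw [mem_roots hm.ne_zero, IsRoot.def, eval_map_algebraMap, ← smul_aeval, minpoly.aeval,
          smul_zero]
      · exact Multiset.Nodup.map hx.injective_smul Finset.univ.nodup)
    rw [Multiset.map_map] at this
    exact this
  · rw [natDegree_prod_of_monic _ _ fun σ _ => monic_X_sub_C _, (minpoly.monic hxi).natDegree_map]
    simp only [natDegree_X_sub_C, Finset.sum_const, smul_eq_mul, mul_one, Finset.card_univ]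
    rw [← Nat.card_eq_fintype_card, IsGalois.card_aut_eq_finrank]
    have h₁ := minpoly.isIntegrallyClosed_eq_field_fractions ℚ L hxi
    have h₂ := minpoly.natDegree_le (A := ℚ) (algebraMap (𝓞 L) L x)
    rwa [h₁, (minpoly.monic hxi).natDegree_map] at h₂

open scoped Classical in
theorem IsLocalGenerator.idealOrd_derivative [P.IsPrime] (hP : P ≠ ⊥)
    (hx : IsLocalGenerator P x r) :
    idealOrd P (aeval x (derivative (minpoly ℤ x))) =
      ∑ σ ∈ Finset.univ.erase (1 : L ≃ₐ[ℚ] L), displacement P x σ := by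
  have : aeval x (derivative (minpoly ℤ x)) =
      ∏ σ ∈ Finset.univ.erase (1 : L ≃ₐ[ℚ] L), (x - σ • x) := by
    rw [← eval_map_algebraMap, ← derivative_map, hx.map_minpoly,
      ← Finset.mul_prod_erase _ _ (Finset.mem_univ (1 : L ≃ₐ[ℚ] L)), derivative_mul, eval_add,
      eval_mul, eval_mul]
    simp [eval_prod]
  rw [this, idealOrd_prod hP]
  refine Finset.sum_congr rfl fun σ _ => ?_
  rw [displacement, ← idealOrd_neg, neg_sub]

open scoped Classical in
theorem natAbs_discr_pow_dvd {a b : ℕ} {c : ℤ}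
    (h : ∀ P : Ideal (𝓞 L), P.IsPrime → P ≠ ⊥ → ∀ x r, IsLocalGenerator P x r →
      a * ∑ σ ∈ Finset.univ.erase (1 : L ≃ₐ[ℚ] L), displacement P x σ ≤
        b * idealOrd P (c : 𝓞 L)) :
    (discr L).natAbs ^ a ∣ c.natAbs ^ (b * Module.finrank ℚ L) := by
  have key : (c : 𝓞 L) ^ b ∈ differentIdeal ℤ (𝓞 L) ^ a := by
    by_contra hnot
    let J : Ideal (𝓞 L) := Submodule.colon (differentIdeal ℤ (𝓞 L) ^ a) {(c : 𝓞 L) ^ b}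
    have hJ : J ≠ ⊤ := fun hJ => hnot (by
      have := (Ideal.eq_top_iff_one J).mp hJ
      simpa [J, Submodule.mem_colon_singleton] using this)
    obtain ⟨P, hPm, hJP⟩ := Ideal.exists_le_maximal J hJ
    have hP : P ≠ ⊥ := Ring.ne_bot_of_isMaximal_of_not_isField hPm (RingOfIntegers.not_isField L)
    have := hPm.isPrime
    obtain ⟨x, r, hx⟩ := exists_isLocalGenerator P hP
    have hle := h P this hP x r hx
    rw [← hx.idealOrd_derivative hP, ← idealOrd_pow hP, ← idealOrd_pow hP] at hle
    obtain ⟨s, hs, hdvd⟩ := exists_notMem_dvd_mul hP hle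
    refine hs (hJP ?_)
    rw [Submodule.mem_colon_singleton, smul_eq_mul]
    refine Ideal.mem_of_dvd _ hdvd (Ideal.pow_mem_pow ?_ a)
    refine aeval_derivative_mem_differentIdeal ℤ ℚ L x ?_
    have := hx.adjoin_eq_top
    rw [← IntermediateField.adjoin_simple_toSubalgebra_of_isAlgebraic
      (IsAlgebraic.of_finite ℚ _)]
    exact (congrArg IntermediateField.toSubalgebra this).trans IntermediateField.top_toSubalgebra
  have h₁ := Ideal.absNorm_dvd_absNorm_of_le ((Ideal.span_singleton_le_iff_mem _).mpr key)
  rw [map_pow, absNorm_differentIdeal L (𝓞 L), Ideal.absNorm_span_singleton, map_pow] at h₁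
  have h₂ : Algebra.norm ℤ (c : 𝓞 L) = c ^ Module.finrank ℚ L := by
    have := Algebra.norm_algebraMap_of_basis (RingOfIntegers.basis L) c
    rw [← Module.finrank_eq_card_basis (RingOfIntegers.basis L), RingOfIntegers.rank] at this
    exact this
  rwa [h₂, ← pow_mul, Int.natAbs_pow, mul_comm] at h₁

end Discriminant

section FixedSubring
open NumberField
variable {L : Type} [Field L] [NumberField L] [IsGalois ℚ L]

theorem exists_uniformizer_fixed (H : Subgroup (L ≃ₐ[ℚ] L)) (P : Ideal (𝓞 L)) [hPp : P.IsPrime]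
    (hP : P ≠ ⊥) :
    ∃ π : 𝓞 L, (∀ h ∈ H, h • π = π) ∧ idealOrd P π = Nat.card (P.inertia H) ∧
      ∀ y : 𝓞 L, y ≠ 0 → (∀ h ∈ H, h • y = y) → ∃ (k : ℕ) (a z : 𝓞 L),
        (∀ h ∈ H, h • z = z) ∧ (∀ h ∈ H, h • a = a) ∧
        a ∉ P ∧ z ∉ P ∧ a * y = π ^ k * z := by
  let M := IntermediateField.fixedField H
  let p : Ideal (𝓞 M) := P.under (𝓞 M)
  have hpp : p.IsPrime := inferInstance
  have hp : p ≠ ⊥ := Ideal.under_ne_bot (𝓞 M) hP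
  have : P.LiesOver p := ⟨rfl⟩
  have hG : IsGaloisGroup H M L := IsGaloisGroup.of_fixedPoints_eq (L ≃ₐ[ℚ] L) ℚ L H M rfl
  have hG' : IsGaloisGroup H (𝓞 M) (𝓞 L) :=
    IsGaloisGroup.of_isFractionRing H (𝓞 M) (𝓞 L) M L
  have hfix (z : 𝓞 M) (h : L ≃ₐ[ℚ] L) (hh : h ∈ H) :
      h • (algebraMap (𝓞 M) (𝓞 L) z) = algebraMap (𝓞 M) (𝓞 L) z :=
    smul_algebraMap (⟨h, hh⟩ : H) z
  have hcard := Ideal.card_inertia_eq_ramificationIdxIn (G := H) p P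
  rw [Ideal.ramificationIdxIn_eq_ramificationIdx p P H,
    ← Ideal.ramificationIdx'_eq_ramificationIdx p P hp] at hcard
  have hmul (y : 𝓞 M) (hy : y ≠ 0) : idealOrd P (algebraMap (𝓞 M) (𝓞 L) y) =
      Nat.card (P.inertia H) * idealOrd p y := by
    rw [hcard, idealOrd, idealOrd, ← Ideal.IsDedekindDomain.emultiplicity_map_eq_ramificationIdx'_mul,
      Ideal.map_span, Set.image_singleton]
    · simpa using hy
    · exact (Ideal.prime_of_isPrime hp hpp).irreducible
    · exact (Ideal.prime_of_isPrime hP hPp).irreducible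
    · exact hP
  obtain ⟨π, hπp, hπ⟩ : ∃ π ∈ p, π ∉ p ^ 2 :=
    SetLike.not_le_iff_exists.mp fun h => (Ideal.pow_right_strictAnti p hp hpp.ne_top
      one_lt_two).not_ge (by simpa using h)
  have hπ1 : idealOrd p π = 1 := by
    refine le_antisymm ?_ (one_le_idealOrd.mpr hπp)
    by_contra hlt
    rw [not_le] at hlt
    refine hπ (le_idealOrd.mp ?_)
    exact_mod_cast Order.add_one_le_of_lt hlt
  have hπ0 : π ≠ 0 := by
    rintro rfl
    exact hπ (zero_mem _)
  refine ⟨algebraMap (𝓞 M) (𝓞 L) π, hfix π, by rw [hmul π hπ0, hπ1, mul_one], fun y hy hyH => ?_⟩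
  obtain ⟨y, rfl⟩ : ∃ y' : 𝓞 M, algebraMap (𝓞 M) (𝓞 L) y' = y :=
    hG'.isInvariant.isInvariant y fun h => hyH h.1 h.2
  have hy0 : y ≠ 0 := by rintro rfl; simp at hy
  obtain ⟨k, hk⟩ := ENat.ne_top_iff_exists.mp (idealOrd_ne_top hp hy0)
  have hk' : idealOrd p (π ^ k) = k := by rw [idealOrd_pow hp, hπ1, mul_one]
  obtain ⟨a, ha, z, haz⟩ := exists_notMem_dvd_mul hp (hk'.trans hk).le
  have hz : z ∉ p := by
    have := congrArg (idealOrd p) haz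
    rw [idealOrd_mul hp, idealOrd_mul hp, idealOrd_eq_zero.mpr ha, zero_add, hk', ← hk] at this
    rw [← idealOrd_eq_zero]
    have h' : (k : ℕ∞) + 0 = k + idealOrd p z := by rw [add_zero]; exact this
    exact (ENat.add_right_injective_of_ne_top (ENat.natCast_ne_top k) h').symm
  exact ⟨k, algebraMap _ _ a, algebraMap _ _ z, hfix z, hfix a, ha, hz, by
    rw [← map_mul, haz, map_mul, map_pow]⟩
end FixedSubring

section InertiaSets
open NumberField
variable {L : Type} [Field L] [NumberField L] {P : Ideal (𝓞 L)} {x r : 𝓞 L} [P.IsPrime]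

theorem IsLocalGenerator.mem_inertia_iff (hP : P ≠ ⊥) (hx : IsLocalGenerator P x r)
    (σ : L ≃ₐ[ℚ] L) : σ ∈ P.inertia (L ≃ₐ[ℚ] L) ↔ 1 ≤ displacement P x σ := by
  constructor
  · intro h
    exact one_le_idealOrd.mpr (h x)
  · intro h y
    exact one_le_idealOrd.mp (h.trans (displacement_le hP hx σ y))

theorem idealOrd_smul_of_mem_inertia {σ : L ≃ₐ[ℚ] L} (hσ : σ ∈ P.inertia (L ≃ₐ[ℚ] L)) (y : 𝓞 L) :
    idealOrd P (σ • y) = idealOrd P y := by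
  have key (τ : L ≃ₐ[ℚ] L) (hτ : τ ∈ P.inertia (L ≃ₐ[ℚ] L)) (y : 𝓞 L) :
      idealOrd P y ≤ idealOrd P (τ • y) := by
    refine le_idealOrd_of_forall fun k hk => ?_
    have hmap : P.map (MulSemiringAction.toRingHom (L ≃ₐ[ℚ] L) (𝓞 L) τ) ≤ P := by
      rw [Ideal.map_le_iff_le_comap]
      intro z hz
      have := add_mem (hτ z) hz
      rw [sub_add_cancel] at this
      exact this
    have := Ideal.mem_map_of_mem (MulSemiringAction.toRingHom (L ≃ₐ[ℚ] L) (𝓞 L) τ)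
      (le_idealOrd.mp hk)
    rw [Ideal.map_pow] at this
    exact Ideal.pow_right_mono hmap k this
  refine le_antisymm ?_ (key σ hσ y)
  simpa using key σ⁻¹ (inv_mem hσ) (σ • y)

variable [IsGalois ℚ L]

/-- The displacement of an element of `(𝓞 L)^H` under an element `ρ` of inertia grows at least as
fast as that of a uniformizer of `(𝓞 L)^H`. -/
theorem add_sum_displacement_le (hP : P ≠ ⊥) (hx : IsLocalGenerator P x r)
    (H : Subgroup (L ≃ₐ[ℚ] L)) (s : Finset (L ≃ₐ[ℚ] L)) (hs : ∀ h ∈ s, h ∈ H)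
    {ρ : L ≃ₐ[ℚ] L} (hρ : ρ ∈ P.inertia (L ≃ₐ[ℚ] L)) {y : 𝓞 L} (hy : ∀ h ∈ H, h • y = y) :
    idealOrd P y + ∑ h ∈ s, displacement P x (ρ * h) ≤
      idealOrd P (ρ • y - y) + Nat.card (P.inertia H) := by
  by_cases hy0 : y = 0
  · simp [hy0]
  obtain ⟨π, hπH, hπ, hloc⟩ := exists_uniformizer_fixed H P hP
  obtain ⟨k, a, z, hzH, haH, ha, hz, haz⟩ := hloc y hy0 hy
  set S := ∑ h ∈ s, displacement P x (ρ * h) with hS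
  set ε := Nat.card (P.inertia H)
  have hSle {z : 𝓞 L} (hz : ∀ h ∈ H, h • z = z) : S ≤ idealOrd P (ρ • z - z) :=
    sum_displacement_le hP hx s (fun h hh => hz h (hs h hh)) ρ
  have ha' : ρ • a ∉ P := by
    rw [← idealOrd_eq_zero, idealOrd_smul_of_mem_inertia hρ, idealOrd_eq_zero]
    exact ha
  have hyk : idealOrd P y = k * ε := by
    have := congrArg (idealOrd P) haz
    rwa [idealOrd_mul hP, idealOrd_mul hP, idealOrd_eq_zero.mpr ha, idealOrd_eq_zero.mpr hz,
      zero_add, add_zero, idealOrd_pow hP, hπ] at this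
  have hpow : k * ε + S ≤ idealOrd P ((ρ • π) ^ k - π ^ k) + ε := by
    rcases k with _ | k
    · simp
    rw [← (Commute.all _ _).geom_sum₂_mul, idealOrd_mul hP]
    have h₁ : (k * ε : ℕ∞) ≤
        idealOrd P (∑ i ∈ Finset.range (k + 1), (ρ • π) ^ i * π ^ (k + 1 - 1 - i)) := by
      refine le_idealOrd_of_forall fun j hj => Ideal.sum_mem _ fun i hi => ?_
      refine le_idealOrd.mp (hj.trans ?_)
      rw [idealOrd_mul hP, idealOrd_pow hP, idealOrd_pow hP, idealOrd_smul_of_mem_inertia hρ, hπ,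
        ← add_mul]
      have : i + (k + 1 - 1 - i) = k := by
        have := Finset.mem_range.mp hi
        omega
      exact_mod_cast (by rw [this])
    calc ((k + 1 : ℕ) : ℕ∞) * ε + S = (k * ε + S) + ε := by push_cast; ring
      _ ≤ _ := by gcongr; exact hSle hπH
  have heq : ρ • a * (ρ • y - y) = ((ρ • π) ^ k - π ^ k) * ρ • z + (π ^ k * (ρ • z - z)
      - (ρ • a - a) * y) := by
    have h₁ : ρ • a * ρ • y = (ρ • π) ^ k * ρ • z := by
      rw [← smul_mul', haz, smul_mul', smul_pow']
    linear_combination h₁ - haz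
  have hfin := congrArg (idealOrd P) heq
  rw [idealOrd_mul hP, idealOrd_eq_zero.mpr ha', zero_add] at hfin
  have h₂ : k * ε + S ≤ idealOrd P (π ^ k * (ρ • z - z) - (ρ • a - a) * y) := by
    refine idealOrd_sub ?_ ?_
    · rw [idealOrd_mul hP, idealOrd_pow hP, hπ]
      gcongr
      exact hSle hzH
    · rw [idealOrd_mul hP, hyk, add_comm]
      gcongr
      exact hSle haH
  rw [hyk, hfin]
  rcases le_total (idealOrd P (((ρ • π) ^ k - π ^ k) * ρ • z))
    (idealOrd P (π ^ k * (ρ • z - z) - (ρ • a - a) * y)) with h | h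
  · refine hpow.trans ?_
    gcongr
    refine le_trans ?_ (idealOrd_add le_rfl h)
    rw [idealOrd_mul hP]
    exact le_self_add
  · exact (h₂.trans (idealOrd_add h le_rfl)).trans le_self_add

end InertiaSets

section WildSubgroup
open NumberField
variable {L : Type} [Field L] [NumberField L] {P : Ideal (𝓞 L)} {x r : 𝓞 L} [P.IsPrime]

theorem add_one_not_le_self {n : ℕ∞} (hn : n ≠ ⊤) : ¬ n + 1 ≤ n := by
  lift n to ℕ using hn
  norm_cast
  omega

theorem smul_fixed_of_mem_normalizer {H : Subgroup (L ≃ₐ[ℚ] L)} {g : L ≃ₐ[ℚ] L}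
    (hg : g ∈ Subgroup.normalizer (H : Set (L ≃ₐ[ℚ] L))) {y : 𝓞 L} (hy : ∀ h ∈ H, h • y = y) :
    ∀ h ∈ H, h • g • y = g • y := fun h hh => by
  have h₁ : g⁻¹ * h * g ∈ H := (Subgroup.mem_normalizer_iff''.mp hg h).mp hh
  have := congrArg (g • ·) (hy _ h₁)
  simpa [mul_smul] using this

variable (P) in
/-- The inertia elements that normalize `H` and act trivially on every graded piece of the
`P`-adic filtration of the subring of `H`-invariants. -/
def wildSubgroup (H : Subgroup (L ≃ₐ[ℚ] L)) : Subgroup (L ≃ₐ[ℚ] L) where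
  carrier := {ρ | ρ ∈ P.inertia (L ≃ₐ[ℚ] L) ∧ ρ ∈ Subgroup.normalizer (H : Set (L ≃ₐ[ℚ] L)) ∧
    ∀ y : 𝓞 L, (∀ h ∈ H, h • y = y) → idealOrd P y + 1 ≤ idealOrd P (ρ • y - y)}
  one_mem' := ⟨one_mem _, one_mem _, fun y _ => by simp⟩
  mul_mem' := by
    rintro ρ τ ⟨hρ, hρN, hρW⟩ ⟨hτ, hτN, hτW⟩
    refine ⟨mul_mem hρ hτ, mul_mem hρN hτN, fun y hy => ?_⟩
    have : (ρ * τ) • y - y = (ρ • τ • y - τ • y) + (τ • y - y) := by rw [mul_smul]; ring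
    rw [this]
    refine idealOrd_add ?_ (hτW y hy)
    rw [← idealOrd_smul_of_mem_inertia hτ y]
    exact hρW _ (smul_fixed_of_mem_normalizer hτN hy)
  inv_mem' := by
    rintro ρ ⟨hρ, hρN, hρW⟩
    refine ⟨inv_mem hρ, inv_mem hρN, fun y hy => ?_⟩
    have := hρW _ (smul_fixed_of_mem_normalizer (inv_mem hρN) hy)
    rw [idealOrd_smul_of_mem_inertia (inv_mem hρ), smul_inv_smul, ← neg_sub, idealOrd_neg] at this
    exact this

theorem mem_of_forall_fixed [IsGalois ℚ L] {H : Subgroup (L ≃ₐ[ℚ] L)} {ρ : L ≃ₐ[ℚ] L}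
    (h : ∀ y : 𝓞 L, (∀ h ∈ H, h • y = y) → ρ • y = y) : ρ ∈ H := by
  rw [← IntermediateField.fixingSubgroup_fixedField H, IntermediateField.mem_fixingSubgroup_iff]
  intro z hz
  obtain ⟨b, hb, hbz⟩ := ((IsFractionRing.isAlgebraic_iff ℤ ℚ L).mpr
    (Algebra.IsAlgebraic.isAlgebraic z)).exists_integral_multiple
  have := h ⟨b • z, hbz⟩ fun g hg => RingOfIntegers.ext (by
    change g (b • z) = b • z
    rw [map_zsmul]
    exact congrArg (b • ·) (hz ⟨g, hg⟩))
  have h₂ : ρ (b • z) = b • z := congrArg (algebraMap (𝓞 L) L) this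
  rw [map_zsmul] at h₂
  exact smul_right_injective L hb h₂

variable {H : Subgroup (L ≃ₐ[ℚ] L)} {ρ : L ≃ₐ[ℚ] L}

theorem pow_smul_sub_of_mem_wildSubgroup (hρ : ρ ∈ wildSubgroup P H) {y : 𝓞 L}
    (hy : ∀ h ∈ H, h • y = y) (n : ℕ) :
    idealOrd P (ρ • y - y) + 1 ≤ idealOrd P (ρ ^ n • y - y - n * (ρ • y - y)) := by
  induction n with
  | zero => simp
  | succ n ih =>
    have : ρ ^ (n + 1) • y - y - (n + 1 : ℕ) * (ρ • y - y) = (ρ ^ n • (ρ • y - y) - (ρ • y - y)) +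
        (ρ ^ n • y - y - n * (ρ • y - y)) := by
      rw [pow_succ, mul_smul, smul_sub]
      push_cast
      ring
    rw [this]
    refine idealOrd_add ((pow_mem hρ n).2.2 _ fun h hh => ?_) ih
    rw [smul_sub, smul_fixed_of_mem_normalizer hρ.2.1 hy h hh, hy h hh]

theorem mem_of_pow_mem_of_mem_wildSubgroup [IsGalois ℚ L] (hP : P ≠ ⊥) (hρ : ρ ∈ wildSubgroup P H)
    {n : ℕ} (hn : (n : 𝓞 L) ∉ P) (hρn : ρ ^ n ∈ H) : ρ ∈ H := by
  refine mem_of_forall_fixed fun y hy => ?_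
  by_contra hne
  have := pow_smul_sub_of_mem_wildSubgroup hρ hy n
  rw [hy _ hρn, sub_self, zero_sub, idealOrd_neg, idealOrd_mul hP, idealOrd_eq_zero.mpr hn,
    zero_add] at this
  exact add_one_not_le_self (idealOrd_ne_top hP (sub_ne_zero.mpr hne)) this

theorem four_mul_le_of_mem_wildSubgroup [IsGalois ℚ L] (hP : P ≠ ⊥) (hρ : ρ ∈ wildSubgroup P H)
    (hρ5 : ρ ^ 5 ∈ H) (hρH : ρ ∉ H) {S : ℕ∞} {ε : ℕ}
    (hS : ∀ y : 𝓞 L, (∀ h ∈ H, h • y = y) → idealOrd P y + S ≤ idealOrd P (ρ • y - y) + ε) :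
    4 * S ≤ idealOrd P 5 + 4 * ε := by
  obtain ⟨y, hy, hne⟩ : ∃ y : 𝓞 L, (∀ h ∈ H, h • y = y) ∧ ρ • y ≠ y := by
    by_contra! h
    exact hρH (mem_of_forall_fixed h)
  let D (y : 𝓞 L) : 𝓞 L := ρ • y - y
  have hD {z : 𝓞 L} (hz : ∀ h ∈ H, h • z = z) : ∀ h ∈ H, h • D z = D z := fun h hh => by
    rw [smul_sub, smul_fixed_of_mem_normalizer hρ.2.1 hz h hh, hz h hh]
  have hW {z : 𝓞 L} (hz : ∀ h ∈ H, h • z = z) : idealOrd P z + 1 ≤ idealOrd P (D z) := hρ.2.2 z hz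
  have hsmul (z : 𝓞 L) : ρ • z = D z + z := (sub_add_cancel _ _).symm
  have hDadd (a b : 𝓞 L) : D (a + b) = D a + D b := by simp only [D, smul_add]; ring
  have h₅ : D (D (D (D (D y)))) =
      -(5 * (D y + (2 * D (D y) + 2 * D (D (D y)) + D (D (D (D y)))))) := by
    have := hy _ hρ5
    simp only [pow_succ, pow_zero, one_mul, mul_smul, hsmul, hDadd] at this
    linear_combination this
  have e₁ := hD hy
  have e₂ := hD e₁
  have e₃ := hD e₂
  have e₄ := hD e₃
  set z := D y
  have hz : idealOrd P z ≠ ⊤ := idealOrd_ne_top hP (sub_ne_zero.mpr hne)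
  have w₁ := hW e₁
  have w₂ := w₁.trans (le_self_add.trans (hW e₂))
  have w₃ := w₂.trans (le_self_add.trans (hW e₃))
  have hu : idealOrd P z + 1 ≤ idealOrd P (2 * D z + 2 * D (D z) + D (D (D z))) := by
    refine idealOrd_add (idealOrd_add ?_ ?_) w₃ <;> rw [idealOrd_mul hP]
    · exact w₁.trans le_add_self
    · exact w₂.trans le_add_self
  have hle : idealOrd P (z + (2 * D z + 2 * D (D z) + D (D (D z)))) ≤ idealOrd P z := by
    by_contra! hlt
    have := idealOrd_sub (Order.add_one_le_of_lt hlt) hu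
    rw [add_sub_cancel_right] at this
    exact add_one_not_le_self hz this
  have h4 : idealOrd P z + 4 * S ≤ idealOrd P (D (D (D (D z)))) + 4 * ε := by
    calc idealOrd P z + 4 * S = (((idealOrd P z + S) + S) + S) + S := by ring
      _ ≤ (((idealOrd P (D z) + ε) + S) + S) + S := by gcongr ?_ + S + S + S; exact hS _ e₁
      _ = (((idealOrd P (D z) + S) + S) + S) + ε := by ring
      _ ≤ (((idealOrd P (D (D z)) + ε) + S) + S) + ε := by gcongr ?_ + S + S + _; exact hS _ e₂
      _ = ((idealOrd P (D (D z)) + S) + S) + 2 * ε := by ring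
      _ ≤ ((idealOrd P (D (D (D z))) + ε) + S) + 2 * ε := by gcongr ?_ + S + _; exact hS _ e₃
      _ = (idealOrd P (D (D (D z))) + S) + 3 * ε := by ring
      _ ≤ (idealOrd P (D (D (D (D z)))) + ε) + 3 * ε := by gcongr ?_ + _; exact hS _ e₄
      _ = _ := by ring
  rw [h₅, idealOrd_neg, idealOrd_mul hP] at h4
  have h5 : idealOrd P z + 4 * S ≤ idealOrd P z + (idealOrd P 5 + 4 * ε) := by
    refine h4.trans ?_
    calc _ ≤ idealOrd P 5 + idealOrd P z + 4 * ε := by gcongr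
      _ = _ := by ring
  exact (ENat.add_le_add_iff_left hz).mp h5
end WildSubgroup

section WildBound
open NumberField
variable {L : Type} [Field L] [NumberField L] [IsGalois ℚ L] {P : Ideal (𝓞 L)} {x r : 𝓞 L}
  [P.IsPrime]

open scoped Classical in
theorem IsLocalGenerator.card_inertia (hP : P ≠ ⊥) (hx : IsLocalGenerator P x r)
    (H : Subgroup (L ≃ₐ[ℚ] L)) :
    Nat.card (P.inertia H) =
      (Finset.univ.filter fun σ : L ≃ₐ[ℚ] L => σ ∈ H ∧ 1 ≤ displacement P x σ).card := by
  have e : (P.inertia H) ≃ {σ : L ≃ₐ[ℚ] L // σ ∈ H ∧ 1 ≤ displacement P x σ} :=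
    { toFun := fun σ => ⟨σ.1.1, σ.1.2, (hx.mem_inertia_iff hP _).mp σ.2⟩
      invFun := fun σ => ⟨⟨σ.1, σ.2.1⟩, (hx.mem_inertia_iff hP σ.1).mpr σ.2.2⟩
      left_inv := fun _ => rfl
      right_inv := fun _ => rfl }
  rw [Nat.card_congr e, Nat.card_eq_fintype_card, Fintype.card_subtype]

theorem IsLocalGenerator.sum_le_of_notMem_wildSubgroup (hP : P ≠ ⊥) (hx : IsLocalGenerator P x r)
    {H : Subgroup (L ≃ₐ[ℚ] L)} {s : Finset (L ≃ₐ[ℚ] L)} (hs : ∀ h ∈ s, h ∈ H)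
    {ρ : L ≃ₐ[ℚ] L} (hρ : ρ ∈ P.inertia (L ≃ₐ[ℚ] L))
    (hρN : ρ ∈ Subgroup.normalizer (H : Set (L ≃ₐ[ℚ] L)))
    (hρW : ρ ∉ wildSubgroup P H) :
    ∑ h ∈ s, displacement P x (ρ * h) ≤ Nat.card (P.inertia H) := by
  obtain ⟨y, hy, hlt⟩ : ∃ y : 𝓞 L, (∀ h ∈ H, h • y = y) ∧
      ¬ idealOrd P y + 1 ≤ idealOrd P (ρ • y - y) := by
    by_contra! h
    exact hρW ⟨hρ, hρN, h⟩
  have hy0 : y ≠ 0 := by rintro rfl; simp at hlt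
  have hle : idealOrd P (ρ • y - y) ≤ idealOrd P y := by
    by_contra! h
    exact hlt (Order.add_one_le_of_lt h)
  have := add_sum_displacement_le hP hx H s hs hρ hy
  exact (ENat.add_le_add_iff_left (idealOrd_ne_top hP hy0)).mp
    (this.trans (by gcongr))

theorem card_inertia_le_idealOrd (hP : P ≠ ⊥) (H : Subgroup (L ≃ₐ[ℚ] L)) {w : 𝓞 L}
    (hw : ∀ h ∈ H, h • w = w) (hwP : w ∈ P) : Nat.card (P.inertia H) ≤ idealOrd P w := by
  by_cases hw0 : w = 0
  · simp [hw0]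
  obtain ⟨π, -, hπ, hloc⟩ := exists_uniformizer_fixed H P hP
  obtain ⟨k, a, z, -, -, ha, hz, haz⟩ := hloc w hw0 hw
  have := congrArg (idealOrd P) haz
  rw [idealOrd_mul hP, idealOrd_mul hP, idealOrd_eq_zero.mpr ha, idealOrd_eq_zero.mpr hz,
      zero_add, add_zero, idealOrd_pow hP, hπ] at this
  rcases k with _ | k
  · have h₁ := one_le_idealOrd.mpr hwP
    simp [this] at h₁
  · rw [this]
    push_cast
    rw [add_mul, one_mul]
    exact le_add_self

theorem pow_five_mem_of_mem_wildSubgroup (hP : P ≠ ⊥) (h5 : (5 : 𝓞 L) ∈ P)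
    {H : Subgroup (L ≃ₐ[ℚ] L)} {ρ : L ≃ₐ[ℚ] L} (hρ : ρ ∈ wildSubgroup P H) (h : ρ ^ 120 ∈ H) :
    ρ ^ 5 ∈ H := by
  refine mem_of_pow_mem_of_mem_wildSubgroup (n := 24) hP (pow_mem hρ 5) (fun h24 => ?_)
    (by rwa [← pow_mul])
  refine (Ideal.ne_top_iff_one P).mp (Ideal.IsPrime.ne_top ‹_›) ?_
  have := sub_mem (P.mul_mem_left 5 h5) h24
  norm_num at this
  exact this

theorem card_le_five_of_pow_five_eq_one (Q : Subgroup (Equiv.Perm (Fin 5)))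
    (hQ : ∀ q ∈ Q, q ^ 5 = 1) : Nat.card Q ≤ 5 := by
  have : Fact (Nat.Prime 5) := ⟨by norm_num⟩
  have : IsPGroup 5 Q := fun q => ⟨1, Subtype.ext (by simpa using hQ q q.2)⟩
  obtain ⟨k, hk⟩ := IsPGroup.iff_card.mp this
  have hdvd : 5 ^ k ∣ 120 := by
    rw [← hk]
    have := Subgroup.card_subgroup_dvd_card Q
    rwa [Nat.card_perm, Nat.card_fin] at this
  rw [hk]
  rcases k with _ | _ | k
  · norm_num
  · norm_num
  · rw [add_assoc, pow_add] at hdvd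
    have := (Dvd.intro_left _ rfl : 5 ^ 2 ∣ 5 ^ k * 5 ^ 2).trans hdvd
    norm_num at this

open scoped Classical in
theorem IsLocalGenerator.sum_min_displacement_le (hP : P ≠ ⊥) (hx : IsLocalGenerator P x r)
    (H : Subgroup (L ≃ₐ[ℚ] L)) (σ ρ : L ≃ₐ[ℚ] L) :
    ∑ h with h ∈ H, min (displacement P x (ρ * h)) (displacement P x σ) ≤
      ∑ h with h ∈ H, displacement P x (σ * h) := by
  have hHs {h : L ≃ₐ[ℚ] L} (hh : h ∈ Finset.univ.filter (· ∈ H)) : h ∈ H :=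
    (Finset.mem_filter.mp hh).2
  obtain ⟨h₀, hh₀, hmax₀⟩ := Finset.exists_max_image (Finset.univ.filter (· ∈ H))
    (fun h => displacement P x (ρ * h)) ⟨1, by simp [one_mem]⟩
  have : ∑ h with h ∈ H, min (displacement P x (ρ * h)) (displacement P x σ) =
      ∑ h with h ∈ H, min (displacement P x (ρ * h₀ * h)) (displacement P x σ) := by
    refine Finset.sum_bij' (fun h _ => h₀⁻¹ * h) (fun h _ => h₀ * h) ?_ ?_ ?_ ?_ ?_
    · intro h hh
      simpa using mul_mem (inv_mem (hHs hh₀)) (hHs hh)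
    · intro h hh
      simpa using mul_mem (hHs hh₀) (hHs hh)
    · simp
    · simp
    · intro h hh
      rw [mul_assoc, mul_inv_cancel_left]
  rw [this]
  refine Finset.sum_le_sum fun h hh => ?_
  have h₁ : displacement P x (ρ * h₀ * h) ≤ displacement P x (ρ * h₀) := by
    rw [mul_assoc]
    exact hmax₀ _ (by simpa using mul_mem (hHs hh₀) (hHs hh))
  have h₂ : displacement P x (ρ * h₀ * h) ≤ displacement P x h := by
    have := displacement_mul hP hx (ρ * h₀)⁻¹ (ρ * h₀ * h)
    rwa [displacement_inv hP hx, min_eq_right h₁, inv_mul_cancel_left] at this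
  calc _ ≤ min (displacement P x σ) (displacement P x h) :=
        le_min (min_le_right _ _) ((min_le_left _ _).trans h₂)
    _ ≤ _ := displacement_mul hP hx σ h

open scoped Classical in
theorem IsLocalGenerator.four_mul_sum_min_displacement_le (hP : P ≠ ⊥)
    (hx : IsLocalGenerator P x r) {H : Subgroup (L ≃ₐ[ℚ] L)} {σ ρ : L ≃ₐ[ℚ] L}
    (hσN : σ ∈ Subgroup.normalizer (H : Set (L ≃ₐ[ℚ] L))) (hσI : 1 ≤ displacement P x σ)
    (hσH : σ ∉ H) (hσ5 : σ ∈ wildSubgroup P H → σ ^ 5 ∈ H)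
    (hρN : ρ ∈ Subgroup.normalizer (H : Set (L ≃ₐ[ℚ] L))) (hρI : 1 ≤ displacement P x ρ) :
    4 * ∑ h with h ∈ H, min (displacement P x (ρ * h)) (displacement P x σ) ≤
      4 * (Nat.card (P.inertia H) : ℕ∞) +
        if ρ ∈ wildSubgroup P H then idealOrd P 5 else 0 := by
  have hHs : ∀ h ∈ Finset.univ.filter (· ∈ H), h ∈ H := fun h hh => (Finset.mem_filter.mp hh).2
  have hσI' := (hx.mem_inertia_iff hP σ).mpr hσI
  split_ifs with hρW
  · refine (mul_le_mul_right (hx.sum_min_displacement_le hP H σ ρ) 4).trans ?_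
    by_cases hσW : σ ∈ wildSubgroup P H
    · rw [add_comm]
      exact four_mul_le_of_mem_wildSubgroup hP hσW (hσ5 hσW) hσH fun y hy =>
        add_sum_displacement_le hP hx H _ hHs hσI' hy
    · refine le_trans ?_ le_self_add
      gcongr
      exact hx.sum_le_of_notMem_wildSubgroup hP hHs hσI' hσN hσW
  · rw [add_zero]
    gcongr
    exact (Finset.sum_le_sum fun h _ => min_le_left _ _).trans
      (hx.sum_le_of_notMem_wildSubgroup hP hHs ((hx.mem_inertia_iff hP ρ).mpr hρI) hρN hρW)

theorem four_mul_sum_le_of_fiberwise {A B : Type*} [DecidableEq B] (I : Finset A) (F : A → B)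
    (m : A → ℕ∞) (ε : ℕ) (e : ℕ∞) (Q : Finset B) (hQ : Q.card ≤ 5)
    (h : ∀ q ∈ I.image F, 4 * ∑ ρ ∈ I with F ρ = q, m ρ ≤ 4 * ε + if q ∈ Q then e else 0)
    (hcard : ∀ q ∈ I.image F, ε ≤ (I.filter fun ρ => F ρ = q).card) :
    4 * ∑ ρ ∈ I, m ρ ≤ 4 * I.card + 5 * e := by
  have hI : (I.image F).card * ε ≤ I.card := by
    rw [Finset.card_eq_sum_card_image F I]
    exact (Finset.card_nsmul_le_sum _ _ _ hcard)
  rw [← Finset.sum_fiberwise_of_maps_to (t := I.image F) (g := F)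
    fun x hx => Finset.mem_image_of_mem F hx, Finset.mul_sum]
  refine (Finset.sum_le_sum h).trans ?_
  rw [Finset.sum_add_distrib, Finset.sum_const, ← Finset.sum_filter, Finset.sum_const]
  refine add_le_add ?_ ?_
  · rw [nsmul_eq_mul, mul_left_comm]
    gcongr
    exact_mod_cast hI
  · rw [nsmul_eq_mul]
    gcongr
    refine (Nat.cast_le.mpr ((Finset.card_le_card fun q hq => ?_).trans hQ))
    exact (Finset.mem_filter.mp hq).2

open scoped Classical in
theorem IsLocalGenerator.four_mul_sum_displacement_le (hP : P ≠ ⊥) (hx : IsLocalGenerator P x r)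
    (h5 : (5 : 𝓞 L) ∈ P) {G₁ : Subgroup (L ≃ₐ[ℚ] L)} (f : G₁ →* Equiv.Perm (Fin 5))
    {H : Subgroup (L ≃ₐ[ℚ] L)} (hHG : H ≤ G₁)
    (hmemH : ∀ g : G₁, (g : L ≃ₐ[ℚ] L) ∈ H ↔ f g = 1) {σ : L ≃ₐ[ℚ] L} (hσG : σ ∈ G₁)
    (hσH : σ ∉ H) (hσI : 1 ≤ displacement P x σ) :
    4 * ∑ ρ with ρ ∈ G₁ ∧ 1 ≤ displacement P x ρ,
        min (displacement P x ρ) (displacement P x σ) ≤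
      4 * (Nat.card (P.inertia G₁) : ℕ∞) + 5 * idealOrd P 5 := by
  have hnorm {g : L ≃ₐ[ℚ] L} (hg : g ∈ G₁) :
      g ∈ Subgroup.normalizer (H : Set (L ≃ₐ[ℚ] L)) := by
    have key (g : L ≃ₐ[ℚ] L) (hg : g ∈ G₁) (h : L ≃ₐ[ℚ] L) (hh : h ∈ H) : g * h * g⁻¹ ∈ H := by
      have := (hmemH (⟨g, hg⟩ * ⟨h, hHG hh⟩ * ⟨g, hg⟩⁻¹)).mpr (by
        rw [map_mul, map_mul, (hmemH ⟨h, hHG hh⟩).mp hh, mul_one, map_inv, mul_inv_cancel])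
      exact this
    refine Subgroup.mem_normalizer_iff.mpr fun h => ⟨key g hg h, fun hh => ?_⟩
    have := key g⁻¹ (inv_mem hg) _ hh
    simpa [mul_assoc] using this
  have hpow (g : G₁) (hg : (g : L ≃ₐ[ℚ] L) ∈ wildSubgroup P H) : (g : L ≃ₐ[ℚ] L) ^ 5 ∈ H := by
    refine pow_five_mem_of_mem_wildSubgroup hP h5 hg ?_
    have h₂ : Nat.card (Equiv.Perm (Fin 5)) = 120 := by
      rw [Nat.card_perm, Nat.card_fin]
      rfl
    rw [← SubgroupClass.coe_pow, hmemH, map_pow, ← h₂, pow_card_eq_one']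
  set Q : Subgroup (Equiv.Perm (Fin 5)) := ((wildSubgroup P H).subgroupOf G₁).map f
  have hQ : Nat.card Q ≤ 5 := by
    refine card_le_five_of_pow_five_eq_one Q ?_
    rintro _ ⟨g, hg, rfl⟩
    rw [← map_pow, ← hmemH]
    exact hpow g hg
  rw [hx.card_inertia hP G₁]
  let F (ρ : L ≃ₐ[ℚ] L) : Equiv.Perm (Fin 5) := if h : ρ ∈ G₁ then f ⟨ρ, h⟩ else 1
  have hF {ρ : L ≃ₐ[ℚ] L} (h : ρ ∈ G₁) : F ρ = f ⟨ρ, h⟩ := dif_pos h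
  have hfib {ρ τ : L ≃ₐ[ℚ] L} (hρ : ρ ∈ G₁) (hτ : τ ∈ G₁) : F τ = F ρ ↔ ρ⁻¹ * τ ∈ H := by
    rw [hF hρ, hF hτ]
    have := hmemH (⟨ρ, hρ⟩⁻¹ * ⟨τ, hτ⟩)
    rw [map_mul, map_inv, inv_mul_eq_one, eq_comm] at this
    exact this.symm
  refine four_mul_sum_le_of_fiberwise _ F _ (Nat.card (P.inertia H)) _
    (Finset.univ.filter (· ∈ Q)) ?_ (fun q hq => ?_) (fun q hq => ?_)
  · rwa [Nat.card_eq_fintype_card, Fintype.card_subtype] at hQ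
  · obtain ⟨ρ, hρ, rfl⟩ := Finset.mem_image.mp hq
    obtain ⟨hρG, hρI⟩ := (Finset.mem_filter.mp hρ).2
    calc _ ≤ 4 * ∑ h with h ∈ H, min (displacement P x (ρ * h)) (displacement P x σ) := ?_
      _ ≤ _ := hx.four_mul_sum_min_displacement_le hP (hnorm hσG) hσI hσH
          (fun h => hpow ⟨σ, hσG⟩ h) (hnorm hρG) hρI
      _ ≤ _ := ?_
    · gcongr
      rw [← Finset.sum_image (g := fun h => ρ * h)
        (f := fun τ => min (displacement P x τ) (displacement P x σ))
        fun a _ b _ h => mul_left_cancel h]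
      refine Finset.sum_le_sum_of_subset fun τ hτ => ?_
      obtain ⟨hτ, hτF⟩ := Finset.mem_filter.mp hτ
      refine Finset.mem_image.mpr ⟨ρ⁻¹ * τ, ?_, mul_inv_cancel_left _ _⟩
      exact Finset.mem_filter.mpr
        ⟨Finset.mem_univ _, (hfib hρG (Finset.mem_filter.mp hτ).2.1).mp hτF⟩
    · gcongr
      split_ifs with h₁ h₂ h₂
      · exact le_rfl
      · refine absurd (Finset.mem_filter.mpr ⟨Finset.mem_univ _, ?_⟩) h₂
        exact ⟨⟨ρ, hρG⟩, h₁, (hF hρG).symm⟩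
      · exact zero_le
      · exact le_rfl
  · obtain ⟨ρ, hρ, rfl⟩ := Finset.mem_image.mp hq
    obtain ⟨hρG, hρI⟩ := (Finset.mem_filter.mp hρ).2
    rw [hx.card_inertia hP H]
    refine Finset.card_le_card_of_injOn (fun h => ρ * h) (fun h hh => ?_)
      (fun a _ b _ h => mul_left_cancel h)
    obtain ⟨hhH, hhI⟩ := (Finset.mem_filter.mp hh).2
    refine Finset.mem_coe.mpr (Finset.mem_filter.mpr ⟨Finset.mem_filter.mpr
      ⟨Finset.mem_univ _, mul_mem hρG (hHG hhH), ?_⟩, ?_⟩)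
    · exact (le_min hρI hhI).trans (displacement_mul hP hx ρ h)
    · rw [hfib hρG (mul_mem hρG (hHG hhH)), inv_mul_cancel_left]
      exact hhH

open scoped Classical in
/-- If `G₁` embeds in a power of `S₅`, and some `G₁`-invariant `w` has order one fifth of that of
`5`, then the different exponent of `G₁` is at most `29/20` of the order of `5`. -/
theorem IsLocalGenerator.twenty_mul_sum_displacement_le (hP : P ≠ ⊥) (hx : IsLocalGenerator P x r)
    (h5 : (5 : 𝓞 L) ∈ P) (G₁ : Subgroup (L ≃ₐ[ℚ] L)) {J : Type*}
    (f : J → G₁ →* Equiv.Perm (Fin 5)) (hf : ∀ g, (∀ j, f j g = 1) → g = 1) {w : 𝓞 L}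
    (hw : ∀ g ∈ G₁, g • w = w) (hw5 : 5 * idealOrd P w = idealOrd P 5) :
    20 * ∑ ρ with ρ ∈ G₁ ∧ ρ ≠ 1, displacement P x ρ ≤ 29 * idealOrd P 5 := by
  set s : Finset (L ≃ₐ[ℚ] L) := Finset.univ.filter fun ρ => ρ ∈ G₁ ∧ ρ ≠ 1
  by_cases hne : ∃ ρ ∈ s, 1 ≤ displacement P x ρ
  swap
  · push Not at hne
    rw [Finset.sum_eq_zero fun ρ hρ => Order.lt_one_iff.mp (hne ρ hρ)]
    simp
  obtain ⟨ρ₀, hρ₀, h1ρ₀⟩ := hne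
  obtain ⟨σ, hσ, hmax⟩ := Finset.exists_max_image s (displacement P x) ⟨ρ₀, hρ₀⟩
  obtain ⟨-, hσG, hσ1⟩ := Finset.mem_filter.mp hσ
  obtain ⟨j, hj⟩ : ∃ j, f j ⟨σ, hσG⟩ ≠ 1 := by
    by_contra! h
    exact hσ1 (congrArg Subtype.val (hf _ h))
  have hmemH (g : G₁) : (g : L ≃ₐ[ℚ] L) ∈ (f j).ker.map G₁.subtype ↔ f j g = 1 := by
    simp [Subgroup.mem_map]
  have hmain := hx.four_mul_sum_displacement_le hP h5 (f j) (Subgroup.map_subtype_le _) hmemH hσG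
    (fun h => hj ((hmemH ⟨σ, hσG⟩).mp h)) (h1ρ₀.trans (hmax ρ₀ hρ₀))
  have hsum : ∑ ρ ∈ s, displacement P x ρ ≤ ∑ ρ with ρ ∈ G₁ ∧ 1 ≤ displacement P x ρ,
      min (displacement P x ρ) (displacement P x σ) := by
    refine Finset.sum_le_sum_of_ne_zero ?_ |>.trans' (Finset.sum_le_sum fun ρ hρ =>
      le_min le_rfl (hmax ρ hρ))
    intro ρ hρ h0
    obtain ⟨-, hρG, -⟩ := Finset.mem_filter.mp hρ
    refine Finset.mem_filter.mpr ⟨Finset.mem_univ _, hρG, ?_⟩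
    rw [Order.one_le_iff_ne_zero]
    rintro h
    exact h0 (by simp [h])
  have hwP : w ∈ P := by
    rw [← one_le_idealOrd, Order.one_le_iff_ne_zero]
    intro h0
    have := one_le_idealOrd.mpr h5
    simp [← hw5, h0] at this
  have hI := card_inertia_le_idealOrd hP G₁ hw hwP
  calc _ = 5 * (4 * ∑ ρ ∈ s, displacement P x ρ) := by ring
    _ ≤ 5 * (4 * idealOrd P w + 5 * idealOrd P 5) := by
        gcongr
        refine le_trans ?_ (hmain.trans ?_) <;> gcongr
    _ = 4 * (5 * idealOrd P w) + 25 * idealOrd P 5 := by ring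
    _ = _ := by rw [hw5]; ring

end WildBound

section GroupStructure
open Equiv

theorem exists_pow_apply_eq_of_pow_five_eq_one : ∀ π : Perm (Fin 5), π ^ 5 = 1 → π ≠ 1 →
    ∀ i j, ∃ k : Fin 5, (π ^ (k : ℕ)) i = j := by
  decide +kernel

theorem card_support_of_pow_three_eq_one : ∀ π : Perm (Fin 5), π ^ 3 = 1 → π ≠ 1 →
    π.support.card = 3 := by
  decide +kernel

theorem alternatingGroup_le_of_pow_mem {M : Subgroup (Perm (Fin 5))} {π τ : Perm (Fin 5)}
    (hπM : π ∈ M) (hπ5 : π ^ 5 = 1) (hπ : π ≠ 1) (hτM : τ ∈ M) (hτ3 : τ ^ 3 = 1) (hτ : τ ≠ 1) :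
    alternatingGroup (Fin 5) ≤ M := by
  have : MulAction.IsPretransitive M (Fin 5) := ⟨fun i j => by
    obtain ⟨k, hk⟩ := exists_pow_apply_eq_of_pow_five_eq_one π hπ5 hπ i j
    exact ⟨⟨π ^ (k : ℕ), pow_mem hπM _⟩, hk⟩⟩
  have : MulAction.IsPreprimitive M (Fin 5) :=
    MulAction.IsPreprimitive.of_prime_card (by simp; norm_num)
  exact Perm.alternatingGroup_le_of_isPreprimitive_of_isThreeCycle_mem this
    (card_support_eq_three_iff.mp (card_support_of_pow_three_eq_one τ hτ3 hτ)) hτM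

/-- An action of `G` by permutations on five cyclically permuted blocks of five points, such that
the elements fixing every block act with the same sign on all blocks. -/
structure BlockAction (G : Type*) [Group G] where
  shift : G →* Multiplicative (ZMod 5)
  perm : G → ZMod 5 → Perm (Fin 5)
  perm_mul : ∀ g h i, perm (g * h) i = perm g (i + (shift h).toAdd) * perm h i
  faithful : ∀ g, shift g = 1 → (∀ i, perm g i = 1) → g = 1
  sign_perm : ∀ g, shift g = 1 → ∀ i j, (perm g i).sign = (perm g j).sign

namespace BlockAction
variable {G : Type*} [Group G] (A : BlockAction G) {g h : G} {i : ZMod 5}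

theorem perm_one (i : ZMod 5) : A.perm 1 i = 1 := by
  simpa using A.perm_mul 1 1 i

theorem perm_mul_of_shift_eq_one (g : G) (hh : A.shift h = 1) (i : ZMod 5) :
    A.perm (g * h) i = A.perm g i * A.perm h i := by
  simp [A.perm_mul, hh]

theorem perm_inv (g : G) (i : ZMod 5) :
    A.perm g⁻¹ (i + (A.shift g).toAdd) = (A.perm g i)⁻¹ := by
  rw [eq_inv_iff_mul_eq_one, ← A.perm_mul, inv_mul_cancel, A.perm_one]

theorem perm_conj (t : G) (hg : A.shift g = 1) (i : ZMod 5) :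
    A.perm (t * g * t⁻¹) (i + (A.shift t).toAdd) = A.perm t i * A.perm g i * (A.perm t i)⁻¹ := by
  rw [A.perm_mul, A.perm_inv, map_inv, toAdd_inv, add_neg_cancel_right,
    A.perm_mul_of_shift_eq_one t hg]

/-- The elements fixing every block and acting on each block by an even permutation. -/
def evenSubgroup : Subgroup G where
  carrier := {g | A.shift g = 1 ∧ ∀ i, (A.perm g i).sign = 1}
  one_mem' := ⟨map_one _, fun i => by rw [A.perm_one, map_one]⟩
  mul_mem' := by
    rintro a b ⟨ha, ha'⟩ ⟨hb, hb'⟩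
    exact ⟨by rw [map_mul, ha, hb, mul_one],
      fun i => by rw [A.perm_mul_of_shift_eq_one a hb, map_mul, ha', hb', mul_one]⟩
  inv_mem' := by
    rintro a ⟨ha, ha'⟩
    refine ⟨by rw [map_inv, ha, inv_one], fun i => ?_⟩
    have := A.perm_inv a i
    rw [ha, toAdd_one, add_zero] at this
    rw [this, map_inv, ha', inv_one]

theorem shift_conj (t : G) (hg : A.shift g = 1) : A.shift (t * g * t⁻¹) = 1 := by
  rw [map_mul, map_mul, hg, mul_one, map_inv, mul_inv_cancel]

instance : A.evenSubgroup.Normal where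
  conj_mem g hg t := by
    refine ⟨A.shift_conj t hg.1, fun i => ?_⟩
    rw [← sub_add_cancel i (A.shift t).toAdd, A.perm_conj t hg.1, map_mul, map_mul, hg.2, mul_one,
      map_inv, mul_inv_cancel]

/-- The permutations of the block `i` induced by elements acting trivially on other blocks. -/
def localSubgroup (i : ZMod 5) : Subgroup (Perm (Fin 5)) where
  carrier := {π | ∃ g, A.shift g = 1 ∧ A.perm g i = π ∧ ∀ j ≠ i, A.perm g j = 1}
  one_mem' := ⟨1, map_one _, A.perm_one i, fun j _ => A.perm_one j⟩
  mul_mem' := by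
    rintro _ _ ⟨a, ha, rfl, ha'⟩ ⟨b, hb, rfl, hb'⟩
    refine ⟨a * b, by rw [map_mul, ha, hb, mul_one], A.perm_mul_of_shift_eq_one a hb i,
      fun j hj => ?_⟩
    rw [A.perm_mul_of_shift_eq_one a hb, ha' j hj, hb' j hj, mul_one]
  inv_mem' := by
    rintro _ ⟨a, ha, rfl, ha'⟩
    have (i : ZMod 5) : A.perm a⁻¹ i = (A.perm a i)⁻¹ := by
      have := A.perm_inv a i
      rwa [ha, toAdd_one, add_zero] at this
    exact ⟨a⁻¹, by rw [map_inv, ha, inv_one], this i,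
      fun j hj => by rw [this, ha' j hj, inv_one]⟩

theorem exists_shift_eq {t : G} (ht : A.shift t ≠ 1) (c : Multiplicative (ZMod 5)) :
    ∃ g, A.shift g = c := by
  have : Fact (Nat.Prime 5) := ⟨by norm_num⟩
  have h₁ : c ∈ Subgroup.zpowers (A.shift t) := mem_zpowers_of_prime_card
    (p := 5) (by simp) ht
  obtain ⟨k, rfl⟩ := Subgroup.mem_zpowers_iff.mp h₁
  exact ⟨t ^ k, map_zpow _ _ _⟩

/-- An element fixing every block, acting on only one of them, and there by a permutation of
order `n`, for `n` a prime. -/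
def HasLocalElement (n : ℕ) : Prop :=
  ∃ g i, A.shift g = 1 ∧ (∀ j ≠ i, A.perm g j = 1) ∧ A.perm g i ^ n = 1 ∧ A.perm g i ≠ 1

theorem exists_mem_localSubgroup {t : G} (ht : A.shift t ≠ 1) {n : ℕ} (h : A.HasLocalElement n)
    (i : ZMod 5) : ∃ π ∈ A.localSubgroup i, π ^ n = 1 ∧ π ≠ 1 := by
  obtain ⟨g, j, hg, hgj, hn, h1⟩ := h
  obtain ⟨s, hs⟩ := A.exists_shift_eq ht (Multiplicative.ofAdd (i - j))
  have hi (k : ZMod 5) := A.perm_conj s hg k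
  simp only [hs, toAdd_ofAdd] at hi
  have hij := hi j
  rw [add_sub_cancel] at hij
  refine ⟨_, ⟨s * g * s⁻¹, A.shift_conj s hg, hij, fun k hk => ?_⟩, ?_, ?_⟩
  · have := hi (k - (i - j))
    rw [sub_add_cancel, hgj, mul_one, mul_inv_cancel] at this
    · exact this
    · intro h
      exact hk (by linear_combination h)
  · rw [conj_pow, hn, mul_one, mul_inv_cancel]
  · rwa [Ne, conj_eq_one_iff]

theorem alternatingGroup_le_localSubgroup {t : G} (ht : A.shift t ≠ 1) (h3 : A.HasLocalElement 3)
    (h5 : A.HasLocalElement 5) (i : ZMod 5) : alternatingGroup (Fin 5) ≤ A.localSubgroup i := by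
  obtain ⟨π, hπM, hπ5, hπ⟩ := A.exists_mem_localSubgroup ht h5 i
  obtain ⟨τ, hτM, hτ3, hτ⟩ := A.exists_mem_localSubgroup ht h3 i
  exact alternatingGroup_le_of_pow_mem hπM hπ5 hπ hτM hτ3 hτ

variable (h : ∀ i, alternatingGroup (Fin 5) ≤ A.localSubgroup i)

/-- The action of the even subgroup on the blocks. -/
def evenHom : A.evenSubgroup →* (ZMod 5 → alternatingGroup (Fin 5)) where
  toFun g i := ⟨A.perm g i, Perm.mem_alternatingGroup.mpr (g.2.2 i)⟩
  map_one' := by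
    ext1 i
    exact Subtype.ext (A.perm_one i)
  map_mul' a b := by
    ext1 i
    exact Subtype.ext (A.perm_mul_of_shift_eq_one a b.2.1 i)

theorem evenHom_injective : Function.Injective A.evenHom := by
  refine (injective_iff_map_eq_one _).mpr fun g hg => Subtype.ext (A.faithful g g.2.1 fun i => ?_)
  exact congrArg Subtype.val (congrFun hg i)

theorem evenHom_surjective (h : ∀ i, alternatingGroup (Fin 5) ≤ A.localSubgroup i) :
    Function.Surjective A.evenHom := by
  rw [← MonoidHom.range_eq_top, eq_top_iff]
  intro f _
  refine Subgroup.pi_mem_of_mulSingle_mem f fun i => ?_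
  obtain ⟨g, hg, hgi, hgj⟩ := h i (f i).2
  refine ⟨⟨g, hg, fun j => ?_⟩, ?_⟩
  · by_cases hj : j = i
    · rw [hj, hgi]
      exact Perm.mem_alternatingGroup.mp (f i).2
    · rw [hgj j hj, map_one]
  · ext1 j
    refine Subtype.ext ?_
    by_cases hj : j = i
    · subst hj
      rw [Pi.mulSingle_eq_same]
      exact hgi
    · rw [Pi.mulSingle_eq_of_ne hj]
      exact hgj j hj

theorem perm_pow_five {g : G} (hg : A.shift g = Multiplicative.ofAdd 1) (i : ZMod 5) :
    A.perm (g ^ 5) i = A.perm g (i + 4) * A.perm g (i + 3) * A.perm g (i + 2) * A.perm g (i + 1) *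
      A.perm g i := by
  have (n : ℕ) : A.perm (g ^ (n + 1)) i = A.perm g (i + n) * A.perm (g ^ n) i := by
    rw [pow_succ', A.perm_mul, map_pow, hg, ← ofAdd_nsmul, toAdd_ofAdd, nsmul_one]
  simp only [this, pow_zero, A.perm_one, mul_one, mul_assoc]
  simp

theorem shift_pow_five (g : G) : A.shift (g ^ 5) = 1 := by
  rw [map_pow]
  have h₂ : Nat.card (Multiplicative (ZMod 5)) = 5 := by simp
  have := pow_card_eq_one' (x := A.shift g)
  rwa [h₂] at this

theorem exists_pow_five_odd {t o : G} (ht : A.shift t ≠ 1) (ho : A.shift o = 1)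
    (ho' : (A.perm o 0).sign = -1) :
    ∃ g, A.shift g = Multiplicative.ofAdd 1 ∧ (A.perm (g ^ 5) 0).sign = -1 := by
  obtain ⟨g, hg⟩ := A.exists_shift_eq ht (Multiplicative.ofAdd 1)
  rcases Int.units_eq_one_or (A.perm (g ^ 5) 0).sign with h | h
  · have hgo : A.shift (g * o) = Multiplicative.ofAdd 1 := by rw [map_mul, hg, ho, mul_one]
    refine ⟨g * o, hgo, ?_⟩
    rw [A.perm_pow_five hg] at h
    rw [A.perm_pow_five hgo]
    simp only [A.perm_mul_of_shift_eq_one g ho, map_mul, A.sign_perm o ho _ 0, ho'] at h ⊢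
    simpa using h
  · exact ⟨g, hg, h⟩

theorem exists_pow_ten_eq_one (h : ∀ i, alternatingGroup (Fin 5) ≤ A.localSubgroup i) {t o : G}
    (ht : A.shift t ≠ 1) (ho : A.shift o = 1) (ho' : (A.perm o 0).sign = -1) :
    ∃ g, A.shift g = Multiplicative.ofAdd 1 ∧ (A.perm (g ^ 5) 0).sign = -1 ∧ g ^ 10 = 1 := by
  obtain ⟨g, hg, hg5⟩ := A.exists_pow_five_odd ht ho ho'
  have hν : (A.perm (g ^ 5) 0)⁻¹ * swap 0 1 ∈ alternatingGroup (Fin 5) := by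
    rw [Perm.mem_alternatingGroup, map_mul, map_inv, hg5, Perm.sign_swap (by decide)]
    rfl
  obtain ⟨n, hn, hn0, hnj⟩ := h 0 hν
  have hgn : A.shift (g * n) = Multiplicative.ofAdd 1 := by rw [map_mul, hg, hn, mul_one]
  have h0 : A.perm ((g * n) ^ 5) 0 = swap 0 1 := by
    rw [A.perm_pow_five hgn]
    simp only [A.perm_mul_of_shift_eq_one g hn]
    rw [hnj, hnj, hnj, hnj, hn0, A.perm_pow_five hg]
    · group
    all_goals decide
  refine ⟨g * n, hgn, by rw [h0, Perm.sign_swap (by decide)], ?_⟩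
  set u := g * n
  have h5 := A.shift_pow_five u
  have h10 : u ^ 10 = u ^ 5 * u ^ 5 := by rw [← pow_add]
  refine A.faithful _ (by rw [h10, map_mul, h5, mul_one]) fun i => ?_
  have hstep (i : ZMod 5) (hi : A.perm (u ^ 10) i = 1) : A.perm (u ^ 10) (i + 1) = 1 := by
    have := A.perm_conj u (g := u ^ 10) (by rw [h10, map_mul, h5, mul_one]) i
    rw [hgn, toAdd_ofAdd, hi, mul_one, mul_inv_cancel, (Commute.self_pow u 10).eq,
      mul_inv_cancel_right] at this
    exact this
  have hzero : A.perm (u ^ 10) 0 = 1 := by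
    rw [h10, A.perm_mul_of_shift_eq_one _ h5, h0, swap_mul_self]
  have hall (n : ℕ) : A.perm (u ^ 10) (n : ZMod 5) = 1 := by
    induction n with
    | zero => exact_mod_cast hzero
    | succ n ih => exact_mod_cast hstep _ ih
  have := hall i.val
  rwa [ZMod.natCast_zmod_val] at this

theorem exists_isComplement' (h : ∀ i, alternatingGroup (Fin 5) ≤ A.localSubgroup i) {t o : G}
    (ht : A.shift t ≠ 1) (ho : A.shift o = 1) (ho' : (A.perm o 0).sign = -1) :
    ∃ g, orderOf g = 10 ∧ A.evenSubgroup.IsComplement' (Subgroup.zpowers g) := by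
  obtain ⟨g, hg, hg5, hg10⟩ := A.exists_pow_ten_eq_one h ht ho ho'
  have hmem {n : ℤ} (hn : g ^ n ∈ A.evenSubgroup) : (10 : ℤ) ∣ n := by
    have h₁ : (5 : ℤ) ∣ n := by
      have := hn.1
      rw [map_zpow, hg, ← ofAdd_zsmul, ofAdd_eq_one, zsmul_one] at this
      exact (ZMod.intCast_zmod_eq_zero_iff_dvd n 5).mp this
    obtain ⟨m, rfl⟩ := h₁
    rcases Int.even_or_odd' m with ⟨l, rfl | rfl⟩
    · exact ⟨l, by ring⟩
    · have := hn.2 0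
      have h₂ : g ^ (5 * (2 * l + 1)) = g ^ 5 := by
        rw [show 5 * (2 * l + 1) = ((10 : ℕ) : ℤ) * l + ((5 : ℕ) : ℤ) by push_cast; ring, zpow_add,
          zpow_mul, zpow_natCast, hg10, one_zpow, one_mul, zpow_natCast]
      rw [h₂, hg5] at this
      exact absurd this (by decide)
  refine ⟨g, ?_, Subgroup.isComplement'_of_disjoint_and_mul_eq_univ ?_ ?_⟩
  · refine Nat.dvd_antisymm (orderOf_dvd_of_pow_eq_one hg10) ?_
    have := hmem (n := orderOf g) (by rw [zpow_natCast, pow_orderOf_eq_one]; exact one_mem _)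
    exact_mod_cast this
  · rw [Subgroup.disjoint_def]
    rintro x hx ⟨n, rfl⟩
    obtain ⟨m, rfl⟩ := hmem hx
    have : (10 : ℤ) = ((10 : ℕ) : ℤ) := rfl
    simp only [this, zpow_mul, zpow_natCast, hg10, one_zpow]
  · refine Set.eq_univ_of_forall fun x => ?_
    set y := x * g ^ (-((A.shift x).toAdd.val : ℤ))
    have hy : A.shift y = 1 := by
      rw [map_mul, map_zpow, hg, ← ofAdd_zsmul, zsmul_one]
      push_cast
      rw [ZMod.natCast_zmod_val, ofAdd_neg, ofAdd_toAdd, mul_inv_cancel]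
    rcases Int.units_eq_one_or (A.perm y 0).sign with h | h
    · exact ⟨y, ⟨hy, fun i => (A.sign_perm y hy i 0).trans h⟩, _,
        ⟨((A.shift x).toAdd.val : ℤ), rfl⟩, by simp [y]⟩
    · have h5 := A.shift_pow_five g
      have hy5 : A.shift (y * g ^ 5) = 1 := by rw [map_mul, h5, hy, mul_one]
      refine ⟨y * g ^ 5, ⟨hy5, fun i => ?_⟩, _, ⟨-5 + ((A.shift x).toAdd.val : ℤ), rfl⟩, ?_⟩
      · rw [A.sign_perm _ hy5 i 0, A.perm_mul_of_shift_eq_one _ h5, map_mul, h, hg5]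
        decide
      · simp only [y]
        group

theorem exists_semidirectProduct (h3 : A.HasLocalElement 3) (h5 : A.HasLocalElement 5) {t o : G}
    (ht : A.shift t ≠ 1) (ho : A.shift o = 1) (ho' : (A.perm o 0).sign = -1) {S : Type*} [Group S]
    (e : S ≃* alternatingGroup (Fin 5)) :
    ∃ φ : Multiplicative (ZMod 10) →* MulAut (Fin 5 → S),
      Nonempty (G ≃* SemidirectProduct (Fin 5 → S) (Multiplicative (ZMod 10)) φ) := by
  have h := A.alternatingGroup_le_localSubgroup ht h3 h5
  obtain ⟨g, hg, hc⟩ := A.exists_isComplement' h ht ho ho'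
  let e₁ : A.evenSubgroup ≃* (Fin 5 → S) :=
    (MulEquiv.ofBijective A.evenHom ⟨A.evenHom_injective, A.evenHom_surjective h⟩).trans
      (MulEquiv.piCongrRight fun _ => e.symm)
  let e₂ : Subgroup.zpowers g ≃* Multiplicative (ZMod 10) :=
    mulEquivOfCyclicCardEq (by rw [Nat.card_zpowers, hg]; simp)
  exact ⟨_, ⟨(SemidirectProduct.mulEquivSubgroup hc).symm.trans (SemidirectProduct.congr' e₁ e₂)⟩⟩

theorem not_isSolvable (h3 : A.HasLocalElement 3) (h5 : A.HasLocalElement 5) {t : G}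
    (ht : A.shift t ≠ 1) : ¬ Group.IsSolvable G := fun hG => by
  have h := A.alternatingGroup_le_localSubgroup ht h3 h5
  have hsurj : Function.Surjective ((Pi.evalMonoidHom _ (0 : ZMod 5)).comp A.evenHom) :=
    (Function.surjective_eval 0).comp (A.evenHom_surjective h)
  have : Group.IsSolvable (alternatingGroup (Fin 5)) := Group.isSolvable_of_surjective hsurj
  exact Perm.not_isSolvable_fin_5 (Group.isSolvable_of_ker_le_range (alternatingGroup (Fin 5)).subtype
    Perm.sign (by rw [Subgroup.range_subtype]; rfl))

end BlockAction
end GroupStructure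

section ProjectiveGroup
open Matrix Equiv

/-- The fifteen trace zero elements of `PSL₂(F₅)` fall into five classes of pairwise commuting
elements; this is the class of the matrix with rows `x, y` and `z, -x`. -/
def traceZeroClass (x y z : ZMod 5) : ZMod 5 := if y = 0 then 3 * x * z ^ 3 else x ^ 3 * y

/-- The coordinates of a representative of each class. -/
def classRep (k : ZMod 5) : ZMod 5 × ZMod 5 × ZMod 5 :=
  if k = 0 then (0, 1, 4) else (1, k, 3 * k ^ 3)

/-- The coordinates of the conjugate of a trace zero matrix. -/
def conjCoord (a b c d x y z : ZMod 5) : ZMod 5 × ZMod 5 × ZMod 5 :=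
  (a * x * d + b * z * d - a * y * c + b * x * c, -a * x * b - b * z * b + a * y * a - b * x * a,
    c * x * d + d * z * d - c * y * c + d * x * c)

theorem traceZeroClass_classRep : ∀ k : ZMod 5,
    traceZeroClass (classRep k).1 (classRep k).2.1 (classRep k).2.2 = k := by
  decide +kernel

theorem classRep_det : ∀ k : ZMod 5,
    (classRep k).1 ^ 2 + (classRep k).2.1 * (classRep k).2.2 = -1 := by
  decide +kernel

/-- The class of the conjugate of a trace zero matrix. -/
def conjClass (a b c d : ZMod 5) (v : ZMod 5 × ZMod 5 × ZMod 5) : ZMod 5 :=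
  let w := conjCoord a b c d v.1 v.2.1 v.2.2
  traceZeroClass w.1 w.2.1 w.2.2

theorem conjClass_classRep : ∀ a b c d : ZMod 5, a * d - b * c = 1 → ∀ x y z : ZMod 5,
    x ^ 2 + y * z = -1 →
    conjClass a b c d (classRep (traceZeroClass x y z)) = conjClass a b c d (x, y, z) := by
  decide +kernel

theorem conjClass_eq_self : ∀ a b c d : ZMod 5, a * d - b * c = 1 →
    (∀ k, conjClass a b c d (classRep k) = k) → b = 0 ∧ c = 0 ∧ a = d := by
  decide +kernel

theorem card_specialLinearGroup_two_five :
    Fintype.card {v : ZMod 5 × ZMod 5 × ZMod 5 × ZMod 5 //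
      v.1 * v.2.2.2 - v.2.1 * v.2.2.1 = 1} = 120 := by
  decide +kernel

/-- The conjugation action of `SL₂(F₅)` on the five classes. -/
def classPerm : Matrix.SpecialLinearGroup (Fin 2) (ZMod 5) →* Perm (ZMod 5) :=
  MonoidHom.toHomPerm
    { toFun := fun g k => conjClass (g 0 0) (g 0 1) (g 1 0) (g 1 1) (classRep k)
      map_one' := by
        funext k
        have := traceZeroClass_classRep k
        simp only [conjClass, conjCoord, Matrix.SpecialLinearGroup.coe_one, one_apply_eq]
        simp only [mul_one, mul_zero, add_zero, sub_zero, one_mul, zero_mul, ne_eq,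
          zero_add, zero_ne_one, one_ne_zero, not_false_eq_true, one_apply_ne]
        exact this
      map_mul' := fun g h => by
        funext k
        have hg : g 0 0 * g 1 1 - g 0 1 * g 1 0 = 1 := by rw [← det_fin_two]; exact g.2
        have hh : h 0 0 * h 1 1 - h 0 1 * h 1 0 = 1 := by rw [← det_fin_two]; exact h.2
        have hk := classRep_det k
        set v := classRep k with hv
        set w := conjCoord (h 0 0) (h 0 1) (h 1 0) (h 1 1) v.1 v.2.1 v.2.2 with hw
        have := conjClass_classRep _ _ _ _ hg w.1 w.2.1 w.2.2 (by
          simp only [hw, conjCoord]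
          linear_combination (h 0 0 * h 1 1 - h 0 1 * h 1 0) ^ 2 * hk -
            (h 0 0 * h 1 1 - h 0 1 * h 1 0 + 1) * hh)
        change _ = conjClass _ _ _ _ (classRep (traceZeroClass w.1 w.2.1 w.2.2))
        rw [this]
        have hgh (i j : Fin 2) : (g * h) i j = g i 0 * h 0 j + g i 1 * h 1 j := by
          rw [Matrix.SpecialLinearGroup.coe_mul, mul_apply, Fin.sum_univ_two]
        simp only [conjClass, hw, hgh]
        congr 1 <;> simp only [conjCoord] <;> ring }

theorem classPerm_apply (g : Matrix.SpecialLinearGroup (Fin 2) (ZMod 5)) (k : ZMod 5) :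
    classPerm g k = conjClass (g 0 0) (g 0 1) (g 1 0) (g 1 1) (classRep k) :=
  rfl

theorem ker_classPerm :
    classPerm.ker = Subgroup.center (Matrix.SpecialLinearGroup (Fin 2) (ZMod 5)) := by
  ext g
  rw [MonoidHom.mem_ker, Matrix.SpecialLinearGroup.mem_center_iff]
  have hg : g 0 0 * g 1 1 - g 0 1 * g 1 0 = 1 := by rw [← det_fin_two]; exact g.2
  constructor
  · intro h
    obtain ⟨h01, h10, h11⟩ := conjClass_eq_self _ _ _ _ hg fun k => by
      rw [← classPerm_apply, h]
      rfl
    refine ⟨g 0 0, ?_, ?_⟩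
    · rw [h01, zero_mul, sub_zero, ← h11] at hg
      simpa [pow_two] using hg
    · ext i j
      fin_cases i <;> fin_cases j <;> simp [h01, h10, h11]
  · rintro ⟨r, hr, h⟩
    have hr : r ^ 2 = 1 := by simpa using hr
    have e00 : g 0 0 = r := by rw [← h]; simp
    have e01 : g 0 1 = 0 := by rw [← h]; simp
    have e10 : g 1 0 = 0 := by rw [← h]; simp
    have e11 : g 1 1 = r := by rw [← h]; simp
    ext k
    rw [classPerm_apply, e00, e01, e10, e11]
    have h₁ : conjCoord r 0 0 r (classRep k).1 (classRep k).2.1 (classRep k).2.2 = classRep k := by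
      rw [conjCoord]
      refine Prod.ext ?_ (Prod.ext ?_ ?_) <;> simp only
      · linear_combination (classRep k).1 * hr
      · linear_combination (classRep k).2.1 * hr
      · linear_combination (classRep k).2.2 * hr
    simp only [conjClass, h₁]
    exact traceZeroClass_classRep k

theorem natCard_specialLinearGroup_two_five :
    Nat.card (Matrix.SpecialLinearGroup (Fin 2) (ZMod 5)) = 120 := by
  rw [← card_specialLinearGroup_two_five, ← Nat.card_eq_fintype_card]
  refine Nat.card_congr ⟨fun g => ⟨(g 0 0, g 0 1, g 1 0, g 1 1), ?_⟩,
    fun v => ⟨!![v.1.1, v.1.2.1; v.1.2.2.1, v.1.2.2.2], ?_⟩, fun g => ?_, fun v => ?_⟩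
  · rw [← det_fin_two]
    exact g.2
  · rw [det_fin_two_of]
    exact v.2
  · exact Subtype.ext (eta_fin_two _).symm
  · rfl

theorem natCard_center_two_five :
    Nat.card (Subgroup.center (Matrix.SpecialLinearGroup (Fin 2) (ZMod 5))) = 2 := by
  rw [Nat.card_congr (Matrix.SpecialLinearGroup.center_equiv_rootsOfUnity (n := Fin 2)).toEquiv]
  have h₁ : IsPrimitiveRoot (-1 : ZMod 5) 2 := IsPrimitiveRoot.neg_one 5 (by decide)
  exact h₁.card_rootsOfUnity

theorem range_classPerm : classPerm.range = alternatingGroup (ZMod 5) := by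
  refine Perm.eq_alternatingGroup_of_index_eq_two ?_
  have h₁ := Subgroup.card_mul_index classPerm.range
  have h₂ := Subgroup.card_mul_index classPerm.ker
  rw [Subgroup.index_ker, ker_classPerm, natCard_center_two_five,
    natCard_specialLinearGroup_two_five] at h₂
  have h₃ : Nat.card (Perm (ZMod 5)) = 120 := by
    rw [Nat.card_perm, Nat.card_zmod]
    rfl
  rw [h₃] at h₁
  have h₄ : Nat.card classPerm.range = 60 := by omega
  rw [h₄] at h₁
  omega

/-- The exceptional isomorphism from `PSL₂(F₅)` to `A₅`. -/
noncomputable def pslTwoFiveEquiv : PSL2 (ZMod 5) ≃* alternatingGroup (Fin 5) :=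
  ((QuotientGroup.quotientMulEquivOfEq ker_classPerm.symm).trans
    (QuotientGroup.quotientKerEquivRange classPerm)).trans (MulEquiv.subgroupCongr range_classPerm)

end ProjectiveGroup

section QuinticField

/-- Coordinates with respect to the integral basis `1, t, t ^ 2, t ^ 3, v` of the cyclic quintic
field of conductor `25`, where `t` is a root of `X ^ 5 - 10 X ^ 3 + 5 X ^ 2 + 10 X + 1` and
`7 v = 2 + 2 t - t ^ 2 + 3 t ^ 3 + t ^ 4`. -/
structure QuinticInt where
  (x₀ x₁ x₂ x₃ x₄ : ℤ)
  deriving DecidableEq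

namespace QuinticInt

instance : Add QuinticInt :=
  ⟨fun a b => ⟨a.x₀ + b.x₀, a.x₁ + b.x₁, a.x₂ + b.x₂, a.x₃ + b.x₃, a.x₄ + b.x₄⟩⟩

instance : Sub QuinticInt :=
  ⟨fun a b => ⟨a.x₀ - b.x₀, a.x₁ - b.x₁, a.x₂ - b.x₂, a.x₃ - b.x₃, a.x₄ - b.x₄⟩⟩

instance : Mul QuinticInt :=
  ⟨fun a b =>
    let c₂ := a.x₁ * b.x₁
    let c₄ := a.x₁ * b.x₃ + a.x₂ * b.x₂ + a.x₃ * b.x₁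
    let c₅ := a.x₂ * b.x₃ + a.x₃ * b.x₂
    let c₆ := a.x₃ * b.x₃
    let d₁ := a.x₁ * b.x₄ + a.x₄ * b.x₁
    let d₂ := a.x₂ * b.x₄ + a.x₄ * b.x₂
    let d₃ := a.x₃ * b.x₄ + a.x₄ * b.x₃
    let d₄ := a.x₄ * b.x₄
    ⟨a.x₀ * b.x₀ - 2 * c₄ - c₅ - 20 * c₆ - d₁ - 3 * d₂ - 9 * d₃ - 7 * d₄,
      a.x₀ * b.x₁ + a.x₁ * b.x₀ - 2 * c₄ - 10 * c₅ - 21 * c₆ - 2 * d₁ - 7 * d₂ - 21 * d₃ - 17 * d₄,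
      a.x₀ * b.x₂ + a.x₂ * b.x₀ + c₂ + c₄ - 5 * c₅ - 2 * d₂ - 7 * d₃ - 6 * d₄,
      a.x₀ * b.x₃ + a.x₃ * b.x₀ + a.x₁ * b.x₂ + a.x₂ * b.x₁ - 3 * c₄ + 10 * c₅ - 35 * c₆
        - 2 * d₃ - d₄,
      a.x₀ * b.x₄ + a.x₄ * b.x₀ + 7 * c₄ + 70 * c₆ + 3 * d₁ + 9 * d₂ + 27 * d₃ + 21 * d₄⟩⟩

/-- The element of the subring `ℤ`. -/
def ofInt (n : ℤ) : QuinticInt := ⟨n, 0, 0, 0, 0⟩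

/-- The value of a coordinate vector. -/
def value {R : Type*} [CommRing R] (t v : R) (a : QuinticInt) : R :=
  a.x₀ + a.x₁ * t + a.x₂ * t ^ 2 + a.x₃ * t ^ 3 + a.x₄ * v

end QuinticInt

/-- The multiplication table of the basis `1, t, t ^ 2, t ^ 3, v`. -/
structure IsQuinticPair {R : Type*} [CommRing R] (t v : R) : Prop where
  t4 : t ^ 4 = -2 - 2 * t + t ^ 2 - 3 * t ^ 3 + 7 * v
  t5 : t ^ 5 = -1 - 10 * t - 5 * t ^ 2 + 10 * t ^ 3
  t6 : t ^ 6 = -20 - 21 * t - 35 * t ^ 3 + 70 * v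
  tv : t * v = -1 - 2 * t + 3 * v
  t2v : t ^ 2 * v = -3 - 7 * t - 2 * t ^ 2 + 9 * v
  t3v : t ^ 3 * v = -9 - 21 * t - 7 * t ^ 2 - 2 * t ^ 3 + 27 * v
  vv : v * v = -7 - 17 * t - 6 * t ^ 2 - t ^ 3 + 21 * v

section CommRing
variable {R S : Type*} [CommRing R] [CommRing S] {t v : R}

theorem IsQuinticPair.map (h : IsQuinticPair t v) (f : R →+* S) : IsQuinticPair (f t) (f v) := by
  constructor
  · simpa [map_ofNat] using congrArg f h.t4
  · simpa [map_ofNat] using congrArg f h.t5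
  · simpa [map_ofNat] using congrArg f h.t6
  · simpa [map_ofNat] using congrArg f h.tv
  · simpa [map_ofNat] using congrArg f h.t2v
  · simpa [map_ofNat] using congrArg f h.t3v
  · simpa [map_ofNat] using congrArg f h.vv

theorem IsQuinticPair.of_root [IsDomain R] [CharZero R]
    (ht : t ^ 5 - 10 * t ^ 3 + 5 * t ^ 2 + 10 * t + 1 = 0)
    (hv : 7 * v = 2 + 2 * t - t ^ 2 + 3 * t ^ 3 + t ^ 4) : IsQuinticPair t v := by
  have h7 : (7 : R) ≠ 0 := by norm_num
  have htv : t * v = -1 - 2 * t + 3 * v := mul_left_cancel₀ h7 (by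
    linear_combination (t - 3) * hv + ht)
  refine ⟨by linear_combination -hv, by linear_combination ht, ?_, htv, ?_, ?_, ?_⟩
  · linear_combination t * ht - 10 * hv - 5 * ht + 5 * ht
  · linear_combination (t + 3) * htv
  · linear_combination (t ^ 2 + 3 * t + 9) * htv
  · refine mul_left_cancel₀ h7 ?_
    linear_combination v * hv + (3 * t ^ 2 + 9 * t + 27) * htv + (-(t + 3) + 2) * htv +
      (t ^ 3 + 3 * t ^ 2 + 9 * t + 27) * htv + 2 * hv

namespace QuinticInt

theorem value_add (a b : QuinticInt) : value t v (a + b) = value t v a + value t v b := by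
  change value t v ⟨_, _, _, _, _⟩ = _
  simp only [value, Int.cast_add]
  ring

theorem value_sub (a b : QuinticInt) : value t v (a - b) = value t v a - value t v b := by
  change value t v ⟨_, _, _, _, _⟩ = _
  simp only [value, Int.cast_sub]
  ring

theorem value_ofInt (n : ℤ) : value t v (ofInt n) = n := by
  simp [value, ofInt]

theorem value_mul (h : IsQuinticPair t v) (a b : QuinticInt) :
    value t v (a * b) = value t v a * value t v b := by
  change value t v ⟨_, _, _, _, _⟩ = _
  simp only [value]
  push_cast
  linear_combination -(a.x₁ * b.x₃ + a.x₂ * b.x₂ + a.x₃ * b.x₁ : R) * h.t4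
    - (a.x₂ * b.x₃ + a.x₃ * b.x₂ : R) * h.t5 - (a.x₃ * b.x₃ : R) * h.t6
    - (a.x₁ * b.x₄ + a.x₄ * b.x₁ : R) * h.tv - (a.x₂ * b.x₄ + a.x₄ * b.x₂ : R) * h.t2v
    - (a.x₃ * b.x₄ + a.x₄ * b.x₃ : R) * h.t3v - (a.x₄ * b.x₄ : R) * h.vv

theorem map_value (f : R →+* S) (a : QuinticInt) : f (value t v a) = value (f t) (f v) a := by
  simp [value]

/-- The coordinates of the `k`-th conjugate of `t`. -/
def conjT : ZMod 5 → QuinticInt :=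
  ![⟨0, 1, 0, 0, 0⟩, ⟨2, 4, -5, -2, 4⟩, ⟨0, 0, 3, 1, -3⟩, ⟨-3, -2, 3, 1, -2⟩, ⟨1, -3, -1, 0, 1⟩]

/-- The coordinates of the `k`-th conjugate of `v`. -/
def conjV : ZMod 5 → QuinticInt :=
  ![⟨0, 0, 0, 0, 1⟩, ⟨11, 7, -14, -5, 11⟩, ⟨2, 4, 7, 2, -7⟩, ⟨-1, -1, 1, 0, 0⟩, ⟨3, -10, 6, 3, -5⟩]

/-- Substitution of the `k`-th conjugate. -/
def conj (k : ZMod 5) (a : QuinticInt) : QuinticInt :=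
  ofInt a.x₀ + ofInt a.x₁ * conjT k + ofInt a.x₂ * (conjT k * conjT k)
    + ofInt a.x₃ * (conjT k * (conjT k * conjT k)) + ofInt a.x₄ * conjV k

theorem value_conj (h : IsQuinticPair t v) (k : ZMod 5) (a : QuinticInt) :
    value t v (conj k a) = value (value t v (conjT k)) (value t v (conjV k)) a := by
  simp only [conj, value_add, value_mul h, value_ofInt]
  simp only [value]
  ring

end QuinticInt

open QuinticInt

theorem IsQuinticPair.conj (h : IsQuinticPair t v) (k : ZMod 5) :
    IsQuinticPair (value t v (conjT k)) (value t v (conjV k)) := by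
  have key : ∀ a b : QuinticInt, a = b → value t v a = value t v b := fun a b => congrArg _
  have h4 := key _ _ ((by decide : ∀ k, conjT k * (conjT k * (conjT k * conjT k)) =
    ofInt (-2) - ofInt 2 * conjT k + conjT k * conjT k - ofInt 3 * (conjT k * (conjT k * conjT k))
      + ofInt 7 * conjV k) k)
  have hv := key _ _ ((by decide : ∀ k, conjT k * conjV k =
    ofInt (-1) - ofInt 2 * conjT k + ofInt 3 * conjV k) k)
  have h5 := key _ _ ((by decide : ∀ k, conjT k * (conjT k * (conjT k * (conjT k * conjT k))) =
    ofInt (-1) - ofInt 10 * conjT k - ofInt 5 * (conjT k * conjT k)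
      + ofInt 10 * (conjT k * (conjT k * conjT k))) k)
  have hvv := key _ _ ((by decide : ∀ k, conjV k * conjV k =
    ofInt (-7) - ofInt 17 * conjT k - ofInt 6 * (conjT k * conjT k)
      - (conjT k * (conjT k * conjT k)) + ofInt 21 * conjV k) k)
  simp only [value_add, value_sub, value_mul h, value_ofInt] at h4 hv h5 hvv
  push_cast at h4 hv h5 hvv
  generalize value t v (conjT k) = s at *
  generalize value t v (conjV k) = w at *
  refine ⟨by linear_combination h4, by linear_combination h5, ?_, hv, ?_, ?_, ?_⟩
  · linear_combination s * h5 + 10 * h4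
  · linear_combination (s + 3) * hv
  · linear_combination (s ^ 2 + 3 * s + 9) * hv
  · linear_combination hvv

end CommRing
end QuinticField

section QuinticField
open Polynomial

namespace QuinticInt

/-- One fifth of the coefficient of `X ^ 2` of the quintic. -/
def coeffA : QuinticInt := ⟨8, 14, -9, -4, 6⟩

/-- One fifth of the coefficient of `X` of the quintic. -/
def coeffB : QuinticInt := ⟨14, 16, 0, -1, -4⟩

/-- The constant coefficient of the quintic. -/
def coeffC : QuinticInt := ⟨-10, 14, 36, 10, -22⟩

/-- The square root of the discriminant of the quintic divided by `5 ^ 5`. -/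
def sqrtDisc : QuinticInt := ⟨-928, -38, 978, 297, -791⟩

end QuinticInt

open QuinticInt

section Discriminant
variable {R : Type*} [CommRing R] {A B C : R} {α : Fin 5 → R}

theorem prod_eval_quadratic_eq [IsDomain R] {a b c L M : R}
    (h : (X ^ 5 + Polynomial.C (5 * A) * X ^ 2 + Polynomial.C (5 * B) * X + Polynomial.C C : R[X]) =
      ∏ j, (X - Polynomial.C (α j)))
    (ha : a ≠ 0)
    (hL : L = b ^ 4 - 3 * a * b ^ 2 * c + a ^ 2 * c ^ 2 - 5 * A * a ^ 3 * b + 5 * B * a ^ 4)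
    (hM : M = b ^ 3 * c - 2 * a * b * c ^ 2 - 5 * A * a ^ 3 * c + C * a ^ 4) :
    a ^ 4 * ∏ j, (a * α j ^ 2 + b * α j + c) = L ^ 2 * c - L * M * b + a * M ^ 2 := by
  let K := AlgebraicClosure (FractionRing R)
  let f : R →+* K := (algebraMap (FractionRing R) K).comp (algebraMap R (FractionRing R))
  have hf : Function.Injective f :=
    (algebraMap (FractionRing R) K).injective.comp (IsFractionRing.injective R _)
  have ha' : f a ≠ 0 := (map_ne_zero_iff f hf).2 ha
  obtain ⟨x, hx⟩ := IsAlgClosed.exists_root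
    (Polynomial.C (f a) * X ^ 2 + Polynomial.C (f b) * X + Polynomial.C (f c) : K[X])
    (by rw [degree_quadratic ha']; norm_num)
  simp only [IsRoot.def, eval_add, eval_mul, eval_C, eval_pow, eval_X] at hx
  obtain ⟨y, hy⟩ : ∃ y, f a * (x + y) = -f b := ⟨-f b / f a - x, by
    rw [add_sub_cancel, mul_div_cancel₀ _ ha']⟩
  have hxy : f a * (x * y) = f c := by linear_combination x * hy - hx
  have hy' : f a * y ^ 2 + f b * y + f c = 0 := by linear_combination y * hy - hxy
  have key : ∀ z, ∏ j, (f (α j) - z) = -(z ^ 5 + 5 * f A * z ^ 2 + 5 * f B * z + f C) := by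
    intro z
    have := congrArg (fun p => (p.map f).eval z) h
    simp only [Polynomial.map_add, Polynomial.map_mul, Polynomial.map_pow, map_X, map_C,
      eval_add, eval_mul, eval_pow, eval_X, eval_C, Polynomial.map_prod, eval_prod,
      Polynomial.map_sub, eval_sub] at this
    simp only [map_mul, map_ofNat] at this
    rw [this]
    simp only [Fin.prod_univ_five]
    ring
  have lin : ∀ z, f a * z ^ 2 + f b * z + f c = 0 →
      f a ^ 4 * (z ^ 5 + 5 * f A * z ^ 2 + 5 * f B * z + f C) = f L * z + f M := by
    intro z hz
    rw [hL, hM]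
    simp only [map_add, map_sub, map_mul, map_pow, map_ofNat]
    linear_combination (f a ^ 3 * z ^ 3 - f a ^ 2 * f b * z ^ 2 + f a * f b ^ 2 * z
      - f a ^ 2 * f c * z + 2 * f a * f b * f c - f b ^ 3 + 5 * f a ^ 3 * f A) * hz
  apply hf
  simp only [map_mul, map_pow, map_prod, map_add, map_sub]
  have fac : ∀ j, f a * f (α j) ^ 2 + f b * f (α j) + f c
      = f a * ((f (α j) - x) * (f (α j) - y)) := by
    intro j
    linear_combination f (α j) * hy - hxy
  rw [Finset.prod_congr rfl fun j _ => fac j, Finset.prod_mul_distrib, Finset.prod_mul_distrib,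
    key, key, Finset.prod_const, Finset.card_univ, Fintype.card_fin]
  have h1 := lin x hx
  have h2 := lin y hy'
  generalize x ^ 5 + 5 * f A * x ^ 2 + 5 * f B * x + f C = u at *
  generalize y ^ 5 + 5 * f A * y ^ 2 + 5 * f B * y + f C = w at *
  linear_combination f a ^ 5 * w * h1 + f a * (f L * x + f M) * h2 + f L ^ 2 * hxy
    + f L * f M * hy

theorem mul_prod_deriv_eq
    (h : (X ^ 5 + Polynomial.C (5 * A) * X ^ 2 + Polynomial.C (5 * B) * X + Polynomial.C C : R[X]) =
      ∏ j, (X - Polynomial.C (α j))) :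
    C * ∏ j, (5 * α j ^ 4 + 10 * A * α j + 5 * B) =
      5 ^ 5 * ∏ j, (3 * A * α j ^ 2 + 4 * B * α j + C) := by
  have h0 : C = -∏ j, α j := by
    have := congrArg (eval 0) h
    simp only [eval_add, eval_mul, eval_pow, eval_X, eval_C, eval_prod, eval_sub, zero_sub,
      Finset.prod_neg, Finset.card_univ, Fintype.card_fin] at this
    linear_combination this
  have hr : ∀ j, α j ^ 5 + 5 * A * α j ^ 2 + 5 * B * α j + C = 0 := by
    intro j
    have := congrArg (eval (α j)) h
    rw [eval_prod, Finset.prod_eq_zero (Finset.mem_univ j) (by simp)] at this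
    simpa using this
  have h1 : ∀ j, α j * (5 * α j ^ 4 + 10 * A * α j + 5 * B) =
      (-5) * (3 * A * α j ^ 2 + 4 * B * α j + C) := by
    intro j
    linear_combination 5 * hr j
  have h2 := Finset.prod_congr rfl fun j (_ : j ∈ Finset.univ) => h1 j
  rw [Finset.prod_mul_distrib, Finset.prod_mul_distrib, Finset.prod_const, Finset.card_univ,
    Fintype.card_fin] at h2
  linear_combination -h2 + (∏ j, (5 * α j ^ 4 + 10 * A * α j + 5 * B)) * h0

theorem det_vandermonde_sq
    (h : (X ^ 5 + Polynomial.C (5 * A) * X ^ 2 + Polynomial.C (5 * B) * X + Polynomial.C C : R[X]) =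
      ∏ j, (X - Polynomial.C (α j))) :
    (Matrix.vandermonde α).det ^ 2 = ∏ j, (5 * α j ^ 4 + 10 * A * α j + 5 * B) := by
  have h1 : ∀ j, 5 * α j ^ 4 + 10 * A * α j + 5 * B
      = ∏ k ∈ Finset.univ.erase j, (α j - α k) := by
    intro j
    have := congrArg (fun p => (derivative p).eval (α j)) h
    simp only [derivative_prod_finset, eval_finsetSum, eval_prod, eval_sub, eval_X, eval_C,
      derivative_sub, derivative_X, derivative_C, sub_zero, mul_one] at this
    rw [Finset.sum_eq_single j ?_ (by simp)] at this
    · rw [← this]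
      simp
      ring
    · intro k _ hk
      exact Finset.prod_eq_zero (i := j) (by simp [hk.symm]) (sub_self _)
  rw [Finset.prod_congr rfl fun j _ => h1 j, Matrix.det_vandermonde]
  have e : ∀ j : Fin 5, (∏ k ∈ Finset.univ.erase j, (α j - α k)) =
      ∏ k : Fin 5, if k = j then 1 else (α j - α k) := by
    intro j
    rw [← Finset.mul_prod_erase _ _ (Finset.mem_univ j), if_pos rfl, one_mul]
    exact Finset.prod_congr rfl fun k hk => by rw [if_neg (Finset.ne_of_mem_erase hk)]
  have e' : ∀ i : Fin 5, (∏ j ∈ Finset.Ioi i, (α j - α i)) =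
      ∏ j : Fin 5, if i < j then (α j - α i) else 1 := by
    intro i
    rw [← Finset.prod_filter]
    congr 1
    ext; simp
  rw [Finset.prod_congr rfl fun j _ => e j, Finset.prod_congr rfl fun j _ => e' j]
  have n : ∀ i j : Fin 5, α i - α j = -(α j - α i) := fun i j => by ring
  simp only [Fin.prod_univ_five, Fin.isValue, Fin.reduceLT, Fin.reduceEq, if_true, if_false]
  rw [n 0 1, n 0 2, n 0 3, n 0 4, n 1 2, n 1 3, n 1 4, n 2 3, n 2 4, n 3 4]
  generalize α 1 - α 0 = a1, α 2 - α 0 = a2, α 3 - α 0 = a3, α 4 - α 0 = a4, α 2 - α 1 = a5,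
    α 3 - α 1 = a6, α 4 - α 1 = a7, α 3 - α 2 = a8, α 4 - α 2 = a9, α 4 - α 3 = a10
  simp
  ring

end Discriminant
end QuinticField

section QuinticField
open Polynomial QuinticInt

variable {R : Type*} [CommRing R] {t v : R}

theorem IsQuinticPair.value_ne_zero [CharZero R] (hp : IsQuinticPair t v) {a : QuinticInt}
    (b : QuinticInt) {n : ℤ} (hn : n ≠ 0) (h : a * b = ofInt n) : value t v a ≠ 0 := by
  intro h0
  have := congrArg (value t v) h
  rw [value_mul hp, h0, zero_mul, value_ofInt, eq_comm, Int.cast_eq_zero] at this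
  exact hn this

theorem IsQuinticPair.coeffA_ne_zero [CharZero R] (hp : IsQuinticPair t v) :
    value t v coeffA ≠ 0 :=
  hp.value_ne_zero ⟨11, 8, -12, 19, -22⟩ (n := 35) (by decide) (by decide)

theorem IsQuinticPair.coeffC_ne_zero [CharZero R] (hp : IsQuinticPair t v) :
    value t v coeffC ≠ 0 :=
  hp.value_ne_zero ⟨151, 58, -297, 634, -672⟩ (n := 490) (by decide) (by decide)

theorem sqrtDisc_mul : sqrtDisc * ⟨26410454, -15186303, -25291968, 97630624, -109191705⟩ =
    ofInt (5 * 435649) := by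
  decide +kernel

theorem IsQuinticPair.sqrtDisc_ne_zero [CharZero R] (hp : IsQuinticPair t v) :
    value t v sqrtDisc ≠ 0 :=
  hp.value_ne_zero _ (by decide) sqrtDisc_mul

namespace QuinticInt

/-- The leading coefficient of the remainder of the quintic modulo a quadratic polynomial. -/
def remL : QuinticInt :=
  let a := ofInt 3 * coeffA
  let b := ofInt 4 * coeffB
  let c := coeffC
  b * b * (b * b) - ofInt 3 * a * (b * b) * c + a * a * (c * c)
    - ofInt 5 * coeffA * (a * a * a) * b + ofInt 5 * coeffB * (a * a * (a * a))

/-- The constant coefficient of the remainder of the quintic modulo a quadratic polynomial. -/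
def remM : QuinticInt :=
  let a := ofInt 3 * coeffA
  let b := ofInt 4 * coeffB
  let c := coeffC
  b * b * b * c - ofInt 2 * a * b * (c * c) - ofInt 5 * coeffA * (a * a * a) * c
    + coeffC * (a * a * (a * a))

theorem remL_remM : remL * remL * coeffC - remL * remM * (ofInt 4 * coeffB) +
      ofInt 3 * coeffA * (remM * remM) =
    ofInt 81 * (coeffA * coeffA * (coeffA * coeffA)) * coeffC * (sqrtDisc * sqrtDisc) := by
  decide +kernel

end QuinticInt

/-- The quintic polynomial over the ring generated by `t` and `v`. -/
noncomputable def quinticPoly (t v : R) : R[X] :=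
  X ^ 5 + C (5 * value t v coeffA) * X ^ 2 + C (5 * value t v coeffB) * X + C (value t v coeffC)

theorem IsQuinticPair.vandermonde_sq [IsDomain R] [CharZero R] (hp : IsQuinticPair t v)
    {α : Fin 5 → R} (h : quinticPoly t v = ∏ j, (X - C (α j))) :
    (Matrix.vandermonde α).det ^ 2 = 5 ^ 5 * value t v sqrtDisc ^ 2 := by
  have h1 := prod_eval_quadratic_eq h (a := 3 * value t v coeffA) (b := 4 * value t v coeffB)
    (c := value t v coeffC) (L := value t v remL) (M := value t v remM)
    (mul_ne_zero (by norm_num) hp.coeffA_ne_zero)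
    (by
      simp only [remL, value_add, value_sub, value_mul hp, value_ofInt]
      push_cast
      ring)
    (by
      simp only [remM, value_add, value_sub, value_mul hp, value_ofInt]
      push_cast
      ring)
  have h2 := congrArg (value t v) remL_remM
  simp only [value_add, value_sub, value_mul hp, value_ofInt] at h2
  push_cast at h2
  have h3 := mul_prod_deriv_eq h
  rw [det_vandermonde_sq h]
  have hA := hp.coeffA_ne_zero
  have hC := hp.coeffC_ne_zero
  refine mul_left_cancel₀ (mul_ne_zero (mul_ne_zero (by norm_num : (81 : R) ≠ 0)
    (pow_ne_zero 4 hA)) hC) ?_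
  linear_combination 81 * value t v coeffA ^ 4 * h3 + 5 ^ 5 * h1 + 5 ^ 5 * h2

theorem IsQuinticPair.injective_roots [IsDomain R] [CharZero R] (hp : IsQuinticPair t v)
    {α : Fin 5 → R} (h : quinticPoly t v = ∏ j, (X - C (α j))) : Function.Injective α := by
  rw [← Matrix.det_vandermonde_ne_zero_iff]
  intro h0
  have := hp.vandermonde_sq h
  rw [h0, zero_pow two_ne_zero, eq_comm] at this
  exact mul_ne_zero (by norm_num) (pow_ne_zero 2 hp.sqrtDisc_ne_zero) this

end QuinticField

section QuinticField
open Polynomial QuinticInt NumberField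

section CommRing
variable {R S : Type*} [CommRing R] [CommRing S] {t v : R}

namespace QuinticInt

theorem conj_conjT : ∀ i k : ZMod 5, conj i (conjT k) = conjT (i + k) := by decide +kernel

theorem conj_conjV : ∀ i k : ZMod 5, conj i (conjV k) = conjV (i + k) := by decide +kernel

end QuinticInt

theorem IsQuinticPair.five_eq_zero (hp : IsQuinticPair t v) {k : ZMod 5} (hk : k ≠ 0)
    (ht : value t v (conjT k) = t) (hv : value t v (conjV k) = v) : (5 : R) = 0 := by
  have cert : ∀ k : ZMod 5, k ≠ 0 → ∃ a b : QuinticInt,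
      (conjT k - conjT 0) * a + (conjV k - conjV 0) * b = ofInt 5 := by
    intro k hk
    fin_cases k
    · exact absurd rfl hk
    · exact ⟨⟨0, 2, -1, 0, -1⟩, ⟨0, 0, -1, -1, 2⟩, by decide⟩
    · exact ⟨⟨-7, -3, 2, 1, -4⟩, ⟨-1, -5, 4, 1, -1⟩, by decide⟩
    · exact ⟨⟨-2, -5, 6, 0, -3⟩, ⟨2, -3, 2, 2, -3⟩, by decide⟩
    · exact ⟨⟨0, -2, 0, 0, 0⟩, ⟨2, 2, -1, 0, 0⟩, by decide⟩
  obtain ⟨a, b, h⟩ := cert k hk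
  have h0 : value t v (conjT 0) = t := by simp [conjT, value]
  have h0' : value t v (conjV 0) = v := by simp [conjV, value]
  have := congrArg (value t v) h
  rw [value_add, value_mul hp, value_mul hp, value_sub, value_sub, ht, hv, h0, h0', sub_self,
    sub_self, zero_mul, zero_mul, add_zero, value_ofInt] at this
  exact_mod_cast this.symm

theorem IsQuinticPair.prod_sub_conjT (hp : IsQuinticPair t v) (x : R) :
    ∏ k, (x - value t v (conjT k)) = x ^ 5 - 10 * x ^ 3 + 5 * x ^ 2 + 10 * x + 1 := by
  have h2 := congrArg (value t v) (by decide :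
    conjT 0 + conjT 1 + conjT 2 + conjT 3 + conjT 4 = ofInt 0)
  have h3 := congrArg (value t v) (by decide :
    conjT 0 * (conjT 1 + conjT 2 + conjT 3 + conjT 4) + conjT 1 * (conjT 2 + conjT 3 + conjT 4)
      + conjT 2 * (conjT 3 + conjT 4) + conjT 3 * conjT 4 = ofInt (-10))
  have h4 := congrArg (value t v) (by decide :
    conjT 0 * (conjT 1 * (conjT 2 + conjT 3 + conjT 4) + conjT 2 * (conjT 3 + conjT 4)
      + conjT 3 * conjT 4) + conjT 1 * (conjT 2 * (conjT 3 + conjT 4) + conjT 3 * conjT 4)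
      + conjT 2 * (conjT 3 * conjT 4) = ofInt (-5))
  have h5 := congrArg (value t v) (by decide :
    conjT 0 * conjT 1 * (conjT 2 * conjT 3 + conjT 2 * conjT 4 + conjT 3 * conjT 4)
      + (conjT 0 + conjT 1) * (conjT 2 * conjT 3 * conjT 4) = ofInt 10)
  have h6 := congrArg (value t v) (by decide :
    conjT 0 * conjT 1 * (conjT 2 * conjT 3) * conjT 4 = ofInt (-1))
  simp only [value_add, value_mul hp, value_ofInt] at h2 h3 h4 h5 h6
  push_cast at h2 h3 h4 h5 h6
  refine (Fin.prod_univ_five (fun k : Fin 5 => x - value t v (conjT k))).trans ?_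
  change (x - value t v (conjT 0)) * (x - value t v (conjT 1)) * (x - value t v (conjT 2))
    * (x - value t v (conjT 3)) * (x - value t v (conjT 4)) = _
  linear_combination -x ^ 4 * h2 + x ^ 3 * h3 - x ^ 2 * h4 + x * h5 - h6

theorem IsQuinticPair.eq_of_left_eq [IsDomain R] [CharZero R] {w : R} (hp : IsQuinticPair t v)
    (hq : IsQuinticPair t w) : v = w := by
  refine mul_left_cancel₀ (by norm_num : (7 : R) ≠ 0) ?_
  linear_combination hq.t4 - hp.t4

theorem quinticPoly_map (f : R →+* S) : (quinticPoly t v).map f = quinticPoly (f t) (f v) := by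
  simp only [quinticPoly, Polynomial.map_add, Polynomial.map_mul, Polynomial.map_pow, map_X,
    Polynomial.map_C]
  simp only [map_mul, map_ofNat, map_value]

end CommRing

/-- The number field `L` is generated by the conjugates of `t` and the roots of the five conjugates
of the quintic polynomial. -/
structure QuinticTower (L : Type) [Field L] [NumberField L] where
  θ : ZMod 5 → 𝓞 L
  v : ZMod 5 → 𝓞 L
  α : ZMod 5 → Fin 5 → 𝓞 L
  pair : ∀ i, IsQuinticPair (θ i) (v i)
  θ_add : ∀ i k, θ (i + k) = value (θ i) (v i) (conjT k)
  v_add : ∀ i k, v (i + k) = value (θ i) (v i) (conjV k)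
  splits : ∀ i, quinticPoly (θ i) (v i) = ∏ j, (X - C (α i j))
  faithful : ∀ σ : L ≃ₐ[ℚ] L, (∀ i, σ • θ i = θ i) → (∀ i j, σ • α i j = α i j) → σ = 1

namespace QuinticTower
variable {L : Type} [Field L] [NumberField L] (T : QuinticTower L)

theorem θ_injective : Function.Injective T.θ := by
  intro i j hij
  by_contra hne
  have hv : T.v i = T.v j := (T.pair i).eq_of_left_eq (by rw [hij]; exact T.pair j)
  have := (T.pair i).five_eq_zero (k := j - i) (sub_ne_zero.2 (Ne.symm hne))
    (by rw [← T.θ_add, add_sub_cancel, hij]) (by rw [← T.v_add, add_sub_cancel, hv])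
  norm_num at this

theorem smul_value (σ : L ≃ₐ[ℚ] L) (t v : 𝓞 L) (a : QuinticInt) :
    σ • value t v a = value (σ • t) (σ • v) a :=
  map_value (MulSemiringAction.toRingHom (L ≃ₐ[ℚ] L) (𝓞 L) σ) a

theorem exists_shift (σ : L ≃ₐ[ℚ] L) :
    ∃ k : ZMod 5, ∀ i, σ • T.θ i = T.θ (i + k) ∧ σ • T.v i = T.v (i + k) := by
  have hσ := (T.pair 0).map (MulSemiringAction.toRingHom (L ≃ₐ[ℚ] L) (𝓞 L) σ)
  change IsQuinticPair (σ • T.θ 0) (σ • T.v 0) at hσ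
  have h := (T.pair 0).prod_sub_conjT (σ • T.θ 0)
  rw [show (σ • T.θ 0) ^ 5 - 10 * (σ • T.θ 0) ^ 3 + 5 * (σ • T.θ 0) ^ 2 + 10 * (σ • T.θ 0) + 1 = 0 by
    linear_combination hσ.t5, Finset.prod_eq_zero_iff] at h
  obtain ⟨k, -, hk⟩ := h
  rw [← T.θ_add, zero_add, sub_eq_zero] at hk
  have hv : σ • T.v 0 = T.v k := hσ.eq_of_left_eq (by rw [hk]; exact T.pair k)
  refine ⟨k, fun i => ⟨?_, ?_⟩⟩
  · rw [← zero_add i, T.θ_add, smul_value, hk, hv, zero_add, add_comm, T.θ_add]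
  · rw [← zero_add i, T.v_add, smul_value, hk, hv, zero_add, add_comm, T.v_add]

/-- The index by which an automorphism shifts the conjugates of `t`. -/
noncomputable def shift (σ : L ≃ₐ[ℚ] L) : ZMod 5 := (T.exists_shift σ).choose

theorem smul_θ (σ : L ≃ₐ[ℚ] L) (i : ZMod 5) : σ • T.θ i = T.θ (i + T.shift σ) :=
  ((T.exists_shift σ).choose_spec i).1

theorem smul_v (σ : L ≃ₐ[ℚ] L) (i : ZMod 5) : σ • T.v i = T.v (i + T.shift σ) :=
  ((T.exists_shift σ).choose_spec i).2

theorem shift_eq_iff {σ : L ≃ₐ[ℚ] L} {i k : ZMod 5} : T.shift σ = k ↔ σ • T.θ i = T.θ (i + k) := by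
  rw [smul_θ, T.θ_injective.eq_iff, add_right_inj]

theorem shift_mul (σ τ : L ≃ₐ[ℚ] L) : T.shift (σ * τ) = T.shift σ + T.shift τ := by
  rw [T.shift_eq_iff (i := 0), mul_smul, smul_θ, smul_θ, add_assoc, add_comm (T.shift τ)]

theorem injective_α (i : ZMod 5) : Function.Injective (T.α i) :=
  (T.pair i).injective_roots (T.splits i)

theorem exists_smul_α_eq (σ : L ≃ₐ[ℚ] L) (i : ZMod 5) (j : Fin 5) :
    ∃ j', σ • T.α i j = T.α (i + T.shift σ) j' := by
  let f := MulSemiringAction.toRingHom (L ≃ₐ[ℚ] L) (𝓞 L) σ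
  have h : (quinticPoly (T.θ i) (T.v i)).map f =
      quinticPoly (T.θ (i + T.shift σ)) (T.v (i + T.shift σ)) := by
    rw [quinticPoly_map, ← T.smul_θ, ← T.smul_v]; rfl
  have := congrArg (fun p => (p.map f).eval (f (T.α i j))) (T.splits i)
  simp only [h, T.splits (i + T.shift σ), Polynomial.map_prod, Polynomial.map_sub, map_X, map_C,
    eval_prod, eval_sub, eval_X, eval_C] at this
  have hz : ∏ j', (f (T.α i j) - f (T.α i j')) = 0 :=
    Finset.prod_eq_zero (Finset.mem_univ j) (sub_self _)
  rw [hz, Finset.prod_eq_zero_iff] at this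
  obtain ⟨j', -, hj⟩ := this
  exact ⟨j', sub_eq_zero.1 hj⟩

/-- The permutation of the roots induced by an automorphism on a block. -/
noncomputable def perm (σ : L ≃ₐ[ℚ] L) (i : ZMod 5) : Equiv.Perm (Fin 5) :=
  Equiv.ofBijective (fun j => (T.exists_smul_α_eq σ i j).choose) <| by
    rw [← Finite.injective_iff_bijective]
    intro j j' h
    have hj := (T.exists_smul_α_eq σ i j).choose_spec
    have hj' := (T.exists_smul_α_eq σ i j').choose_spec
    simp only at h
    rw [h, ← hj'] at hj
    exact T.injective_α i (smul_left_cancel σ hj)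

theorem smul_α (σ : L ≃ₐ[ℚ] L) (i : ZMod 5) (j : Fin 5) :
    σ • T.α i j = T.α (i + T.shift σ) (T.perm σ i j) :=
  (T.exists_smul_α_eq σ i j).choose_spec

theorem perm_mul (σ τ : L ≃ₐ[ℚ] L) (i : ZMod 5) :
    T.perm (σ * τ) i = T.perm σ (i + T.shift τ) * T.perm τ i := by
  ext1 j
  apply T.injective_α (i + T.shift (σ * τ))
  rw [← smul_α, mul_smul, smul_α, smul_α, shift_mul, Equiv.Perm.mul_apply]
  congr 1
  ring

/-- The product of the differences of the roots in a block. -/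
noncomputable def disc (i : ZMod 5) : 𝓞 L := (Matrix.vandermonde (T.α i)).det

theorem disc_sq (i : ZMod 5) :
    T.disc i ^ 2 = 5 ^ 5 * value (T.θ i) (T.v i) sqrtDisc ^ 2 :=
  (T.pair i).vandermonde_sq (T.splits i)

theorem smul_disc {σ : L ≃ₐ[ℚ] L} (hσ : T.shift σ = 0) (i : ZMod 5) :
    σ • T.disc i = ((T.perm σ i).sign : ℤ) * T.disc i := by
  have : σ • T.disc i = (Matrix.vandermonde (T.α i ∘ T.perm σ i)).det := by
    change MulSemiringAction.toRingHom (L ≃ₐ[ℚ] L) (𝓞 L) σ _ = _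
    rw [disc, RingHom.map_det]
    congr 1
    ext1 j k
    simp [Matrix.vandermonde, T.smul_α, hσ]
  rw [this, disc, ← Matrix.det_permute]
  congr 1

theorem smul_sqrtDisc {σ : L ≃ₐ[ℚ] L} (hσ : T.shift σ = 0) (i : ZMod 5) (a : QuinticInt) :
    σ • value (T.θ i) (T.v i) a = value (T.θ i) (T.v i) a := by
  rw [smul_value, smul_θ, smul_v, hσ, add_zero]

theorem sqrtDisc_ne_zero (i : ZMod 5) : value (T.θ i) (T.v i) sqrtDisc ≠ 0 :=
  (T.pair i).sqrtDisc_ne_zero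

theorem disc_ne_zero (i : ZMod 5) : T.disc i ≠ 0 :=
  Matrix.det_vandermonde_ne_zero_iff.2 (T.injective_α i)

/-- The golden ratio. -/
theorem exists_golden :
    ∃ ω : 𝓞 L, ω ^ 2 = ω + 1 ∧
      ∀ i, ∃ ε : ℤˣ, T.disc i = (ε : ℤ) * (25 * value (T.θ i) (T.v i) sqrtDisc * (2 * ω - 1)) := by
  set e : L := algebraMap (𝓞 L) L (value (T.θ 0) (T.v 0) sqrtDisc) with he
  have he0 : e ≠ 0 := by
    rw [he, map_ne_zero_iff _ (FaithfulSMul.algebraMap_injective _ _)]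
    exact T.sqrtDisc_ne_zero 0
  set d : L := algebraMap (𝓞 L) L (T.disc 0) with hd
  have hde : d ^ 2 = 5 ^ 5 * e ^ 2 := by
    have := congrArg (algebraMap (𝓞 L) L) (T.disc_sq 0)
    simpa only [map_pow, map_mul, map_ofNat] using this
  set w : L := (1 + d / (25 * e)) / 2 with hw
  have hw2 : w ^ 2 = w + 1 := by
    rw [hw]; field_simp; linear_combination hde
  have hxi : IsIntegral ℤ w := ⟨X ^ 2 - X - 1, by
    rw [sub_sub, sub_eq_add_neg]
    exact monic_X_pow_add (by compute_degree!), by simp [hw2]⟩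
  obtain ⟨ω, hω⟩ : ∃ ω : 𝓞 L, (ω : L) = w := ⟨⟨w, hxi⟩, rfl⟩
  have h5 : ω ^ 2 = ω + 1 := by
    apply RingOfIntegers.ext
    simpa [hω] using hw2
  refine ⟨ω, h5, fun i => ?_⟩
  · have : T.disc i ^ 2 = (25 * value (T.θ i) (T.v i) sqrtDisc * (2 * ω - 1)) ^ 2 := by
      rw [disc_sq]
      linear_combination -2500 * value (T.θ i) (T.v i) sqrtDisc ^ 2 * h5
    rcases sq_eq_sq_iff_eq_or_eq_neg.1 this with h | h
    · exact ⟨1, by simpa using h⟩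
    · exact ⟨-1, by simpa using h⟩

theorem smul_golden {ω : 𝓞 L} {σ : L ≃ₐ[ℚ] L} (hσ : T.shift σ = 0) {i : ZMod 5} {ε : ℤˣ}
    (h : T.disc i = (ε : ℤ) * (25 * value (T.θ i) (T.v i) sqrtDisc * (2 * ω - 1))) :
    σ • (2 * ω - 1) = ((T.perm σ i).sign : ℤ) * (2 * ω - 1) := by
  have h1 := T.smul_disc hσ i
  rw [h] at h1
  simp only [smul_mul', T.smul_sqrtDisc hσ] at h1
  have hc : ∀ n : ℤ, σ • (n : 𝓞 L) = n := fun n =>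
    map_intCast (MulSemiringAction.toRingHom (L ≃ₐ[ℚ] L) (𝓞 L) σ) n
  have h25 : σ • (25 : 𝓞 L) = 25 := by exact_mod_cast hc 25
  rw [hc, h25] at h1
  have h0 := T.disc_ne_zero i
  have hne : ((ε : ℤ) : 𝓞 L) * (25 * value (T.θ i) (T.v i) sqrtDisc) ≠ 0 := by
    intro h'
    apply h0
    rw [h, ← mul_assoc, h', zero_mul]
  apply mul_left_cancel₀ hne
  linear_combination h1

end QuinticTower
end QuinticField

section QuinticField
open Polynomial QuinticInt NumberField

theorem NumberField.RingOfIntegers.exists_intCast_eq_of_forall_smul_eq {L : Type} [Field L]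
    [NumberField L] [IsGalois ℚ L] {x : 𝓞 L} (hx : ∀ σ : L ≃ₐ[ℚ] L, σ • x = x) :
    ∃ n : ℤ, (n : 𝓞 L) = x := by
  have h : (x : L) ∈ (⊥ : IntermediateField ℚ L) :=
    (IsGalois.mem_bot_iff_fixed _).2 fun σ => congrArg (algebraMap (𝓞 L) L) (hx σ)
  obtain ⟨q, hq⟩ := IntermediateField.mem_bot.1 h
  have hi : IsIntegral ℤ q := by
    rw [← isIntegral_algebraMap_iff (algebraMap ℚ L).injective, hq]
    exact x.isIntegral_coe
  obtain ⟨n, hn⟩ := IsIntegrallyClosed.isIntegral_iff.1 hi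
  refine ⟨n, RingOfIntegers.ext ?_⟩
  rw [← hq, ← hn]
  simp

namespace QuinticTower
variable {L : Type} [Field L] [NumberField L] (T : QuinticTower L)

/-- The action of the Galois group on the blocks of roots. -/
noncomputable def blockAction : BlockAction (L ≃ₐ[ℚ] L) where
  shift :=
    { toFun := fun σ => Multiplicative.ofAdd (T.shift σ)
      map_one' := by rw [T.shift_eq_iff (i := 0) (k := 0) |>.2 (by simp)]; rfl
      map_mul' := fun σ τ => by rw [shift_mul, ofAdd_add] }
  perm := T.perm
  perm_mul := T.perm_mul
  faithful := fun σ hσ h => by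
    change Multiplicative.ofAdd (T.shift σ) = 1 at hσ
    rw [ofAdd_eq_one] at hσ
    refine T.faithful σ (fun i => ?_) fun i j => ?_
    · rw [smul_θ, hσ, add_zero]
    · rw [smul_α, hσ, add_zero, h, Equiv.Perm.one_apply]
  sign_perm := fun σ hσ i j => by
    change Multiplicative.ofAdd (T.shift σ) = 1 at hσ
    rw [ofAdd_eq_one] at hσ
    obtain ⟨ω, hω, h⟩ := T.exists_golden
    obtain ⟨ε, hε⟩ := h i
    obtain ⟨ε', hε'⟩ := h j
    have h1 := T.smul_golden hσ hε
    rw [T.smul_golden hσ hε'] at h1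
    have hne : 2 * ω - 1 ≠ 0 := by
      intro h0
      have : (5 : 𝓞 L) = 0 := by linear_combination -4 * hω + (2 * ω - 1) * h0
      norm_num at this
    exact Units.ext (Int.cast_injective (mul_right_cancel₀ hne h1)).symm

theorem blockAction_shift {σ : L ≃ₐ[ℚ] L} : T.blockAction.shift σ = 1 ↔ T.shift σ = 0 :=
  ofAdd_eq_one

variable [IsGalois ℚ L]

theorem exists_shift_ne_zero : ∃ σ : L ≃ₐ[ℚ] L, T.shift σ ≠ 0 := by
  by_contra! h
  obtain ⟨n, hn⟩ := RingOfIntegers.exists_intCast_eq_of_forall_smul_eq (x := T.θ 0)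
    fun σ => by rw [smul_θ, h, add_zero]
  have h5 := (T.pair 0).t5
  rw [← hn] at h5
  have h5 : n ^ 5 = -1 - 10 * n - 5 * n ^ 2 + 10 * n ^ 3 := by exact_mod_cast h5
  have := congrArg (Int.cast : ℤ → ZMod 2) h5
  push_cast at this
  generalize (n : ZMod 2) = m at this
  revert this m
  decide

theorem exists_sign_eq_neg_one :
    ∃ σ : L ≃ₐ[ℚ] L, T.shift σ = 0 ∧ (T.perm σ 0).sign = -1 := by
  obtain ⟨ω, hω, h⟩ := T.exists_golden
  obtain ⟨ε, hε⟩ := h 0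
  obtain ⟨σ, hσ⟩ : ∃ σ : L ≃ₐ[ℚ] L, σ • ω ≠ ω := by
    by_contra! h
    obtain ⟨n, hn⟩ := RingOfIntegers.exists_intCast_eq_of_forall_smul_eq h
    rw [← hn] at hω
    have hω : n ^ 2 = n + 1 := by exact_mod_cast hω
    have := congrArg (Int.cast : ℤ → ZMod 2) hω
    push_cast at this
    generalize (n : ZMod 2) = m at this
    revert this m
    decide
  have h1 : σ • ω = 1 - ω := by
    have := congrArg (σ • ·) hω
    simp only [smul_pow', smul_add, smul_one] at this
    rcases mul_eq_zero.1 (show (σ • ω - ω) * (σ • ω - (1 - ω)) = 0 by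
      linear_combination this - hω) with h' | h'
    · exact absurd (sub_eq_zero.1 h') hσ
    · exact sub_eq_zero.1 h'
  have h2 : ∀ x : 𝓞 L, x = 1 - ω → σ • x = ω := by
    rintro x rfl
    rw [smul_sub, smul_one, h1, sub_sub_cancel]
  have h5 : σ ^ 5 • ω = 1 - ω := by
    simp only [pow_succ, pow_zero, one_mul, mul_smul]
    rw [h1, h2 _ rfl, h1, h2 _ rfl, h1]
  have hs : T.shift (σ ^ 5) = 0 := by
    simp only [pow_succ, pow_zero, one_mul, shift_mul]
    generalize T.shift σ = k
    revert k
    decide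
  refine ⟨σ ^ 5, hs, ?_⟩
  have h3 := T.smul_golden hs hε
  rw [smul_sub, smul_one, show (2 : 𝓞 L) * ω = ω + ω by ring, smul_add, h5] at h3
  rcases Int.units_eq_one_or (T.perm (σ ^ 5) 0).sign with h' | h'
  · rw [h'] at h3
    have : (10 : 𝓞 L) = 0 := by
      push_cast at h3
      linear_combination -8 * hω - (2 * ω - 1) * h3
    norm_num at this
  · exact h'

end QuinticTower
end QuinticField

section QuinticField
open Polynomial QuinticInt NumberField

theorem three_le_card_support_of_sign_eq_one :
    ∀ π : Equiv.Perm (Fin 5), π.sign = 1 → π ≠ 1 → 3 ≤ π.support.card := by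
  decide +kernel

section Collision
variable {R : Type*} [CommRing R] {t v : R} {β : Fin 5 → R}

theorem pow_dvd_prod_X_sub_C {ι : Type*} [Fintype ι] (β : ι → R) (x : R) (s : Finset ι)
    (hs : ∀ j ∈ s, β j = x) {n : ℕ} (hn : n ≤ s.card) : (X - C x) ^ n ∣ ∏ j, (X - C (β j)) := by
  refine (pow_dvd_pow _ hn).trans ?_
  rw [← Finset.prod_const, Finset.prod_congr rfl fun j hj => by rw [← hs j hj]]
  exact Finset.prod_dvd_prod_of_subset _ _ _ (Finset.subset_univ s)

theorem IsQuinticPair.eq_of_sqrtDisc_eq_zero [IsDomain R] (hp : IsQuinticPair t v)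
    (h5 : (5 : R) ≠ 0) (hE : value t v sqrtDisc = 0) :
    (435649 : R) = 0 ∧ t = 161497 ∧ v = 267750 := by
  have h1 : (435649 : R) = 0 := by
    have := congrArg (value t v) sqrtDisc_mul
    rw [value_mul hp, hE, zero_mul, value_ofInt, Int.cast_mul, eq_comm] at this
    exact_mod_cast (mul_eq_zero.1 this).resolve_left (by exact_mod_cast h5)
  have h2 : t = 161497 := by
    have := congrArg (value t v) (by decide +kernel :
      sqrtDisc * ⟨-9790669, 5629743, 9376033, -36192832, 40478662⟩ =
        ofInt 5 * ⟨-161497, 1, 0, 0, 0⟩)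
    rw [value_mul hp, hE, zero_mul, value_mul hp, value_ofInt] at this
    have := (mul_eq_zero.1 this.symm).resolve_left (by exact_mod_cast h5)
    simp only [value] at this
    push_cast at this
    linear_combination this
  refine ⟨h1, h2, ?_⟩
  have h3 := hp.t4
  rw [h2] at h3
  linear_combination (-311178) * h3 + ((485890119629322827664) + (-5) * v) * h1

theorem IsQuinticPair.eq_one_of_sign_eq_one [IsDomain R] (hp : IsQuinticPair t v)
    (h5 : (5 : R) ≠ 0) (h : quinticPoly t v = ∏ j, (X - C (β j)))
    (hd : (Matrix.vandermonde β).det ^ 2 = 5 ^ 5 * value t v sqrtDisc ^ 2)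
    {π : Equiv.Perm (Fin 5)} (hπ : ∀ j, β (π j) = β j) (hs : π.sign = 1) : π = 1 := by
  by_contra hne
  obtain ⟨j₀, hj₀⟩ : ∃ j, π j ≠ j := by
    by_contra! h'
    exact hne (Equiv.ext h')
  have hE : value t v sqrtDisc = 0 := by
    have h0 : (Matrix.vandermonde β).det = 0 := by
      by_contra h'
      exact hj₀ (Matrix.det_vandermonde_ne_zero_iff.1 h' (hπ j₀))
    rw [h0, zero_pow two_ne_zero] at hd
    exact pow_eq_zero_iff two_ne_zero |>.1
      ((mul_eq_zero.1 hd.symm).resolve_left (pow_ne_zero 5 h5))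
  obtain ⟨h1, ht, hv⟩ := hp.eq_of_sqrtDisc_eq_zero h5 hE
  have hq : quinticPoly t v = X ^ 5 + C (5 * 37559) * X ^ 2 + C (5 * 428337) * X + C 390163 := by
    have hA : value t v coeffA = 37559 := by
      simp only [value, coeffA, ht, hv]; push_cast; linear_combination (-38674321034) * h1
    have hB : value t v coeffB = 428337 := by
      simp only [value, coeffB, ht, hv]; push_cast; linear_combination (-9668445556) * h1
    have hC : value t v coeffC = 390163 := by
      simp only [value, coeffC, ht, hv]; push_cast; linear_combination (96686610811) * h1
    rw [quinticPoly, hA, hB, hC]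
  rw [hq] at h
  have double : ∀ j ∈ π.support, β j = 125707 := by
    intro j hj
    rw [Equiv.Perm.mem_support] at hj
    obtain ⟨g, hg⟩ := pow_dvd_prod_X_sub_C β (β j) {j, π j} (by simp [hπ]) (n := 2)
      (by rw [Finset.card_pair hj.symm])
    rw [← h] at hg
    have e1 := congrArg (eval (β j)) hg
    have e2 := congrArg (fun p => (derivative p).eval (β j)) hg
    simp only [eval_add, eval_mul, eval_pow, eval_sub, eval_X, eval_C, sub_self, derivative_add,
      derivative_mul, derivative_pow, derivative_X, derivative_C, derivative_sub,
      eval_natCast, zero_mul, zero_add, mul_one, add_zero, sub_zero, zero_pow two_ne_zero,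
      map_natCast] at e1 e2
    push_cast at e1 e2
    simp only [pow_one, mul_zero, zero_mul] at e2
    linear_combination (-61253 - 46179 * β j - 160730 * β j ^ 2 - 192108 * β j ^ 3) * e2
      + (-204754 - 67648 * β j + 89242 * β j ^ 2) * e1
      + (484500 + 1347000 * β j + 1170876 * β j ^ 2 + 673430 * β j ^ 3 + 127155 * β j ^ 4
        + β j ^ 5 + 2 * β j ^ 6 + 2 * β j ^ 7) * h1
  obtain ⟨g, hg⟩ := pow_dvd_prod_X_sub_C β 125707 π.support double
    (three_le_card_support_of_sign_eq_one π hs hne)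
  rw [← h] at hg
  have e := congrArg (fun p => (derivative (derivative p)).eval 125707) hg
  simp [derivative_pow] at e
  refine one_ne_zero (α := R) ?_
  linear_combination 248009 * e - 22617213705711601 * h1

end Collision

namespace QuinticTower
variable {L : Type} [Field L] [NumberField L] (T : QuinticTower L) {P : Ideal (𝓞 L)}

theorem pair_mk (i : ZMod 5) : IsQuinticPair (Ideal.Quotient.mk P (T.θ i))
    (Ideal.Quotient.mk P (T.v i)) :=
  (T.pair i).map _

theorem splits_mk (i : ZMod 5) :
    quinticPoly (Ideal.Quotient.mk P (T.θ i)) (Ideal.Quotient.mk P (T.v i)) =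
      ∏ j, (X - C (Ideal.Quotient.mk P (T.α i j))) := by
  have := congrArg (Polynomial.map (Ideal.Quotient.mk P)) (T.splits i)
  simpa only [quinticPoly_map, Polynomial.map_prod, Polynomial.map_sub, map_X, map_C] using this

theorem disc_sq_mk (i : ZMod 5) :
    (Matrix.vandermonde fun j => Ideal.Quotient.mk P (T.α i j)).det ^ 2 = 5 ^ 5 *
      value (Ideal.Quotient.mk P (T.θ i)) (Ideal.Quotient.mk P (T.v i)) sqrtDisc ^ 2 := by
  have := congrArg (Ideal.Quotient.mk P) (T.disc_sq i)
  rw [disc, map_pow, RingHom.map_det, map_mul, map_pow, map_pow, map_value, map_ofNat] at this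
  rw [← this]
  congr 2

theorem five_ne_zero_mk (h5 : (5 : 𝓞 L) ∉ P) : (5 : 𝓞 L ⧸ P) ≠ 0 := fun h =>
  h5 (by rw [← Ideal.Quotient.eq_zero_iff_mem, map_ofNat, h])

theorem shift_eq_zero_of_sub_mem (h5 : (5 : 𝓞 L) ∉ P) {σ : L ≃ₐ[ℚ] L} {i : ZMod 5}
    (hθ : σ • T.θ i - T.θ i ∈ P) (hv : σ • T.v i - T.v i ∈ P) : T.shift σ = 0 := by
  by_contra hne
  refine five_ne_zero_mk h5 ((T.pair_mk i).five_eq_zero hne ?_ ?_)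
  · rw [← map_value, ← T.θ_add, ← T.smul_θ]
    exact Ideal.Quotient.eq.2 hθ
  · rw [← map_value, ← T.v_add, ← T.smul_v]
    exact Ideal.Quotient.eq.2 hv

theorem eq_one_of_mem_inertia (T : QuinticTower L) [P.IsPrime] (h5 : (5 : 𝓞 L) ∉ P) {σ : L ≃ₐ[ℚ] L}
    (hσ : ∀ x : 𝓞 L, σ • x - x ∈ P) : σ = 1 := by
  have hs := T.shift_eq_zero_of_sub_mem h5 (i := 0) (hσ _) (hσ _)
  refine T.blockAction.faithful σ (T.blockAction_shift.2 hs) fun i => ?_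
  refine (T.pair_mk i).eq_one_of_sign_eq_one (five_ne_zero_mk h5) (T.splits_mk i) (T.disc_sq_mk i)
    (π := T.perm σ i) (fun j => ?_) ?_
  · have := hσ (T.α i j)
    rw [smul_α, hs, add_zero] at this
    exact Ideal.Quotient.eq.2 this
  · obtain ⟨ω, hω, h⟩ := T.exists_golden
    obtain ⟨ε, hε⟩ := h i
    have h1 := T.smul_golden hs hε
    refine (Int.units_eq_one_or _).resolve_right fun h' => h5 ?_
    rw [h', smul_sub, smul_one, show (2 : 𝓞 L) * ω = ω + ω by ring, smul_add] at h1
    push_cast at h1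
    have h2 : σ • ω = 1 - ω := mul_left_cancel₀ (two_ne_zero (α := 𝓞 L)) (by
      linear_combination h1)
    have h3 := hσ ω
    rw [h2] at h3
    have : (5 : 𝓞 L) = (1 - ω - ω) * (1 - ω - ω) := by linear_combination -4 * hω
    rw [this]
    exact P.mul_mem_left _ h3

end QuinticTower
end QuinticField

section QuinticField
open Polynomial QuinticInt NumberField

namespace QuinticTower
variable {L : Type} [Field L] [NumberField L] (T : QuinticTower L) {P : Ideal (𝓞 L)}

theorem prod_X_sub_C_θ :
    ∏ k, (X - C (T.θ k)) = (X ^ 5 - 10 * X ^ 3 + 5 * X ^ 2 + 10 * X + 1 : (𝓞 L)[X]) := by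
  rw [← ((T.pair 0).map C).prod_sub_conjT X]
  refine Finset.prod_congr rfl fun k _ => ?_
  rw [← map_value, ← T.θ_add, zero_add]

theorem prod_θ_sub_θ : ∏ k ∈ Finset.univ.erase (0 : ZMod 5), (T.θ 0 - T.θ k) =
    5 * T.θ 0 ^ 4 - 30 * T.θ 0 ^ 2 + 10 * T.θ 0 + 10 := by
  have h := congrArg (fun p => (derivative p).eval (T.θ 0)) T.prod_X_sub_C_θ
  simp only [derivative_prod_finset, eval_finsetSum, eval_prod, eval_sub, eval_X, eval_C,
    derivative_sub, derivative_X, derivative_C, sub_zero, mul_one] at h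
  rw [Finset.sum_eq_single 0
    (fun k _ hk => Finset.prod_eq_zero (i := 0) (by simp [hk.symm]) (sub_self _)) (by simp)] at h
  rw [h]
  simp
  ring

theorem eta_mul : 5 * ((T.θ 0 + 1) ^ 4 - 5 * (T.θ 0 + 1) ^ 2 + 5 * (T.θ 0 + 1) - 1) =
    (T.θ 0 + 1) ^ 5 := by
  linear_combination -(T.pair 0).t5

theorem eta_notMem [P.IsPrime] (h5 : (5 : 𝓞 L) ∈ P) : T.θ 0 + 1 ∈ P ∧
    (T.θ 0 + 1) ^ 4 - 5 * (T.θ 0 + 1) ^ 2 + 5 * (T.θ 0 + 1) - 1 ∉ P := by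
  have hw : T.θ 0 + 1 ∈ P := by
    refine Ideal.IsPrime.mem_of_pow_mem ‹_› 5 ?_
    rw [← T.eta_mul]
    exact P.mul_mem_right _ h5
  refine ⟨hw, fun h => (Ideal.ne_top_iff_one P).1 (Ideal.IsPrime.ne_top ‹_›) ?_⟩
  convert sub_mem (P.mul_mem_left ((T.θ 0 + 1) ^ 3 - 5 * (T.θ 0 + 1) + 5) hw) h using 1
  ring

theorem five_mul_idealOrd [P.IsPrime] (hP : P ≠ ⊥) (h5 : (5 : 𝓞 L) ∈ P) :
    5 * idealOrd P (T.θ 0 + 1) = idealOrd P 5 := by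
  have h := congrArg (idealOrd P) T.eta_mul
  rw [idealOrd_mul hP, idealOrd_eq_zero.2 (T.eta_notMem h5).2, add_zero, idealOrd_pow hP] at h
  rw [h]
  norm_num

theorem idealOrd_prod_θ_sub_θ [P.IsPrime] (hP : P ≠ ⊥) (h5 : (5 : 𝓞 L) ∈ P) :
    idealOrd P (∏ k ∈ Finset.univ.erase (0 : ZMod 5), (T.θ 0 - T.θ k)) =
      8 * idealOrd P (T.θ 0 + 1) := by
  obtain ⟨hw, hη⟩ := T.eta_notMem h5
  have hη' := T.eta_mul
  have h := T.prod_θ_sub_θ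
  rw [show 5 * T.θ 0 ^ 4 - 30 * T.θ 0 ^ 2 + 10 * T.θ 0 + 10 = 5 * (T.θ 0 + 1) ^ 4
    - 5 * (4 * (T.θ 0 + 1) ^ 3 - 10 * (T.θ 0 + 1) + 5) by ring] at h
  generalize T.θ 0 + 1 = w at *
  set η := w ^ 4 - 5 * w ^ 2 + 5 * w - 1 with hηd
  have key : η ^ 2 * ∏ k ∈ Finset.univ.erase (0 : ZMod 5), (T.θ 0 - T.θ k) =
      w ^ 8 * ((w - 4) * η + 2 * w ^ 3 - w ^ 2) := by
    rw [h]
    clear_value η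
    linear_combination (w ^ 4 * η - (4 * w ^ 3 - 10 * w + 5) * η + 2 * w ^ 6 - w ^ 5) * hη'
  have hu : (w - 4) * η + 2 * w ^ 3 - w ^ 2 ∉ P := by
    intro hu
    refine hη ?_
    convert add_mem (P.mul_mem_right η h5)
      (sub_mem hu (P.mul_mem_left (η + 2 * w ^ 2 - w) hw)) using 1
    ring
  have := congrArg (idealOrd P) key
  rw [idealOrd_mul hP, idealOrd_mul hP, idealOrd_pow hP, idealOrd_pow hP, idealOrd_eq_zero.2 hη,
    idealOrd_eq_zero.2 hu] at this
  simpa using this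

theorem sum_displacement_shift_le [P.IsPrime] (hP : P ≠ ⊥) {x r : 𝓞 L}
    (hx : IsLocalGenerator P x r) (k : ZMod 5) :
    ∑ σ with T.shift σ = k, displacement P x σ ≤ idealOrd P (T.θ 0 - T.θ k) := by
  rcases (Finset.univ.filter fun σ => T.shift σ = k).eq_empty_or_nonempty with h | ⟨ρ, hρ⟩
  · rw [h]; simp
  rw [Finset.mem_filter_univ] at hρ
  have := sum_displacement_le hP hx (Finset.univ.filter fun σ => T.shift σ = 0) (y := T.θ 0)
    (fun h hh => by rw [smul_θ, (Finset.mem_filter_univ _).1 hh, add_zero]) ρ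
  rw [displacement, smul_θ, hρ, zero_add, ← idealOrd_neg, neg_sub] at this
  refine le_trans (le_of_eq ?_) this
  refine (Finset.sum_bij (fun h _ => ρ * h) ?_ ?_ ?_ ?_).symm
  · intro h hh
    rw [Finset.mem_filter_univ] at hh ⊢
    rw [shift_mul, hρ, hh, add_zero]
  · exact fun _ _ _ _ h => mul_left_cancel h
  · intro σ hσ
    rw [Finset.mem_filter_univ] at hσ
    refine ⟨ρ⁻¹ * σ, ?_, mul_inv_cancel_left _ _⟩
    have := T.shift_mul ρ (ρ⁻¹ * σ)
    rw [mul_inv_cancel_left, hσ, hρ] at this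
    rw [Finset.mem_filter_univ]
    simpa using this
  · exact fun _ _ => rfl

variable [IsGalois ℚ L]

open scoped Classical in
theorem twenty_mul_sum_displacement_le (T : QuinticTower L) [P.IsPrime] (hP : P ≠ ⊥) (h5 : (5 : 𝓞 L) ∈ P)
    {x r : 𝓞 L} (hx : IsLocalGenerator P x r) :
    20 * ∑ σ ∈ Finset.univ.erase 1, displacement P x σ ≤ 61 * idealOrd P 5 := by
  have h1 : ∑ σ with T.shift σ ≠ 0, displacement P x σ ≤ 8 * idealOrd P (T.θ 0 + 1) := by
    rw [← T.idealOrd_prod_θ_sub_θ hP h5, idealOrd_prod hP,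
      ← Finset.sum_fiberwise_of_maps_to (t := Finset.univ.erase 0) (g := T.shift)
        (fun σ hσ => Finset.mem_erase.2 ⟨(Finset.mem_filter.1 hσ).2, Finset.mem_univ _⟩)]
    refine Finset.sum_le_sum fun k hk => ?_
    rw [Finset.filter_filter]
    refine (Finset.sum_le_sum_of_subset fun σ hσ => ?_).trans (T.sum_displacement_shift_le hP hx k)
    rw [Finset.mem_filter_univ] at hσ ⊢
    exact hσ.2
  have h2 := hx.twenty_mul_sum_displacement_le hP h5 T.blockAction.shift.ker (J := ZMod 5)
    (fun i =>
      { toFun := fun σ => T.perm σ i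
        map_one' := T.blockAction.perm_one i
        map_mul' := fun σ τ => T.blockAction.perm_mul_of_shift_eq_one _ τ.2 i })
    (fun σ hσ => Subtype.ext (T.blockAction.faithful _ σ.2 hσ)) (w := T.θ 0 + 1)
    (fun σ hσ => by
      rw [smul_add, smul_one, smul_θ, T.blockAction_shift.1 hσ, add_zero])
    (T.five_mul_idealOrd hP h5)
  have h3 : ∑ σ ∈ Finset.univ.erase 1, displacement P x σ ≤
      ∑ σ with T.shift σ ≠ 0, displacement P x σ +
        ∑ ρ with ρ ∈ T.blockAction.shift.ker ∧ ρ ≠ 1, displacement P x ρ := by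
    rw [← Finset.sum_filter_add_sum_filter_not _ (fun σ => T.shift σ ≠ 0)]
    refine add_le_add (Finset.sum_le_sum_of_subset fun σ hσ => ?_)
      (Finset.sum_le_sum_of_subset fun σ hσ => ?_)
    · rw [Finset.mem_filter] at hσ
      exact (Finset.mem_filter_univ _).2 hσ.2
    · rw [Finset.mem_filter, Finset.mem_erase, not_not] at hσ
      exact (Finset.mem_filter_univ _).2 ⟨T.blockAction_shift.2 hσ.2, hσ.1.1⟩
  have h5' := T.five_mul_idealOrd hP h5
  calc _ ≤ 20 * (∑ σ with T.shift σ ≠ 0, displacement P x σ +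
        ∑ ρ with ρ ∈ T.blockAction.shift.ker ∧ ρ ≠ 1, displacement P x ρ) := by gcongr
    _ ≤ 20 * (8 * idealOrd P (T.θ 0 + 1)) + 29 * idealOrd P 5 := by
      rw [mul_add]
      exact add_le_add (mul_le_mul_right h1 _) (le_of_eq_of_le (by congr!) h2)
    _ = 32 * idealOrd P 5 + 29 * idealOrd P 5 := by
      rw [← h5']
      ring
    _ = 61 * idealOrd P 5 := by
      rw [← add_mul]
      norm_num

theorem natAbs_discr_pow_dvd (T : QuinticTower L) :
    (discr L).natAbs ^ 20 ∣ 5 ^ (61 * Module.finrank ℚ L) := by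
  refine _root_.natAbs_discr_pow_dvd (L := L) (a := 20) (b := 61) (c := 5) fun P hPp hP x r hx => ?_
  by_cases h5 : (5 : 𝓞 L) ∈ P
  · simpa using T.twenty_mul_sum_displacement_le hP h5 hx
  · classical
    rw [Finset.sum_eq_zero]
    · simp
    · intro σ hσ
      by_contra h0
      refine Finset.ne_of_mem_erase hσ (T.eq_one_of_mem_inertia h5 ?_)
      exact (hx.mem_inertia_iff hP σ).2 (Order.one_le_iff_ne_zero.2 h0)

end QuinticTower
end QuinticField

/-- The coefficients of a polynomial of degree at most `4`. -/
structure QuarticPoly where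
  (c₀ c₁ c₂ c₃ c₄ : ℕ)
  deriving DecidableEq

namespace QuarticPoly

/-- The variable. -/
def var : QuarticPoly := ⟨0, 1, 0, 0, 0⟩

/-- Multiplication modulo `q` and `X ^ 5 - (a X ^ 2 + b X + c)`. -/
def mulMod (q a b c : ℕ) (x y : QuarticPoly) : QuarticPoly :=
  let d₈ := x.c₄ * y.c₄
  let d₇ := x.c₃ * y.c₄ + x.c₄ * y.c₃
  let d₆ := x.c₂ * y.c₄ + x.c₃ * y.c₃ + x.c₄ * y.c₂
  let d₅ := x.c₁ * y.c₄ + x.c₂ * y.c₃ + x.c₃ * y.c₂ + x.c₄ * y.c₁ + a * d₈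
  ⟨(x.c₀ * y.c₀ + c * d₅) % q, (x.c₀ * y.c₁ + x.c₁ * y.c₀ + b * d₅ + c * d₆) % q,
    (x.c₀ * y.c₂ + x.c₁ * y.c₁ + x.c₂ * y.c₀ + a * d₅ + b * d₆ + c * d₇) % q,
    (x.c₀ * y.c₃ + x.c₁ * y.c₂ + x.c₂ * y.c₁ + x.c₃ * y.c₀ + a * d₆ + b * d₇ + c * d₈) % q,
    (x.c₀ * y.c₄ + x.c₁ * y.c₃ + x.c₂ * y.c₂ + x.c₃ * y.c₁ + x.c₄ * y.c₀ + a * d₇ + b * d₈) % q⟩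

/-- A power with exponent given by its binary digits, leading digit first. -/
def powMod (q a b c : ℕ) (x : QuarticPoly) (l : List Bool) : QuarticPoly :=
  l.foldl (fun y i => bif i then mulMod q a b c (mulMod q a b c y y) x else mulMod q a b c y y)
    ⟨1, 0, 0, 0, 0⟩

/-- The number with given binary digits, leading digit first. -/
def ofDigits (l : List Bool) : ℕ := l.foldl (fun n i => bif i then n + n + 1 else n + n) 0

variable {R : Type*} [CommRing R] {β : R}

/-- The value at an element of a ring. -/
def value (β : R) (x : QuarticPoly) : R :=
  x.c₀ + x.c₁ * β + x.c₂ * β ^ 2 + x.c₃ * β ^ 3 + x.c₄ * β ^ 4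

theorem value_var : value β var = β := by simp [value, var]

theorem natCast_mod {q : ℕ} (hq : (q : R) = 0) (n : ℕ) : ((n % q : ℕ) : R) = n := by
  conv_rhs => rw [← Nat.mod_add_div n q]
  simp [hq]

section
variable {q a b c : ℕ} (hq : (q : R) = 0) (hβ : β ^ 5 = a * β ^ 2 + b * β + c)
include hq hβ

theorem value_mulMod (x y : QuarticPoly) :
    value β (mulMod q a b c x y) = value β x * value β y := by
  simp only [value, mulMod, natCast_mod hq]
  push_cast
  linear_combination -(x.c₁ * y.c₄ + x.c₂ * y.c₃ + x.c₃ * y.c₂ + x.c₄ * y.c₁ + a * (x.c₄ * y.c₄) +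
    (x.c₂ * y.c₄ + x.c₃ * y.c₃ + x.c₄ * y.c₂) * β + (x.c₃ * y.c₄ + x.c₄ * y.c₃) * β ^ 2 +
    x.c₄ * y.c₄ * β ^ 3) * hβ

theorem value_powMod (x : QuarticPoly) (l : List Bool) :
    value β (powMod q a b c x l) = value β x ^ ofDigits l := by
  suffices h : ∀ y n, value β y = value β x ^ n →
      value β (l.foldl (fun y i =>
        bif i then mulMod q a b c (mulMod q a b c y y) x else mulMod q a b c y y) y) =
      value β x ^ l.foldl (fun n i => bif i then n + n + 1 else n + n) n from
    h _ _ (by simp [value])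
  induction l with
  | nil => exact fun y n h => h
  | cons i l ih =>
    intro y n h
    refine ih _ _ ?_
    cases i
    · simp [value_mulMod hq hβ, h, pow_add]
    · simp [value_mulMod hq hβ, h, pow_add]

theorem value_iterate_powMod {l : List Bool} (hl : ofDigits l = q) (n : ℕ) :
    value β ((fun x => powMod q a b c x l)^[n] var) = β ^ q ^ n := by
  induction n with
  | zero => simp [value_var]
  | succ n ih =>
    rw [Function.iterate_succ_apply', value_powMod hq hβ, ih, hl, pow_succ q, pow_mul]

end

theorem natCast_c₂_eq_zero [IsDomain R] {γ : Fin 5 → R} (hγ : Function.Injective γ)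
    (x : QuarticPoly) (h : ∀ j, value (γ j) x = γ j) : (x.c₂ : R) = 0 := by
  open Polynomial in
  have := eq_zero_of_natDegree_lt_card_of_eval_eq_zero
    (C (x.c₀ : R) + C (x.c₁ - 1 : R) * X + C (x.c₂ : R) * X ^ 2 + C (x.c₃ : R) * X ^ 3 +
      C (x.c₄ : R) * X ^ 4) hγ
    (fun j => by
      have := h j
      simp only [value] at this
      simp only [eval_add, eval_mul, eval_C, eval_X, eval_pow]
      linear_combination this)
    (by rw [Fintype.card_fin, Nat.lt_succ_iff]; compute_degree)
  have := congrArg (Polynomial.coeff · 2) this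
  simpa [Polynomial.coeff_X, Polynomial.coeff_C, Polynomial.coeff_X_pow, Polynomial.coeff_one] using this

end QuarticPoly

section QuinticField
open Polynomial QuinticInt NumberField

theorem QuinticInt.intCast_value {R : Type*} [CommRing R] (t v : ℤ) (x : QuinticInt) :
    ((value t v x : ℤ) : R) = value (t : R) (v : R) x :=
  map_value (Int.castRingHom R) x

namespace QuinticTower
variable {L : Type} [Field L] [NumberField L] (T : QuinticTower L) {P : Ideal (𝓞 L)} {q : ℕ}

theorem pow_smul_sub_pow_mem {σ : L ≃ₐ[ℚ] L} (hσ : ∀ x : 𝓞 L, σ • x - x ^ q ∈ P) (n : ℕ)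
    (x : 𝓞 L) : σ ^ n • x - x ^ q ^ n ∈ P := by
  induction n generalizing x with
  | zero => simp
  | succ n ih =>
    have := add_mem (ih (σ • x)) (P.mem_of_dvd (sub_dvd_pow_sub_pow (σ • x) (x ^ q) (q ^ n)) (hσ x))
    rwa [sub_add_sub_cancel, ← pow_mul, ← pow_succ', ← mul_smul, ← pow_succ] at this

theorem injective_mk_α [P.IsPrime] (h5 : (5 : 𝓞 L) ∉ P) (i : ZMod 5)
    (hE : value (Ideal.Quotient.mk P (T.θ i)) (Ideal.Quotient.mk P (T.v i)) sqrtDisc ≠ 0) :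
    Function.Injective fun j => Ideal.Quotient.mk P (T.α i j) := by
  rw [← Matrix.det_vandermonde_ne_zero_iff, ← pow_ne_zero_iff two_ne_zero, T.disc_sq_mk]
  exact mul_ne_zero (pow_ne_zero _ (five_ne_zero_mk h5)) (pow_ne_zero _ hE)

/-- Reductions of the parameters of a block at a prime of residue characteristic `q`. -/
structure IsReduction (T : QuinticTower L) (P : Ideal (𝓞 L)) (q : ℕ) (i : ZMod 5) (t v : ℤ)
    (a b c : ℕ) : Prop where
  mk_θ : Ideal.Quotient.mk P (T.θ i) = t
  mk_v : Ideal.Quotient.mk P (T.v i) = v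
  coeffA : (q : ℤ) ∣ 5 * value t v coeffA + a
  coeffB : (q : ℤ) ∣ 5 * value t v coeffB + b
  coeffC : (q : ℤ) ∣ value t v coeffC + c
  sqrtDisc : ¬ (q : ℤ) ∣ value t v sqrtDisc

namespace IsReduction
variable {T} {i : ZMod 5} {t v : ℤ} {a b c : ℕ} (h : IsReduction T P q i t v a b c)
  [P.IsPrime] [CharP (𝓞 L ⧸ P) q]
include h

theorem value_eq (x : QuinticInt) :
    value (Ideal.Quotient.mk P (T.θ i)) (Ideal.Quotient.mk P (T.v i)) x = (value t v x : ℤ) := by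
  rw [h.mk_θ, h.mk_v, intCast_value]

theorem injective (h5 : (5 : 𝓞 L) ∉ P) :
    Function.Injective fun j => Ideal.Quotient.mk P (T.α i j) := by
  refine T.injective_mk_α h5 i ?_
  rw [h.value_eq, Ne, CharP.intCast_eq_zero_iff _ q]
  exact h.sqrtDisc

theorem mk_α_pow_five (j : Fin 5) : Ideal.Quotient.mk P (T.α i j) ^ 5 =
    a * Ideal.Quotient.mk P (T.α i j) ^ 2 + b * Ideal.Quotient.mk P (T.α i j) + c := by
  have h0 := congrArg (eval (Ideal.Quotient.mk P (T.α i j))) (T.splits_mk (P := P) i)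
  rw [eval_prod, Finset.prod_eq_zero (Finset.mem_univ j) (by simp), quinticPoly, h.value_eq,
    h.value_eq, h.value_eq] at h0
  simp only [eval_add, eval_mul, eval_pow, eval_X, eval_C] at h0
  have hA := (CharP.intCast_eq_zero_iff (𝓞 L ⧸ P) q _).2 h.coeffA
  have hB := (CharP.intCast_eq_zero_iff (𝓞 L ⧸ P) q _).2 h.coeffB
  have hC := (CharP.intCast_eq_zero_iff (𝓞 L ⧸ P) q _).2 h.coeffC
  push_cast at hA hB hC
  linear_combination h0 - Ideal.Quotient.mk P (T.α i j) ^ 2 * hA -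
    Ideal.Quotient.mk P (T.α i j) * hB - hC

variable {σ : L ≃ₐ[ℚ] L} (hs : T.shift σ = 0) (hσ : ∀ x : 𝓞 L, σ • x - x ^ q ∈ P)
  {l : List Bool} (hl : QuarticPoly.ofDigits l = q)
include hs hσ hl

theorem mk_α_perm_pow (n : ℕ) (j : Fin 5) :
    Ideal.Quotient.mk P (T.α i ((T.perm σ i ^ n) j)) =
      QuarticPoly.value (Ideal.Quotient.mk P (T.α i j))
        ((fun x => QuarticPoly.powMod q a b c x l)^[n] QuarticPoly.var) := by
  have hn : σ ^ n • T.α i j = T.α i ((T.perm σ i ^ n) j) := by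
    induction n with
    | zero => simp
    | succ n ih => rw [pow_succ', mul_smul, ih, smul_α, hs, add_zero, pow_succ']; rfl
  rw [QuarticPoly.value_iterate_powMod (CharP.cast_eq_zero _ q) (h.mk_α_pow_five j) hl, ← hn,
    ← map_pow, Ideal.Quotient.eq]
  exact pow_smul_sub_pow_mem hσ n _

theorem perm_pow_eq_one (h5 : (5 : 𝓞 L) ∉ P) {n : ℕ}
    (hn : (fun x => QuarticPoly.powMod q a b c x l)^[n] QuarticPoly.var = QuarticPoly.var) :
    T.perm σ i ^ n = 1 := by
  ext1 j
  apply h.injective h5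
  simp only [h.mk_α_perm_pow hs hσ hl, hn, QuarticPoly.value_var, Equiv.Perm.one_apply]

theorem perm_pow_ne_one (h5 : (5 : 𝓞 L) ∉ P) {n : ℕ}
    (hn : ¬ q ∣ ((fun x => QuarticPoly.powMod q a b c x l)^[n] QuarticPoly.var).c₂) :
    T.perm σ i ^ n ≠ 1 := by
  intro h1
  refine hn ((CharP.cast_eq_zero_iff (𝓞 L ⧸ P) q _).1 ?_)
  refine QuarticPoly.natCast_c₂_eq_zero (h.injective h5) _ fun j => ?_
  rw [← h.mk_α_perm_pow hs hσ hl, h1, Equiv.Perm.one_apply]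

end IsReduction

variable [IsGalois ℚ L]

theorem exists_frobenius (hq : q.Prime) (r s : ℤ)
    (hr : (q : ℤ) ∣ r ^ 5 - 10 * r ^ 3 + 5 * r ^ 2 + 10 * r + 1)
    (hs : (q : ℤ) ∣ 7 * s - (2 + 2 * r - r ^ 2 + 3 * r ^ 3 + r ^ 4)) (h7 : ¬ (q : ℤ) ∣ 7) :
    ∃ (P : Ideal (𝓞 L)) (_ : P.IsPrime) (_ : CharP (𝓞 L ⧸ P) q) (σ : L ≃ₐ[ℚ] L) (i : ZMod 5),
      (∀ x : 𝓞 L, σ • x - x ^ q ∈ P) ∧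
      ∀ k, Ideal.Quotient.mk P (T.θ (i + k)) = (value r s (conjT k) : ℤ) ∧
        Ideal.Quotient.mk P (T.v (i + k)) = (value r s (conjV k) : ℤ) := by
  have : (Ideal.span {(q : ℤ)}).IsMaximal :=
    PrincipalIdealRing.isMaximal_of_irreducible (Nat.prime_iff_prime_int.1 hq).irreducible
  obtain ⟨P, hPm, hP⟩ := Ideal.exists_maximal_ideal_liesOver_of_isIntegral (S := 𝓞 L)
    (Ideal.span {(q : ℤ)})
  have hqP : (q : 𝓞 L ⧸ P) = 0 := by
    rw [← map_natCast (Ideal.Quotient.mk P), Ideal.Quotient.eq_zero_iff_mem]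
    have : (q : ℤ) ∈ P.under ℤ := by
      rw [← hP.over]
      exact Ideal.mem_span_singleton_self _
    simpa using this
  have hchar : CharP (𝓞 L ⧸ P) q := (CharP.charP_iff_prime_eq_zero hq).2 hqP
  obtain ⟨σ, hσ⟩ := IsArithFrobAt.exists_of_isInvariant ℤ (L ≃ₐ[ℚ] L) P
  have hp := T.pair_mk (P := P)
  have hr' := (CharP.intCast_eq_zero_iff (𝓞 L ⧸ P) q _).2 hr
  have hs' := (CharP.intCast_eq_zero_iff (𝓞 L ⧸ P) q _).2 hs
  have h7' := (CharP.intCast_eq_zero_iff (𝓞 L ⧸ P) q _).not.2 h7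
  push_cast at hr' hs' h7'
  obtain ⟨i, hi⟩ : ∃ i, Ideal.Quotient.mk P (T.θ i) = r := by
    have := (hp 0).prod_sub_conjT (r : 𝓞 L ⧸ P)
    rw [hr', Finset.prod_eq_zero_iff] at this
    obtain ⟨k, -, hk⟩ := this
    refine ⟨0 + k, ?_⟩
    rw [T.θ_add, map_value, ← sub_eq_zero.1 hk]
  have hi' : Ideal.Quotient.mk P (T.v i) = s := by
    refine mul_left_cancel₀ h7' ?_
    have := (hp i).t4
    rw [hi] at this
    linear_combination -hs' - this
  refine ⟨P, hPm.isPrime, hchar, σ, i, fun x => ?_, fun k => ?_⟩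
  · have := hσ x
    rwa [← hP.over, Int.card_ideal_quot] at this
  · rw [T.θ_add, T.v_add, map_value, map_value, hi, hi', intCast_value, intCast_value]
    exact ⟨rfl, rfl⟩

theorem hasLocalElement (hq : q.Prime) (r s : ℤ) (a b c : ZMod 5 → ℕ) (l : List Bool) (n m : ℕ)
    (hr : (q : ℤ) ∣ r ^ 5 - 10 * r ^ 3 + 5 * r ^ 2 + 10 * r + 1)
    (hs : (q : ℤ) ∣ 7 * s - (2 + 2 * r - r ^ 2 + 3 * r ^ 3 + r ^ 4))
    (h7 : ¬ (q : ℤ) ∣ 7) (h5 : ¬ (q : ℤ) ∣ 5)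
    (hA : ∀ k, (q : ℤ) ∣ 5 * value (value r s (conjT k)) (value r s (conjV k)) coeffA + a k)
    (hB : ∀ k, (q : ℤ) ∣ 5 * value (value r s (conjT k)) (value r s (conjV k)) coeffB + b k)
    (hC : ∀ k, (q : ℤ) ∣ value (value r s (conjT k)) (value r s (conjV k)) coeffC + c k)
    (hE : ∀ k, ¬ (q : ℤ) ∣ value (value r s (conjT k)) (value r s (conjV k)) sqrtDisc)
    (hl : QuarticPoly.ofDigits l = q)
    (hn : ∀ k ≠ 0, (fun x => QuarticPoly.powMod q (a k) (b k) (c k) x l)^[n] QuarticPoly.var =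
      QuarticPoly.var)
    (hm : (fun x => QuarticPoly.powMod q (a 0) (b 0) (c 0) x l)^[n * m] QuarticPoly.var =
      QuarticPoly.var)
    (hm' : ¬ q ∣
      ((fun x => QuarticPoly.powMod q (a 0) (b 0) (c 0) x l)^[n] QuarticPoly.var).c₂) :
    T.blockAction.HasLocalElement m := by
  obtain ⟨P, hP, hchar, σ, i, hσ, hi⟩ := T.exists_frobenius hq r s hr hs h7
  have hred k : IsReduction T P q (i + k) _ _ (a k) (b k) (c k) :=
    ⟨(hi k).1, (hi k).2, hA k, hB k, hC k, hE k⟩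
  have h5P : (5 : 𝓞 L) ∉ P := by
    rw [← Ideal.Quotient.eq_zero_iff_mem, map_ofNat]
    exact_mod_cast (CharP.intCast_eq_zero_iff (𝓞 L ⧸ P) q 5).not.2 h5
  have hfix (x : 𝓞 L) (z : ℤ) (hx : Ideal.Quotient.mk P x = z) : σ • x - x ∈ P := by
    rw [← Ideal.Quotient.eq, Ideal.Quotient.eq.2 (hσ x), map_pow, hx]
    have := Fact.mk hq
    exact map_intCast (frobenius (𝓞 L ⧸ P) q) z
  have hshift : T.shift σ = 0 :=
    T.shift_eq_zero_of_sub_mem h5P (hfix _ _ (hi 0).1) (hfix _ _ (hi 0).2)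
  have hσ' : T.blockAction.shift σ = 1 := T.blockAction_shift.2 hshift
  have hpow (n : ℕ) (j : ZMod 5) : T.blockAction.perm (σ ^ n) j = T.perm σ j ^ n := by
    induction n with
    | zero => exact T.blockAction.perm_one j
    | succ n ih => rw [pow_succ, T.blockAction.perm_mul_of_shift_eq_one _ hσ', ih, pow_succ]; rfl
  refine ⟨σ ^ n, i + 0, by rw [map_pow, hσ', one_pow], fun j hj => ?_, ?_, ?_⟩
  · rw [hpow]
    have := hred (j - i)
    rw [add_sub_cancel] at this
    exact this.perm_pow_eq_one hshift hσ hl h5P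
      (hn _ fun h => hj (by rw [← h, add_sub_cancel]))
  · rw [hpow, ← pow_mul]
    exact (hred 0).perm_pow_eq_one hshift hσ hl h5P hm
  · rw [hpow]
    exact (hred 0).perm_pow_ne_one hshift hσ hl h5P hm'

theorem hasLocalElement_five (T : QuinticTower L) : T.blockAction.HasLocalElement 5 :=
  T.hasLocalElement (q := 101) (by norm_num) 4 92
    ![31, 86, 3, 7, 25] ![53, 36, 21, 95, 74] ![55, 27, 19, 9, 3]
    [true, true, false, false, true, false, true] 6 5
    (by decide +kernel) (by decide +kernel) (by decide +kernel) (by decide +kernel)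
    (by decide +kernel) (by decide +kernel) (by decide +kernel) (by decide +kernel)
    (by decide +kernel) (by decide +kernel) (by decide +kernel) (by decide +kernel)

theorem hasLocalElement_three (T : QuinticTower L) : T.blockAction.HasLocalElement 3 :=
  T.hasLocalElement (q := 107) (by norm_num) 89 34
    ![4, 14, 88, 1, 57] ![68, 103, 82, 71, 86] ![51, 78, 11, 93, 5]
    [true, true, false, true, false, true, true] 4 3
    (by decide +kernel) (by decide +kernel) (by decide +kernel) (by decide +kernel)
    (by decide +kernel) (by decide +kernel) (by decide +kernel) (by decide +kernel)
    (by decide +kernel) (by decide +kernel) (by decide +kernel) (by decide +kernel)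

end QuinticTower
end QuinticField

section QuinticField
open Polynomial QuinticInt NumberField

section CommRing
variable {R S : Type*} [CommRing R] [CommRing S] {t v : R}

theorem IsQuinticPair.of_map {f : R →+* S} (hf : Function.Injective f)
    (h : IsQuinticPair (f t) (f v)) : IsQuinticPair t v := by
  constructor <;> apply hf
  · simpa [map_ofNat] using h.t4
  · simpa [map_ofNat] using h.t5
  · simpa [map_ofNat] using h.t6
  · simpa [map_ofNat] using h.tv
  · simpa [map_ofNat] using h.t2v
  · simpa [map_ofNat] using h.t3v
  · simpa [map_ofNat] using h.vv

theorem IsQuinticPair.isIntegral_left (h : IsQuinticPair t v) : IsIntegral ℤ t := by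
  refine ⟨X ^ 5 - 10 * X ^ 3 + 5 * X ^ 2 + 10 * X + 1, by monicity!, ?_⟩
  simp only [eval₂_add, eval₂_sub, eval₂_mul, eval₂_pow, eval₂_X, eval₂_one, eval₂_ofNat]
  linear_combination h.t5

theorem IsQuinticPair.isIntegral_right (h : IsQuinticPair t v) : IsIntegral ℤ v := by
  refine ⟨X ^ 5 - 15 * X ^ 4 + 25 * X ^ 3 + 30 * X ^ 2 - 5 * X - 1, by monicity!, ?_⟩
  simp only [eval₂_add, eval₂_sub, eval₂_mul, eval₂_pow, eval₂_X, eval₂_one, eval₂_ofNat]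
  let w : QuinticInt := ⟨0, 0, 0, 0, 1⟩
  have := congrArg (value t v) (by decide +kernel : w * (w * (w * (w * w))) =
    ofInt 15 * (w * (w * (w * w))) - ofInt 25 * (w * (w * w)) - ofInt 30 * (w * w) + ofInt 5 * w
      + ofInt 1)
  have hw : value t v w = v := by simp [value, w]
  simp only [value_add, value_sub, value_mul h, value_ofInt, hw] at this
  push_cast at this
  linear_combination this

theorem monic_quinticPoly [Nontrivial R] : (quinticPoly t v).Monic := by
  rw [quinticPoly]
  monicity!

theorem natDegree_quinticPoly [Nontrivial R] : (quinticPoly t v).natDegree = 5 := by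
  rw [quinticPoly]
  compute_degree!

theorem IsQuinticPair.isIntegral_of_isRoot [Nontrivial R] (h : IsQuinticPair t v) {x : R}
    (hx : (quinticPoly t v).IsRoot x) : IsIntegral ℤ x := by
  refine isIntegral_trans (A := integralClosure ℤ R) x
    ⟨quinticPoly ⟨t, h.isIntegral_left⟩ ⟨v, h.isIntegral_right⟩, monic_quinticPoly, ?_⟩
  rw [← eval_map, quinticPoly_map]
  exact hx

end CommRing

theorem exists_quinticPoly_eq_prod {k : Type*} [Field k] [IsAlgClosed k] (t v : k) :
    ∃ α : Fin 5 → k, quinticPoly t v = ∏ j, (X - C (α j)) := by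
  have hs := IsAlgClosed.splits (quinticPoly t v)
  have hc := hs.natDegree_eq_card_roots
  have hp := hs.eq_prod_roots_of_monic monic_quinticPoly
  rw [natDegree_quinticPoly] at hc
  generalize (quinticPoly t v).roots = s at hc hp
  induction s using Quotient.inductionOn with
  | _ l =>
    have hl : l.length = 5 := by simpa using hc.symm
    refine ⟨fun j => l.get (j.cast hl.symm), ?_⟩
    rw [hp, ← List.prod_ofFn]
    simp only [Multiset.quot_mk_to_coe, Multiset.map_coe, Multiset.prod_coe]
    congr 1
    refine List.ext_get (by simp [hl]) fun n h₁ h₂ => ?_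
    rw [List.get_ofFn]
    simp

theorem exists_isQuinticPair (k : Type*) [Field k] [IsAlgClosed k] [CharZero k] :
    ∃ t v : k, IsQuinticPair t v := by
  have hd : (X ^ 5 - 10 * X ^ 3 + 5 * X ^ 2 + 10 * X + 1 : k[X]).degree = 5 := by compute_degree!
  obtain ⟨t, ht⟩ := IsAlgClosed.exists_root _ (hd.trans_ne (by norm_num))
  refine ⟨t, (2 + 2 * t - t ^ 2 + 3 * t ^ 3 + t ^ 4) / 7, .of_root ?_ (by field_simp)⟩
  simpa [IsRoot.def] using ht

/-- The conjugates of a cyclic quintic irrationality and the roots of the attached quintics. -/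
structure IsQuinticFamily {R : Type*} [CommRing R] (t v : ZMod 5 → R) (α : ZMod 5 → Fin 5 → R) :
    Prop where
  pair : ∀ i, IsQuinticPair (t i) (v i)
  t_add : ∀ i k, t (i + k) = value (t i) (v i) (conjT k)
  v_add : ∀ i k, v (i + k) = value (t i) (v i) (conjV k)
  splits : ∀ i, quinticPoly (t i) (v i) = ∏ j, (X - C (α i j))

theorem exists_isQuinticFamily (k : Type*) [Field k] [IsAlgClosed k] [CharZero k] :
    ∃ (t v : ZMod 5 → k) (α : ZMod 5 → Fin 5 → k), IsQuinticFamily t v α := by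
  obtain ⟨t, v, h⟩ := exists_isQuinticPair k
  choose α hα using fun i =>
    exists_quinticPoly_eq_prod (value t v (conjT i)) (value t v (conjV i))
  refine ⟨_, _, α, fun i => h.conj i, fun i j => ?_, fun i j => ?_, hα⟩
  · rw [← value_conj h, conj_conjT]
  · rw [← value_conj h, conj_conjV]

namespace IsQuinticFamily

theorem of_map {R S : Type*} [CommRing R] [CommRing S] {f : R →+* S} (hf : Function.Injective f)
    {t v : ZMod 5 → R} {α : ZMod 5 → Fin 5 → R}
    (h : IsQuinticFamily (fun i => f (t i)) (fun i => f (v i)) fun i j => f (α i j)) :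
    IsQuinticFamily t v α where
  pair i := .of_map hf (h.pair i)
  t_add i k := hf (by rw [map_value]; exact h.t_add i k)
  v_add i k := hf (by rw [map_value]; exact h.v_add i k)
  splits i := Polynomial.map_injective f hf (by
    rw [quinticPoly_map, h.splits, Polynomial.map_prod]
    simp)

section
variable {R : Type*} [CommRing R] [Nontrivial R] {t v : ZMod 5 → R} {α : ZMod 5 → Fin 5 → R}
  (h : IsQuinticFamily t v α)

/-- The set of all the conjugates and roots. -/
def range (t v : ZMod 5 → R) (α : ZMod 5 → Fin 5 → R) : Set R :=
  Set.range t ∪ Set.range v ∪ Set.range fun i : ZMod 5 × Fin 5 => α i.1 i.2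

include h

theorem isIntegral {x : R} (hx : x ∈ range t v α) : IsIntegral ℤ x := by
  obtain (⟨i, rfl⟩ | ⟨i, rfl⟩) | ⟨⟨i, j⟩, rfl⟩ := hx
  · exact (h.pair i).isIntegral_left
  · exact (h.pair i).isIntegral_right
  · refine (h.pair i).isIntegral_of_isRoot ?_
    rw [h.splits, IsRoot.def, eval_prod, Finset.prod_eq_zero (Finset.mem_univ j) (by simp)]

end

theorem map_mem_range {R : Type*} [CommRing R] [IsDomain R] [CharZero R] {t v : ZMod 5 → R}
    {α : ZMod 5 → Fin 5 → R} (h : IsQuinticFamily t v α) (f : R →+* R) {x : R}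
    (hx : x ∈ range t v α) : f x ∈ range t v α := by
  have hf := (h.pair 0).map f
  obtain ⟨k, hk⟩ : ∃ k, f (t 0) = t k := by
    have := (h.pair 0).prod_sub_conjT (f (t 0))
    rw [show f (t 0) ^ 5 - 10 * f (t 0) ^ 3 + 5 * f (t 0) ^ 2 + 10 * f (t 0) + 1 = 0 by
      linear_combination hf.t5, Finset.prod_eq_zero_iff] at this
    obtain ⟨k, -, hk⟩ := this
    exact ⟨k, by rw [← zero_add k, h.t_add, ← sub_eq_zero, hk]⟩
  have hv : f (v 0) = v k := hf.eq_of_left_eq (by rw [hk]; exact h.pair k)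
  have ht (i) : f (t i) = t (k + i) := by
    rw [← zero_add i, h.t_add, map_value, hk, hv, zero_add, h.t_add]
  have hv (i) : f (v i) = v (k + i) := by
    rw [← zero_add i, h.v_add, map_value, hk, hv, zero_add, h.v_add]
  obtain (⟨i, rfl⟩ | ⟨i, rfl⟩) | ⟨⟨i, j⟩, rfl⟩ := hx
  · exact .inl (.inl ⟨_, (ht i).symm⟩)
  · exact .inl (.inr ⟨_, (hv i).symm⟩)
  · have hq : (quinticPoly (t i) (v i)).map f = quinticPoly (t (k + i)) (v (k + i)) := by
      rw [quinticPoly_map, ht, hv]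
    have := congrArg (eval (f (α i j))) hq
    rw [h.splits, h.splits, Polynomial.map_prod, eval_prod, eval_prod,
      Finset.prod_eq_zero (Finset.mem_univ j) (by simp), eq_comm, Finset.prod_eq_zero_iff] at this
    obtain ⟨j', -, hj⟩ := this
    rw [eval_sub, eval_X, eval_C, sub_eq_zero] at hj
    exact .inr ⟨(k + i, j'), hj.symm⟩

end IsQuinticFamily

theorem exists_quinticTower : ∃ (L : Type) (_ : Field L) (_ : NumberField L) (_ : IsGalois ℚ L),
    Nonempty (QuinticTower L) := by
  obtain ⟨t, v, α, h⟩ := exists_isQuinticFamily (AlgebraicClosure ℚ)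
  let S := IsQuinticFamily.range t v α
  have hfin : Finite S := by
    rw [Set.finite_coe_iff]
    exact ((Set.finite_range _).union (Set.finite_range _)).union (Set.finite_range _)
  let L := IntermediateField.adjoin ℚ S
  have hL : FiniteDimensional ℚ L :=
    IntermediateField.finiteDimensional_adjoin fun x hx => (h.isIntegral hx).tower_top
  have hA : Normal ℚ (AlgebraicClosure ℚ) := by
    rw [Subsingleton.elim DivisionRing.toRatAlgebra (AlgebraicClosure.instAlgebra ℚ)]
    exact @IsAlgClosure.normal ℚ (AlgebraicClosure ℚ) _ _ (AlgebraicClosure.instAlgebra ℚ) _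
  have hN : Normal ℚ L := by
    refine IntermediateField.normal_iff_forall_map_le.2 fun σ => ?_
    rw [IntermediateField.adjoin_map, IntermediateField.adjoin_le_iff]
    rintro _ ⟨x, hx, rfl⟩
    exact IntermediateField.subset_adjoin _ _ (h.map_mem_range (σ : _ →+* _) hx)
  have : NumberField L := ⟨⟩
  let f : 𝓞 L →+* AlgebraicClosure ℚ := (algebraMap L _).comp (algebraMap (𝓞 L) L)
  have hf : Function.Injective f :=
    (algebraMap L (AlgebraicClosure ℚ)).injective.comp RingOfIntegers.coe_injective
  have hlift (x) (hx : x ∈ S) : ∃ y, f y = x := by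
    refine ⟨⟨⟨x, IntermediateField.subset_adjoin _ _ hx⟩, ?_⟩, rfl⟩
    exact (isIntegral_algebraMap_iff (algebraMap L (AlgebraicClosure ℚ)).injective).1
      (h.isIntegral hx)
  choose θ hθ using fun i => hlift (t i) (.inl (.inl ⟨i, rfl⟩))
  choose w hw using fun i => hlift (v i) (.inl (.inr ⟨i, rfl⟩))
  choose β hβ using fun i j => hlift (α i j) (.inr ⟨(i, j), rfl⟩)
  have h' : IsQuinticFamily θ w β := .of_map hf (by simpa only [hθ, hw, hβ] using h)
  refine ⟨L, inferInstance, inferInstance, ⟨⟩, ⟨⟨θ, w, β, h'.pair, h'.t_add, h'.v_add, h'.splits,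
    fun σ hσ hσ' => ?_⟩⟩⟩
  have hcoe (y : 𝓞 L) (hy : σ • y = y) (x) (hx : x ∈ S) (hxy : f y = x) :
      σ ⟨x, IntermediateField.subset_adjoin _ _ hx⟩ =
        ⟨x, IntermediateField.subset_adjoin _ _ hx⟩ := by
    have : (⟨x, IntermediateField.subset_adjoin _ _ hx⟩ : L) = algebraMap (𝓞 L) L y :=
      Subtype.ext hxy.symm
    rw [this]
    exact congrArg (algebraMap (𝓞 L) L) hy
  have hσv (i) : σ • w i = w i := by
    have := (h'.pair i).map (MulSemiringAction.toRingHom (L ≃ₐ[ℚ] L) (𝓞 L) σ)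
    rw [show MulSemiringAction.toRingHom (L ≃ₐ[ℚ] L) (𝓞 L) σ (θ i) = θ i from hσ i] at this
    exact this.eq_of_left_eq (h'.pair i)
  refine AlgEquiv.coe_toAlgHom_injective (IntermediateField.algHom_ext_of_eq_adjoin ℚ rfl ?_)
  intro x hx
  obtain (⟨i, rfl⟩ | ⟨i, rfl⟩) | ⟨⟨i, j⟩, rfl⟩ := id hx
  · exact hcoe _ (hσ i) _ hx (hθ i)
  · exact hcoe _ (hσv i) _ hx (hw i)
  · exact hcoe _ (hσ' i j) _ hx (hβ i j)

end QuinticField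

/-- There is a finite Galois extension `L` of `ℚ`, ramified only at `5`, with Galois group
isomorphic to `(PSL₂(F₅))⁵ ⋊ ℤ/10ℤ` for some action of `ℤ/10ℤ` on the product of `5` copies of
`PSL₂(F₅)`; in particular the Galois group is not solvable.  Moreover `L` can be taken with
`|disc L|^20 ≤ 5^(61⬝[L:ℚ])` (root discriminant at most `5^(61/20) < 135.48`). -/
theorem nonsolvable_field_ramified_only_at_five_PSL2_F5_pow_five :
    ∃ (L : Type) (_ : Field L) (_ : NumberField L) (_ : IsGalois ℚ L),
      (∀ q : ℕ, q.Prime → q ∣ (NumberField.discr L).natAbs → q = 5) ∧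
      (∃ φ : Multiplicative (ZMod 10) →* MulAut (Fin 5 → PSL2 (ZMod 5)),
        Nonempty ((L ≃ₐ[ℚ] L) ≃*
          SemidirectProduct (Fin 5 → PSL2 (ZMod 5)) (Multiplicative (ZMod 10)) φ)) ∧
      ¬ IsSolvable (L ≃ₐ[ℚ] L) ∧
      (NumberField.discr L).natAbs ^ 20 ≤ 5 ^ (61 * Module.finrank ℚ L) := by
  obtain ⟨L, _, _, _, ⟨T⟩⟩ := exists_quinticTower
  have hd := T.natAbs_discr_pow_dvd
  obtain ⟨t, ht⟩ := T.exists_shift_ne_zero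
  obtain ⟨o, ho, ho'⟩ := T.exists_sign_eq_neg_one
  have ht' : T.blockAction.shift t ≠ 1 := T.blockAction_shift.not.2 ht
  refine ⟨L, inferInstance, inferInstance, inferInstance, fun q hq h => ?_,
    T.blockAction.exists_semidirectProduct T.hasLocalElement_three T.hasLocalElement_five ht'
      (T.blockAction_shift.2 ho) ho' pslTwoFiveEquiv,
    T.blockAction.not_isSolvable T.hasLocalElement_three T.hasLocalElement_five ht',
    Nat.le_of_dvd (by positivity) hd⟩
  exact (Nat.prime_dvd_prime_iff_eq hq (by norm_num)).1
    (hq.dvd_of_dvd_pow ((dvd_pow h (by norm_num)).trans hd))
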